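/- Let (A, 𝔪, k) be a local complete intersection of codimension c, let M be a finitely generated A-module, let η_1, …, η_t ∈ H = k[χ_1,…,χ_c] be homogeneous elements of positive degree, and let T be a finitely generated A-module whose support variety satisfies V(T) = V_H(η_1, …, η_t). If Ext^i_A(M,T) = 0 for all i ≫ 0, then cx M ≤ t. -/

import Mathlib

open CategoryTheory Opposite Filter IsLocalRing

universe u

namespace ComplexityTest

variable (A : Type u) [CommRing A] [IsLocalRing A]

structure MinFreeRes (M : Type u) [AddCommGroup M] [Module A M] : Type u where
  b : ℕ → ℕ
  d : (n : ℕ) → ((Fin (b (n + 1)) → A) →ₗ[A] (Fin (b n) → A))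
  aug : (Fin (b 0) → A) →ₗ[A] M
  aug_surjective : Function.Surjective aug
  exact_zero : Function.Exact (d 0) aug
  exact_succ : ∀ n, Function.Exact (d (n + 1)) (d n)
  minimal : ∀ n x i, d n x i ∈ maximalIdeal A

variable (M : Type u) [AddCommGroup M] [Module A M]

def HasComplexityLE (t : ℕ) : Prop :=
  ∃ (R : MinFreeRes A M) (a : ℝ), ∀ᶠ n : ℕ in atTop, (R.b n : ℝ) ≤ a * (n : ℝ) ^ ((t : ℤ) - 1)

noncomputable def complexity : ℕ∞ :=
  sInf {c : ℕ∞ | ∃ t : ℕ, c = t ∧ HasComplexityLE A M t}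

def HasProjDimLE (t : ℕ) : Prop :=
  ∃ R : MinFreeRes A M, ∀ i, t < i → R.b i = 0

noncomputable def projDim : ℕ∞ :=
  sInf {c : ℕ∞ | ∃ t : ℕ, c = t ∧ HasProjDimLE A M t}

def HasFiniteProjDim : Prop :=
  ∃ t : ℕ, HasProjDimLE A M t

def IsSyzygyOf (S : Type u) [AddCommGroup S] [Module A S] : ℕ → Prop
  | 0 => Nonempty (S ≃ₗ[A] M)
  | 1 => ∃ R : MinFreeRes A M, Nonempty (S ≃ₗ[A] (LinearMap.ker R.aug))
  | (n + 2) => ∃ R : MinFreeRes A M, Nonempty (S ≃ₗ[A] (LinearMap.ker (R.d n)))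

variable {A M} in
def IsSES {K S : Type u} [AddCommGroup K] [Module A K] [AddCommGroup S] [Module A S]
    (f : M →ₗ[A] K) (g : K →ₗ[A] S) : Prop :=
  Function.Injective f ∧ Function.Exact f g ∧ Function.Surjective g

noncomputable def extModule (n : ℕ) (N : Type u) [AddCommGroup N] [Module A N] :
    ModuleCat A :=
  ((_root_.Ext A (ModuleCat.{u} A) n).obj (op (ModuleCat.of A M))).obj (ModuleCat.of A N)

def extVanish (n : ℕ) (N : Type u) [AddCommGroup N] [Module A N] : Prop :=
  Subsingleton (extModule A M n N)

/-- The `n`-th Tor module `Tor^A_n(M, N)`. -/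
noncomputable def torModule (n : ℕ) (N : Type u) [AddCommGroup N] [Module A N] :
    ModuleCat A :=
  ((Tor (ModuleCat.{u} A) n).obj (ModuleCat.of A M)).obj (ModuleCat.of A N)

/-- The vanishing `Tor^A_n(M, N) = 0`. -/
def torVanish (n : ℕ) (N : Type u) [AddCommGroup N] [Module A N] : Prop :=
  Subsingleton (torModule A M n N)

noncomputable def depth : ℕ∞ :=
  sInf {c : ℕ∞ | ∃ i : ℕ, c = i ∧ ¬ extVanish A (ResidueField A) i M}

variable {A}

/-- The category of modules of *free reducible complexity* over the local ring `A`.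
It is defined inductively: every finitely generated module of finite projective
dimension has free reducible complexity, and a finitely generated module `M` of finite
positive complexity has free reducible complexity provided there is a short exact
sequence `0 → M → K → Ω^n_A(M) → 0` (necessarily induced by a cohomology element
`η ∈ Ext^{n+1}_A(M,M)`) where `K` is a finitely generated module of free reducible
complexity with `cx K = cx M - 1`. -/
inductive HasFreeRedCxCat : ModuleCat.{u} A → Prop
  | of_finite_projDim (M : ModuleCat.{u} A) (hfg : Module.Finite A M)
      (h : HasFiniteProjDim A M) : HasFreeRedCxCat M
  | step (M K S : ModuleCat.{u} A) (n : ℕ)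
      (hfg : Module.Finite A M) (hKfg : Module.Finite A K)
      (hpos : 0 < complexity A M) (hfin : complexity A M ≠ ⊤)
      (hsyz : IsSyzygyOf A M S n)
      (f : M →ₗ[A] K) (g : K →ₗ[A] S) (hses : IsSES f g)
      (hcx : complexity A K = complexity A M - 1)
      (hK : HasFreeRedCxCat K) : HasFreeRedCxCat M

/-- The category of modules of *reducible complexity* over the local ring `A`: as for
free reducible complexity, but where in addition the reductions are required to
preserve depth. -/
inductive HasRedCxCat : ModuleCat.{u} A → Prop
  | of_finite_projDim (M : ModuleCat.{u} A) (hfg : Module.Finite A M)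
      (h : HasFiniteProjDim A M) : HasRedCxCat M
  | step (M K S : ModuleCat.{u} A) (n : ℕ)
      (hfg : Module.Finite A M) (hKfg : Module.Finite A K)
      (hpos : 0 < complexity A M) (hfin : complexity A M ≠ ⊤)
      (hsyz : IsSyzygyOf A M S n)
      (f : M →ₗ[A] K) (g : K →ₗ[A] S) (hses : IsSES f g)
      (hcx : complexity A K = complexity A M - 1)
      (hdepth : depth A K = depth A M)
      (hK : HasRedCxCat K) : HasRedCxCat M

variable (A)

/-- `M` has free reducible complexity. -/
def HasFreeRedCx (M : Type u) [AddCommGroup M] [Module A M] : Prop :=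
  HasFreeRedCxCat (ModuleCat.of A M)

/-- `M` has reducible complexity. -/
def HasRedCx (M : Type u) [AddCommGroup M] [Module A M] : Prop :=
  HasRedCxCat (ModuleCat.of A M)

/-- A Noetherian local ring is Gorenstein if it has finite injective dimension over
itself; by Bass' characterization, this is equivalent to the vanishing of
`Ext^i_A(k, A)` for all sufficiently large `i`. -/
def IsGorenstein : Prop :=
  ∃ n : ℕ, ∀ i : ℕ, n < i → extVanish A (ResidueField A) i A

end ComplexityTest

open ComplexityTest

namespace ComplexityTest

/-- A regular local ring: a Noetherian local ring whose maximal ideal can be generated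
by `dim A` elements. -/
def IsRegularLocalRing (Q : Type u) [CommRing Q] [IsLocalRing Q] : Prop :=
  IsNoetherianRing Q ∧
    ∃ (n : ℕ) (x : Fin n → Q), Ideal.span (Set.range x) = IsLocalRing.maximalIdeal Q ∧
      (n : WithBot ℕ∞) = ringKrullDim Q

variable (A : Type u) [CommRing A] [IsLocalRing A]

/-- The `𝔪`-adic completion of the local ring `A`. -/
abbrev Completion : Type u := AdicCompletion (IsLocalRing.maximalIdeal A) A

/-- The local ring `A` is a complete intersection: its `𝔪`-adic completion is the
residue ring of a regular local ring modulo an ideal generated by a regular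
sequence. -/
def IsCompleteIntersection : Prop :=
  ∃ (Q : Type u) (_ : CommRing Q),
    ∃ (_ : IsLocalRing Q),
      IsRegularLocalRing Q ∧
        ∃ g : Q →+* Completion A,
          Function.Surjective g ∧
            ∃ rs : List Q, RingTheory.Sequence.IsRegular Q rs ∧
              RingHom.ker g = Ideal.span {x | x ∈ rs}

/-- The embedding dimension of the local ring `A`, i.e. `dim_k 𝔪/𝔪²`. -/
noncomputable def embDim : ℕ :=
  Module.finrank (IsLocalRing.ResidueField A) (IsLocalRing.CotangentSpace A)

/-- The local ring `A` has codimension `c`, i.e. `dim_k (𝔪/𝔪²) - dim A = c`. -/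
def HasCodim (c : ℕ) : Prop :=
  ∃ d : ℕ, ringKrullDim A = (d : WithBot ℕ∞) ∧ embDim A = d + c

end ComplexityTest
namespace ComplexityTest

variable (A : Type u) [CommRing A] [IsLocalRing A]

/-- The graded vector space `E(M,M) = Ext^*_A(M,M) ⊗_A k` over the residue field `k`
of `A`, as the direct sum of the fibers `Ext^n_A(M,M) ⊗_A k`. -/
noncomputable abbrev extFiberAlgebra (M : Type u) [AddCommGroup M] [Module A M] : Type u :=
  DirectSum ℕ (fun n => TensorProduct A (IsLocalRing.ResidueField A) (extModule A M n M))

/-- The auxiliary data of the theory of cohomology operators (the Eisenbud operators)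
over a complete intersection `A` of codimension `c`: for every `A`-module `M`, the
graded `k`-vector space `E(M,M) = Ext^*_A(M,M) ⊗_A k` is a graded module over the
polynomial ring `H = k[χ_1, …, χ_c]`, where the variables `χ_j` act as operators of
cohomological degree `2`, and `E(M,M)` is a finitely generated `H`-module whenever `M`
is a finitely generated `A`-module. -/
structure SupportVarietyTheory (c : ℕ) : Type (u + 1) where
  /-- the `H`-module structure on `E(M,M)` -/
  smul : ∀ (M : Type u) [AddCommGroup M] [Module A M],
    Module (MvPolynomial (Fin c) (IsLocalRing.ResidueField A)) (extFiberAlgebra A M)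
  /-- the `H`-module structure extends the `k`-vector space structure -/
  compat : ∀ (M : Type u) [AddCommGroup M] [Module A M]
      (a : IsLocalRing.ResidueField A) (x : extFiberAlgebra A M),
    letI := smul M
    (MvPolynomial.C a : MvPolynomial (Fin c) (IsLocalRing.ResidueField A)) • x = a • x
  /-- the operators `χ_j` have cohomological degree `2` -/
  degree_two : ∀ (M : Type u) [AddCommGroup M] [Module A M] (j : Fin c) (n : ℕ)
      (x : TensorProduct A (IsLocalRing.ResidueField A) (extModule A M n M)),
    letI := smul M
    ∃ y : TensorProduct A (IsLocalRing.ResidueField A) (extModule A M (n + 2) M),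
      (MvPolynomial.X j : MvPolynomial (Fin c) (IsLocalRing.ResidueField A)) •
          (DirectSum.of (fun m : ℕ =>
            TensorProduct A (IsLocalRing.ResidueField A) (extModule A M m M)) n x) =
        DirectSum.of (fun m : ℕ =>
          TensorProduct A (IsLocalRing.ResidueField A) (extModule A M m M)) (n + 2) y
  /-- `E(M,M)` is a finitely generated `H`-module for finitely generated `M` -/
  finite : ∀ (M : Type u) [AddCommGroup M] [Module A M] [Module.Finite A M],
    letI := smul M
    Module.Finite (MvPolynomial (Fin c) (IsLocalRing.ResidueField A)) (extFiberAlgebra A M)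

/-- The support variety `V(M)` of the `A`-module `M`: the zero locus, inside `k̃^c`
(where `k̃` is the algebraic closure of the residue field `k`), of the annihilator
ideal of `E(M,M) = Ext^*_A(M,M) ⊗_A k` in `H = k[χ_1, …, χ_c]`. -/
noncomputable def supportVariety {c : ℕ} (D : SupportVarietyTheory A c)
    (M : Type u) [AddCommGroup M] [Module A M] :
    Set (Fin c → AlgebraicClosure (IsLocalRing.ResidueField A)) :=
  {α | ∀ f : MvPolynomial (Fin c) (IsLocalRing.ResidueField A),
    (letI := D.smul M
     f ∈ Module.annihilator (MvPolynomial (Fin c) (IsLocalRing.ResidueField A))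
        (extFiberAlgebra A M)) →
      MvPolynomial.aeval α f = 0}

/-- The subvariety `V_H(S) ⊆ k̃^c` cut out by a set `S` of polynomials in
`H = k[χ_1, …, χ_c]`. -/
def polyZeroLocus (c : ℕ) (S : Set (MvPolynomial (Fin c) (IsLocalRing.ResidueField A))) :
    Set (Fin c → AlgebraicClosure (IsLocalRing.ResidueField A)) :=
  {α | ∀ f ∈ S, MvPolynomial.aeval α f = 0}

end ComplexityTest

universe v

namespace CT

/-- stability of a family of submodules under the operators -/
def Stable {A : Type u} [CommRing A] {V : ℕ → Type v} [∀ n, AddCommGroup (V n)]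
    [∀ n, Module A (V n)] {r : ℕ} (X : Fin r → ∀ n, V n →ₗ[A] V (n + 2))
    (W : ∀ n, Submodule A (V n)) : Prop :=
  ∀ j n, ∀ v ∈ W n, X j n v ∈ W (n + 2)

def FGFam {A : Type u} [CommRing A] {V : ℕ → Type v} [∀ n, AddCommGroup (V n)]
    [∀ n, Module A (V n)] {r : ℕ} (X : Fin r → ∀ n, V n →ₗ[A] V (n + 2))
    (W : ∀ n, Submodule A (V n)) : Prop :=
  ∃ N : ℕ, ∀ n, N ≤ n → ∀ v ∈ W (n + 2), ∃ w : Fin r → V n, (∀ j, w j ∈ W n) ∧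
    v = ∑ j, X j n (w j)

theorem exists_ringHom_of_commute {A : Type u} [CommRing A] {D : Type v} [AddCommGroup D]
    [Module A D] {r : ℕ} (x : Fin r → Module.End A D) (hx : ∀ i j, x i * x j = x j * x i) :
    ∃ φ : MvPolynomial (Fin r) A →ₐ[A] Module.End A D, ∀ i, φ (MvPolynomial.X i) = x i := by
  letI : CommRing (Algebra.adjoin A (Set.range x)) := Algebra.adjoinCommRingOfComm A (by
    rintro _ ⟨i, rfl⟩ _ ⟨j, rfl⟩
    exact hx i j)
  refine ⟨(Algebra.adjoin A (Set.range x)).val.comp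
    (MvPolynomial.aeval (fun i => (⟨x i, Algebra.subset_adjoin ⟨i, rfl⟩⟩ :
      Algebra.adjoin A (Set.range x)))), fun i => ?_⟩
  simp

theorem acc_stable {A : Type u} [CommRing A] [IsNoetherianRing A] {V : ℕ → Type v}
    [∀ n, AddCommGroup (V n)]
    [∀ n, Module A (V n)] [∀ n, Module.Finite A (V n)] {r : ℕ}
    (X : Fin r → ∀ n, V n →ₗ[A] V (n + 2))
    (hc : ∀ i j n v, X i (n + 2) (X j n v) = X j (n + 2) (X i n v))
    (hfg : FGFam X (fun _ => ⊤))
    (W : ℕ → ∀ n, Submodule A (V n)) (hs : ∀ i, Stable X (W i))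
    (hm : ∀ i j, i ≤ j → ∀ n, W i n ≤ W j n) :
    ∃ i0, ∀ i, i0 ≤ i → ∀ n, W i n = W i0 n := by
  classical
  let D := DirectSum ℕ V
  let x : Fin r → Module.End A D := fun j =>
    DirectSum.toModule A ℕ D (fun n => (DirectSum.lof A ℕ V (n + 2)).comp (X j n))
  have hxof : ∀ j n v, x j (DirectSum.lof A ℕ V n v) = DirectSum.lof A ℕ V (n + 2) (X j n v) := by
    intro j n v
    exact DirectSum.toModule_lof (R := A) n v
  have hx : ∀ i j, x i * x j = x j * x i := by
    intro i j
    apply DirectSum.linearMap_ext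
    intro n
    ext v
    simp only [LinearMap.comp_apply, Module.End.mul_apply, hxof, hc]
  obtain ⟨φ, hφ⟩ := exists_ringHom_of_commute x hx
  letI : Module (MvPolynomial (Fin r) A) D := Module.compHom D φ.toRingHom
  have hsm : ∀ (p : MvPolynomial (Fin r) A) (d : D), p • d = φ p d := fun p d => rfl
  haveI : IsScalarTower A (MvPolynomial (Fin r) A) D := ⟨by
    intro a p d
    rw [hsm, hsm, map_smul]; rfl⟩
  have hXs : ∀ j n v, (MvPolynomial.X j : MvPolynomial (Fin r) A) • DirectSum.lof A ℕ V n v =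
    DirectSum.lof A ℕ V (n + 2) (X j n v) := by
    intro j n v
    rw [hsm, hφ, hxof]
  have hfin : Module.Finite (MvPolynomial (Fin r) A) D := by
    obtain ⟨N, hN⟩ := hfg
    let P : Submodule (MvPolynomial (Fin r) A) D := ⨆ n : Fin (N + 2),
      Submodule.span (MvPolynomial (Fin r) A) (LinearMap.range (DirectSum.lof A ℕ V n) : Set D)
    have hP : P.FG := by
      apply Submodule.fg_iSup
      intro n
      obtain ⟨s, hs⟩ := (Module.Finite.fg_top : (⊤ : Submodule A (V n)).FG)
      refine ⟨s.image (DirectSum.lof A ℕ V n), ?_⟩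
      apply le_antisymm
      · apply Submodule.span_mono
        intro y hy
        simp only [Finset.coe_image, Set.mem_image] at hy
        obtain ⟨z, _, rfl⟩ := hy
        exact ⟨z, rfl⟩
      · apply Submodule.span_le.2
        rintro _ ⟨z, rfl⟩
        have : z ∈ Submodule.span A (s : Set (V n)) := by rw [hs]; trivial
        rw [SetLike.mem_coe]
        have h2 : Submodule.span A (Set.image (DirectSum.lof A ℕ V n) (s : Set (V n))) ≤
          (Submodule.span (MvPolynomial (Fin r) A) (Set.image (DirectSum.lof A ℕ V n) (s : Set (V n)))).restrictScalars A :=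
          Submodule.span_le_restrictScalars _ _ _
        rw [Finset.coe_image]
        apply h2
        rw [← Submodule.map_span]
        exact ⟨z, this, rfl⟩
    have hall : ∀ n v, DirectSum.lof A ℕ V n v ∈ P := by
      intro n
      induction n using Nat.strong_induction_on with
      | _ n ih =>
        intro v
        by_cases h : n < N + 2
        · have := le_iSup (fun n : Fin (N + 2) => Submodule.span (MvPolynomial (Fin r) A)
            (LinearMap.range (DirectSum.lof A ℕ V n) : Set D)) ⟨n, h⟩
          apply this
          apply Submodule.subset_span
          exact ⟨v, rfl⟩
        · obtain ⟨m, rfl⟩ : ∃ m, n = m + 2 := ⟨n - 2, by omega⟩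
          obtain ⟨w, _, rfl⟩ := hN m (by omega) v trivial
          rw [map_sum]
          apply Submodule.sum_mem
          intro j _
          rw [← hXs]
          exact P.smul_mem _ (ih m (by omega) _)
    have hPt : P = ⊤ := by
      rw [eq_top_iff]
      intro d _
      induction d using DirectSum.induction_on with
      | zero => exact zero_mem _
      | of n v => exact hall n v
      | add a b ha hb => exact add_mem (ha trivial) (hb trivial)
    exact ⟨hPt ▸ hP⟩
  have hnoeth : IsNoetherian (MvPolynomial (Fin r) A) D := inferInstance
  let S : ℕ → Submodule (MvPolynomial (Fin r) A) D := fun i =>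
    { carrier := {d | ∀ n, d n ∈ W i n}
      add_mem' := fun {a b} ha hb n => by
        rw [DirectSum.add_apply]; exact add_mem (ha n) (hb n)
      zero_mem' := fun n => by rw [DirectSum.zero_apply]; exact zero_mem _
      smul_mem' := by
        intro p d hd
        have key : ∀ j (d : D), (∀ n, d n ∈ W i n) → ∀ n, (x j d) n ∈ W i n := by
          intro j d hd n
          have : d = ∑ k ∈ DFinsupp.support d, DirectSum.lof A ℕ V k (d k) := by
            exact (DirectSum.sum_support_of (β := V) d).symm
          rw [this, map_sum, DFinsupp.finsetSum_apply]
          apply Submodule.sum_mem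
          intro k _
          rw [hxof]
          by_cases hk : k + 2 = n
          · subst hk
            rw [DirectSum.lof_apply]
            exact hs i j k _ (hd k)
          · rw [DirectSum.lof_eq_of, DirectSum.of_eq_of_ne _ _ _ (Ne.symm hk)]
            exact zero_mem _
        rw [hsm]
        induction p using MvPolynomial.induction_on generalizing d with
        | C a =>
          intro n
          have : φ (MvPolynomial.C a) d = a • d := by
            rw [← MvPolynomial.algebraMap_eq, AlgHom.commutes]; rfl
          rw [this, DirectSum.smul_apply]
          exact Submodule.smul_mem _ _ (hd n)
        | add p q hp hq =>
          intro n
          rw [map_add, LinearMap.add_apply, DirectSum.add_apply]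
          exact add_mem (hp hd n) (hq hd n)
        | mul_X p j hp =>
          rw [map_mul, hφ, Module.End.mul_apply]
          exact hp (key j d hd) }
  obtain ⟨i0, hi0⟩ := monotone_stabilizes_iff_noetherian.2 hnoeth
    ⟨S, fun i j hij d hd n => hm i j hij n (hd n)⟩
  refine ⟨i0, fun i hi n => le_antisymm ?_ (hm _ _ hi n)⟩
  intro v hv
  have h1 : DirectSum.lof A ℕ V n v ∈ S i := by
    intro k
    by_cases hk : n = k
    · subst hk; rw [DirectSum.lof_apply]; exact hv
    · rw [DirectSum.lof_eq_of, DirectSum.of_eq_of_ne _ _ _ (Ne.symm hk)]; exact zero_mem _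
  have h2 : S i0 = S i := hi0 i hi
  rw [← h2] at h1
  have := h1 n
  rwa [DirectSum.lof_apply] at this

/-- auxiliary filtration -/
def filt {A : Type u} [CommRing A] {V : ℕ → Type v} [∀ n, AddCommGroup (V n)]
    [∀ n, Module A (V n)] {r : ℕ} (X : Fin r → ∀ n, V n →ₗ[A] V (n + 2))
    (W : ∀ n, Submodule A (V n)) (i : ℕ) : ∀ n, Submodule A (V n)
  | 0 => W 0
  | 1 => W 1
  | (n + 2) => if n + 2 ≤ i then W (n + 2) else
      ⨆ j, (filt X W i n).map (X j n)

theorem fgFam_of_stable {A : Type u} [CommRing A] [IsNoetherianRing A] {V : ℕ → Type v}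
    [∀ n, AddCommGroup (V n)]
    [∀ n, Module A (V n)] [∀ n, Module.Finite A (V n)] {r : ℕ}
    (X : Fin r → ∀ n, V n →ₗ[A] V (n + 2))
    (hc : ∀ i j n v, X i (n + 2) (X j n v) = X j (n + 2) (X i n v))
    (hfg : FGFam X (fun _ => ⊤))
    (W : ∀ n, Submodule A (V n)) (hs : Stable X W) : FGFam X W := by
  have hle : ∀ i n, filt X W i n ≤ W n := by
    intro i n
    induction n using Nat.twoStepInduction with
    | zero => exact le_rfl
    | one => exact le_rfl
    | more n ih _ =>
      rw [filt]
      split_ifs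
      · exact le_rfl
      · refine iSup_le fun j => ?_
        rintro _ ⟨v, hv, rfl⟩
        exact hs j n v (ih hv)
  have hst : ∀ i, Stable X (filt X W i) := by
    intro i j n v hv
    rw [filt]
    split_ifs
    · exact hs j n v (hle i n hv)
    · exact le_iSup (fun j => (filt X W i n).map (X j n)) j ⟨v, hv, rfl⟩
  have hmono : ∀ i j, i ≤ j → ∀ n, filt X W i n ≤ filt X W j n := by
    intro i j hij n
    induction n using Nat.twoStepInduction with
    | zero => exact le_rfl
    | one => exact le_rfl
    | more n ih _ =>
      rw [filt]
      split_ifs with h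
      · rw [filt, if_pos (h.trans hij)]
      · refine iSup_le fun k => ?_
        rintro _ ⟨v, hv, rfl⟩
        exact hst j k n v (ih hv)
  have hself : ∀ n, filt X W n n = W n := by
    intro n
    rcases n with _ | _ | n
    · rfl
    · rfl
    · rw [filt, if_pos le_rfl]
  obtain ⟨i0, hi0⟩ := acc_stable X hc hfg (filt X W) hst hmono
  refine ⟨i0, fun n hn v hv => ?_⟩
  rw [← hself, hi0 (n + 2) (by omega), filt, if_neg (by omega)] at hv
  rw [Submodule.mem_iSup_iff_exists_finsupp] at hv
  obtain ⟨g, hg, rfl⟩ := hv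
  choose w hw hw2 using hg
  refine ⟨w, fun j => hle _ _ (hw j), ?_⟩
  rw [Finsupp.sum_fintype _ _ (fun _ => rfl)]
  exact Finset.sum_congr rfl fun j _ => (hw2 j).symm

end CT

namespace CT

/-- eventually killed by an iterate of the step-two difference operator -/
def EZ (d : ℕ) (h : ℕ → ℝ) : Prop := ∃ N : ℕ, ∀ n, N ≤ n → (fwdDiff 2)^[d] h n = 0

theorem EZ.sub_aux {h g : ℕ → ℝ} (d : ℕ) :
    (fwdDiff 2)^[d] (fun n => h n - g n) =
      fun n => (fwdDiff 2)^[d] h n - (fwdDiff 2)^[d] g n := by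
  induction d with
  | zero => rfl
  | succ d ih =>
    rw [Function.iterate_succ_apply', ih, Function.iterate_succ_apply', Function.iterate_succ_apply']
    ext n; simp only [fwdDiff]; ring

theorem EZ.sub {d : ℕ} {h g : ℕ → ℝ} (H : EZ d h) (G : EZ d g) : EZ d (fun n => h n - g n) := by
  obtain ⟨N, H⟩ := H
  obtain ⟨M, G⟩ := G
  refine ⟨max N M, fun n hn => ?_⟩
  rw [EZ.sub_aux]
  beta_reduce
  rw [H n (le_trans (le_max_left _ _) hn), G n (le_trans (le_max_right _ _) hn), sub_zero]

theorem EZ.of_diff {d : ℕ} {h g : ℕ → ℝ} (G : EZ d g) (hg : ∀ n, h (n + 2) - h n = g n) :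
    EZ (d + 1) h := by
  obtain ⟨N, G⟩ := G
  refine ⟨N, fun n hn => ?_⟩
  rw [Function.iterate_succ_apply]
  have : fwdDiff 2 h = g := by ext n; exact hg n
  rw [this]; exact G n hn

theorem hilbert_serre (K : Type u) [Field K] (r : ℕ) : ∀ (V : ℕ → Type v)
    [∀ n, AddCommGroup (V n)] [∀ n, Module K (V n)] [∀ n, Module.Finite K (V n)]
    (X : Fin r → ∀ n, V n →ₗ[K] V (n + 2))
    (_ : ∀ i j n v, X i (n + 2) (X j n v) = X j (n + 2) (X i n v))
    (_ : FGFam X (fun _ => ⊤)), EZ r (fun n => (Module.finrank K (V n) : ℝ)) := by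
  induction r with
  | zero =>
    intro V _ _ _ X hc hfg
    obtain ⟨N, hN⟩ := hfg
    refine ⟨N + 2, fun n hn => ?_⟩
    obtain ⟨m, rfl⟩ : ∃ m, n = m + 2 := ⟨n - 2, by omega⟩
    have : Subsingleton (V (m + 2)) := by
      refine subsingleton_of_forall_eq 0 fun v => ?_
      obtain ⟨w, _, hw⟩ := hN m (by omega) v trivial
      simpa using hw
    simp [Module.finrank_zero_of_subsingleton]
  | succ r ih =>
    intro V _ _ _ X hc hfg
    let l := Fin.last r
    let Wk : ∀ n, Submodule K (V n) := fun n => LinearMap.ker (X l n)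
    have hst : Stable X Wk := by
      intro j n v hv
      change X l (n + 2) (X j n v) = 0
      rw [hc, LinearMap.mem_ker.1 hv, map_zero]
    have hkfg := fgFam_of_stable X hc hfg Wk hst
    have hk : EZ r (fun n => (Module.finrank K (Wk n) : ℝ)) := by
      refine ih (fun n => Wk n) (fun j n => (X j.castSucc n).restrict (hst j.castSucc n)) ?_ ?_
      · intro i j n v
        ext
        exact hc _ _ _ _
      · obtain ⟨N, hN⟩ := hkfg
        refine ⟨N, fun n hn v _ => ?_⟩
        obtain ⟨w, hw, hv⟩ := hN n hn v v.2
        refine ⟨fun j => ⟨w j.castSucc, hw _⟩, fun _ => trivial, ?_⟩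
        ext
        rw [hv, Fin.sum_univ_castSucc, show X (Fin.last r) n (w (Fin.last r)) = 0 from hw _, add_zero]
        simp
    have hcst : ∀ j n, LinearMap.range (X l n) ≤ (LinearMap.range (X l (n + 2))).comap (X j (n + 2)) := by
      rintro j n _ ⟨v, rfl⟩
      exact ⟨X j n v, hc _ _ _ _⟩
    have hcok : EZ r (fun n => (Module.finrank K (V (n + 2) ⧸ LinearMap.range (X l n)) : ℝ)) := by
      refine ih (fun n => V (n + 2) ⧸ LinearMap.range (X l n))
        (fun j n => Submodule.mapQ _ _ (X j.castSucc (n + 2)) (hcst j.castSucc n)) ?_ ?_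
      · intro i j n v
        obtain ⟨v, rfl⟩ := Submodule.Quotient.mk_surjective _ v
        simp only [Submodule.mapQ_apply]
        rw [hc]
      · obtain ⟨N, hN⟩ := hfg
        refine ⟨N, fun n hn v _ => ?_⟩
        obtain ⟨v, rfl⟩ := Submodule.Quotient.mk_surjective _ v
        obtain ⟨w, hw, hv⟩ := hN (n + 2) (by omega) v trivial
        refine ⟨fun j => Submodule.Quotient.mk (w j.castSucc), fun _ => trivial, ?_⟩
        rw [hv, Fin.sum_univ_castSucc]
        simp only [Submodule.mapQ_apply]
        rw [Submodule.Quotient.mk_add, (Submodule.Quotient.mk_eq_zero (LinearMap.range (X l (n + 2)))).2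
          (LinearMap.mem_range_self (X l (n + 2)) _), add_zero]
        exact map_sum (Submodule.mkQ _) _ _
    refine EZ.of_diff (hcok.sub hk) fun n => ?_
    have h1 := Submodule.finrank_quotient_add_finrank (LinearMap.range (X l n))
    have h2 := LinearMap.finrank_range_add_finrank_ker (X l n)
    have h1' : (Module.finrank K (V (n + 2) ⧸ LinearMap.range (X l n)) : ℝ) +
      Module.finrank K (LinearMap.range (X l n)) = Module.finrank K (V (n + 2)) := by exact_mod_cast h1
    have h2' : (Module.finrank K (LinearMap.range (X l n)) : ℝ) +
      Module.finrank K (Wk n) = Module.finrank K (V n) := by exact_mod_cast h2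
    linarith

open Polynomial in
theorem newton_poly (s : ℕ → ℝ) (d : ℕ) (hs : ∀ n, (fwdDiff 1)^[d] s n = 0) :
    ∃ q : ℝ[X], q.natDegree ≤ d - 1 ∧ ∀ m : ℕ, s m = q.eval (m : ℝ) := by
  have hz : ∀ k, d ≤ k → (fwdDiff 1)^[k] s 0 = 0 := by
    intro k hk
    obtain ⟨e, rfl⟩ := Nat.exists_eq_add_of_le hk
    have : ∀ e n, (fwdDiff 1)^[d + e] s n = 0 := by
      intro e
      induction e with
      | zero => simpa using hs
      | succ e ih =>
        intro n
        rw [← add_assoc, Function.iterate_succ_apply', fwdDiff, ih, ih, sub_zero]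
    exact this e 0
  refine ⟨∑ k ∈ Finset.range d, C ((fwdDiff 1)^[k] s 0 / k.factorial) * descPochhammer ℝ k, ?_, ?_⟩
  · apply natDegree_sum_le_of_forall_le
    intro k hk
    refine (natDegree_C_mul_le _ _).trans ?_
    rw [descPochhammer_natDegree]
    simp at hk; omega
  intro m
  have h := shift_eq_sum_fwdDiff_iter (1 : ℕ) s m 0
  simp only [zero_add, smul_eq_mul, mul_one, nsmul_eq_mul] at h
  rw [h, eval_finsetSum]
  have e1 : ∑ k ∈ Finset.range (m + 1), (m.choose k : ℝ) * (fwdDiff 1)^[k] s 0 =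
      ∑ k ∈ Finset.range (max (m + 1) d), (m.choose k : ℝ) * (fwdDiff 1)^[k] s 0 := by
    apply Finset.sum_subset
    · intro x hx; simp at hx ⊢; omega
    · intro x _ hx
      rw [Nat.choose_eq_zero_of_lt (by simp at hx; omega)]; simp
  have e2 : ∑ k ∈ Finset.range d, (m.choose k : ℝ) * (fwdDiff 1)^[k] s 0 =
      ∑ k ∈ Finset.range (max (m + 1) d), (m.choose k : ℝ) * (fwdDiff 1)^[k] s 0 := by
    apply Finset.sum_subset
    · intro x hx; simp at hx ⊢; omega
    · intro x _ hx
      rw [hz x (by simpa using hx), mul_zero]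
  rw [e1, ← e2]
  apply Finset.sum_congr rfl
  intro k _
  rw [eval_mul, eval_C, descPochhammer_eval_eq_descFactorial, Nat.descFactorial_eq_factorial_mul_choose]
  push_cast
  have : (k.factorial : ℝ) ≠ 0 := by positivity
  field_simp

open Polynomial in
theorem poly_natDegree_le_of_bound (q : ℝ[X]) (C : ℝ) (t : ℕ)
    (h : ∀ m : ℕ, |q.eval (m : ℝ)| ≤ C * ((m : ℝ) + 1) ^ t) : q.natDegree ≤ t := by
  by_contra hlt
  push Not at hlt
  have hq0 : q ≠ 0 := by rintro rfl; simp at hlt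
  have hp : ((X + 1 : ℝ[X]) ^ t) ≠ 0 := (monic_X_add_C (1 : ℝ)).pow t |>.ne_zero
  have hdeg : ((X + 1 : ℝ[X]) ^ t).degree < q.degree := by
    have : ((X + Polynomial.C 1 : ℝ[X]) ^ t).natDegree = t := natDegree_pow_X_add_C t 1
    rw [Polynomial.C_1] at this
    rw [degree_eq_natDegree hp, degree_eq_natDegree hq0, this]
    exact_mod_cast hlt
  have := (Polynomial.abs_div_tendsto_atTop_atTop_of_degree_gt q ((X + 1 : ℝ[X]) ^ t) hdeg hp).comp
    (tendsto_natCast_atTop_atTop (R := ℝ))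
  obtain ⟨m, hm⟩ := (this.eventually_gt_atTop C).exists
  simp only [Function.comp, eval_pow, eval_add, eval_X, eval_one, abs_div] at hm
  have hpos : (0 : ℝ) < ((m : ℝ) + 1) ^ t := by positivity
  rw [abs_of_pos hpos, lt_div_iff₀ hpos] at hm
  linarith [h m]

open Polynomial in
theorem poly_bound (q : ℝ[X]) (t : ℕ) (h : q.natDegree ≤ t) :
    ∃ C : ℝ, ∀ m : ℕ, |q.eval (m : ℝ)| ≤ C * ((m : ℝ) + 1) ^ t := by
  refine ⟨∑ i ∈ Finset.range (t + 1), |q.coeff i|, fun m => ?_⟩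
  rw [eval_eq_sum_range' (Nat.lt_succ_of_le h), Finset.sum_mul]
  refine (Finset.abs_sum_le_sum_abs _ _).trans (Finset.sum_le_sum fun i hi => ?_)
  rw [abs_mul]
  apply mul_le_mul_of_nonneg_left _ (abs_nonneg _)
  rw [abs_pow, Nat.abs_cast]
  have hi' : i ≤ t := by simpa [Nat.lt_succ_iff] using hi
  calc (m : ℝ) ^ i ≤ ((m : ℝ) + 1) ^ i := by gcongr; linarith
    _ ≤ ((m : ℝ) + 1) ^ t := pow_le_pow_right₀ (by linarith [Nat.cast_nonneg (α := ℝ) m]) hi'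

open Polynomial in
theorem regular_growth (s : ℕ → ℝ) (d : ℕ) (hs : ∀ n, (fwdDiff 1)^[d] s n = 0) (C : ℝ) (t : ℕ)
    (hS : ∀ m : ℕ, |∑ i ∈ Finset.range m, s i| ≤ C * ((m : ℝ) + 1) ^ t) :
    (t = 0 → ∀ m, s m = 0) ∧
      (∀ t', t = t' + 1 → ∃ C' : ℝ, ∀ m : ℕ, |s m| ≤ C' * ((m : ℝ) + 1) ^ t') := by
  obtain ⟨q, -, hq⟩ := newton_poly (fun m => ∑ i ∈ Finset.range m, s i) (d + 1) (by
    intro n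
    rw [Function.iterate_succ_apply]
    have : fwdDiff 1 (fun m => ∑ i ∈ Finset.range m, s i) = s := by
      ext n; simp [fwdDiff, Finset.sum_range_succ]
    rw [this]; exact hs n)
  have hdeg : q.natDegree ≤ t := poly_natDegree_le_of_bound q C t (fun m => by
    rw [← hq]; exact hS m)
  have hsm : ∀ m : ℕ, s m = (q.comp (X + Polynomial.C 1) - q).eval (m : ℝ) := by
    intro m
    have h1 := hq (m + 1)
    have h2 := hq m
    simp only [Finset.sum_range_succ] at h1 h2
    rw [eval_sub, eval_comp]
    simp only [eval_add, eval_X, eval_C]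
    push_cast at h1
    linarith
  constructor
  · rintro rfl m
    have : q = Polynomial.C (q.coeff 0) := eq_C_of_natDegree_le_zero hdeg
    rw [hsm, this]; simp
  · rintro t' rfl
    have hd : (q.comp (X + Polynomial.C 1) - q).natDegree ≤ t' := by
      by_cases h0 : q.natDegree = 0
      · have : q = Polynomial.C (q.coeff 0) := eq_C_of_natDegree_eq_zero h0
        rw [this]; simp
      · have hq0 : q ≠ 0 := by rintro rfl; simp at h0
        have hlt : (q.comp (X + Polynomial.C 1) - q).degree < q.degree := by
          have hne : q.comp (X + Polynomial.C 1) ≠ 0 := by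
            intro h
            have := natDegree_comp (p := q) (q := X + Polynomial.C 1)
            rw [h, natDegree_X_add_C, mul_one] at this
            simp at this; exact h0 this.symm
          have hde : (q.comp (X + Polynomial.C 1)).degree = q.degree := by
            rw [degree_eq_natDegree hne, degree_eq_natDegree hq0, natDegree_comp, natDegree_X_add_C,
              mul_one]
          rw [← hde]
          apply degree_sub_lt_left hde hne
          rw [leadingCoeff_comp (by rw [natDegree_X_add_C]; exact one_ne_zero), (monic_X_add_C (1 : ℝ)).leadingCoeff, one_pow, mul_one]
        by_cases hz : q.comp (X + Polynomial.C 1) - q = 0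
        · rw [hz]; simp
        · rw [degree_eq_natDegree hz, degree_eq_natDegree hq0] at hlt
          have : (q.comp (X + Polynomial.C 1) - q).natDegree < q.natDegree := by exact_mod_cast hlt
          omega
    obtain ⟨C', hC'⟩ := poly_bound _ t' hd
    exact ⟨C', fun m => by rw [hsm]; exact hC' m⟩

theorem EZ.class_zero {d N : ℕ} {b : ℕ → ℝ} (hd : ∀ n, N ≤ n → (fwdDiff 2)^[d] b n = 0) (e n : ℕ) :
    (fwdDiff 1)^[d] (fun m => b (N + e + 2 * m)) n = 0 := by
  have : ∀ d n, (fwdDiff 1)^[d] (fun m => b (N + e + 2 * m)) n =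
      (fwdDiff 2)^[d] b (N + e + 2 * n) := by
    intro d
    induction d with
    | zero => intro n; rfl
    | succ d ih =>
      intro n
      rw [Function.iterate_succ_apply', Function.iterate_succ_apply', fwdDiff, fwdDiff, ih, ih]
      rfl
  rw [this]
  exact hd _ (by omega)

/-- the sums of a function killed by the `d`-th difference grow at most like `m ^ d` -/
theorem EZ.sum_le {d : ℕ} {b : ℕ → ℝ} (hb : EZ d b) :
    ∃ C : ℝ, ∀ m : ℕ, (∑ i ∈ Finset.range m, b i) ≤ C * ((m : ℝ) + 1) ^ d := by
  obtain ⟨N, hd⟩ := hb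
  have key : ∀ e : ℕ, ∃ C : ℝ, ∀ m : ℕ, |∑ i ∈ Finset.range m, b (N + e + 2 * i)| ≤
      C * ((m : ℝ) + 1) ^ d := by
    intro e
    obtain ⟨q, hqd, hq⟩ := newton_poly (fun m => ∑ i ∈ Finset.range m, b (N + e + 2 * i)) (d + 1) (by
      intro n
      rw [Function.iterate_succ_apply]
      have : fwdDiff 1 (fun m => ∑ i ∈ Finset.range m, b (N + e + 2 * i)) =
          fun m => b (N + e + 2 * m) := by
        ext n; simp [fwdDiff, Finset.sum_range_succ]
      rw [this]; exact EZ.class_zero hd e n)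
    obtain ⟨C, hC⟩ := poly_bound q d (by simpa using hqd)
    exact ⟨C, fun m => by rw [hq]; exact hC m⟩
  obtain ⟨C0, h0⟩ := key 0
  obtain ⟨C1, h1⟩ := key 1
  have hC0' : 0 ≤ C0 := by simpa using (abs_nonneg _).trans (h0 0)
  have hC1' : 0 ≤ C1 := by simpa using (abs_nonneg _).trans (h1 0)
  have hsplit : ∀ m, ∑ i ∈ Finset.range m, b (N + i) =
      ∑ i ∈ Finset.range ((m + 1) / 2), b (N + 0 + 2 * i) +
        ∑ i ∈ Finset.range (m / 2), b (N + 1 + 2 * i) := by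
    intro m
    induction m with
    | zero => simp
    | succ m ih =>
      rw [Finset.sum_range_succ, ih]
      rcases Nat.even_or_odd' m with ⟨k, rfl | rfl⟩
      · rw [show (2 * k + 1 + 1) / 2 = k + 1 by omega, show (2 * k + 1) / 2 = k by omega,
          show 2 * k / 2 = k by omega, Finset.sum_range_succ, add_zero]
        ring
      · rw [show (2 * k + 1 + 1 + 1) / 2 = k + 1 by omega, show (2 * k + 1 + 1) / 2 = k + 1 by omega,
          show (2 * k + 1) / 2 = k by omega, Finset.sum_range_succ _ k,
          Finset.sum_range_succ _ k, show N + (2 * k + 1) = N + 1 + 2 * k by ring]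
        ring
  refine ⟨∑ i ∈ Finset.range N, |b i| + C0 + C1, fun m => ?_⟩
  have hB : 0 ≤ ∑ i ∈ Finset.range N, |b i| := Finset.sum_nonneg fun i _ => abs_nonneg _
  have hp1 : (1 : ℝ) ≤ ((m : ℝ) + 1) ^ d := one_le_pow₀ (by linarith [Nat.cast_nonneg (α := ℝ) m])
  rcases le_total m N with h | h
  · have : ∑ i ∈ Finset.range m, b i ≤ ∑ i ∈ Finset.range N, |b i| := by
      refine (Finset.sum_le_sum fun i _ => le_abs_self (b i)).trans
        (Finset.sum_le_sum_of_subset_of_nonneg ?_ fun _ _ _ => abs_nonneg _)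
      intro x hx; simp at hx ⊢; omega
    nlinarith
  · obtain ⟨k, rfl⟩ := Nat.exists_eq_add_of_le h
    rw [Finset.sum_range_add, hsplit]
    have a1 := (le_abs_self _).trans (h0 ((k + 1) / 2))
    have a2 := (le_abs_self _).trans (h1 (k / 2))
    have a3 : ∑ i ∈ Finset.range N, b i ≤ ∑ i ∈ Finset.range N, |b i| :=
      Finset.sum_le_sum fun i _ => le_abs_self (b i)
    have b1 : (((((k + 1) / 2 : ℕ) : ℝ)) + 1) ^ d ≤ (((N + k : ℕ) : ℝ) + 1) ^ d := by
      gcongr; omega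
    have b2 : (((((k) / 2 : ℕ) : ℝ)) + 1) ^ d ≤ (((N + k : ℕ) : ℝ) + 1) ^ d := by
      gcongr; omega
    nlinarith [mul_le_mul_of_nonneg_left b1 hC0', mul_le_mul_of_nonneg_left b2 hC1']

theorem growth_of_EZ (b : ℕ → ℕ) {d : ℕ} (hb : EZ d (fun n => (b n : ℝ))) (C : ℝ) (t : ℕ)
    (hS : ∀ m : ℕ, (∑ i ∈ Finset.range m, (b i : ℝ)) ≤ C * ((m : ℝ) + 1) ^ t) :
    ∃ a : ℝ, ∀ᶠ n : ℕ in atTop, (b n : ℝ) ≤ a * (n : ℝ) ^ ((t : ℤ) - 1) := by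
  obtain ⟨N, hd⟩ := hb
  have hC0 : 0 ≤ C := by simpa using hS 0
  -- both residue classes
  have key : ∀ e : ℕ, (t = 0 → ∀ m, (b (N + e + 2 * m) : ℝ) = 0) ∧
      (∀ t', t = t' + 1 → ∃ C' : ℝ, ∀ m : ℕ, |(b (N + e + 2 * m) : ℝ)| ≤ C' * ((m : ℝ) + 1) ^ t') := by
    intro e
    apply regular_growth (fun m => (b (N + e + 2 * m) : ℝ)) d (C := C * ((N : ℝ) + e + 2) ^ t)
    · exact fun n => EZ.class_zero (b := fun n => (b n : ℝ)) hd e n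
    · intro m
      rw [abs_of_nonneg (Finset.sum_nonneg fun i _ => Nat.cast_nonneg _)]
      have h1 : ∑ i ∈ Finset.range m, (b (N + e + 2 * i) : ℝ) ≤
          ∑ i ∈ Finset.range (N + e + 2 * m), (b i : ℝ) := by
        rw [← Finset.sum_image (s := Finset.range m) (g := fun i => N + e + 2 * i) (f := fun i => (b i : ℝ))
          (fun x _ y _ h => by simp only at h; omega)]
        apply Finset.sum_le_sum_of_subset_of_nonneg
        · intro x hx
          simp only [Finset.mem_image, Finset.mem_range] at hx ⊢
          obtain ⟨i, hi, rfl⟩ := hx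
          omega
        · intros; positivity
      refine h1.trans ((hS _).trans ?_)
      rw [mul_assoc, ← mul_pow]
      apply mul_le_mul_of_nonneg_left _ hC0
      push_cast
      gcongr
      nlinarith [Nat.cast_nonneg (α := ℝ) N, Nat.cast_nonneg (α := ℝ) e, Nat.cast_nonneg (α := ℝ) m,
        mul_nonneg (Nat.cast_nonneg (α := ℝ) N) (Nat.cast_nonneg (α := ℝ) m),
        mul_nonneg (Nat.cast_nonneg (α := ℝ) e) (Nat.cast_nonneg (α := ℝ) m)]
  have hn : ∀ n, N ≤ n → ∃ e m, e < 2 ∧ n = N + e + 2 * m := fun n hn =>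
    ⟨(n - N) % 2, (n - N) / 2, Nat.mod_lt _ (by norm_num), by omega⟩
  rcases Nat.eq_zero_or_pos t with ht | ht
  · refine ⟨0, eventually_atTop.2 ⟨N, fun n h => ?_⟩⟩
    obtain ⟨e, m, he, rfl⟩ := hn n h
    rw [(key e).1 ht m]; simp
  · obtain ⟨t', rfl⟩ : ∃ t', t = t' + 1 := ⟨t - 1, by omega⟩
    obtain ⟨C0, h0⟩ := (key 0).2 t' rfl
    obtain ⟨C1, h1⟩ := (key 1).2 t' rfl
    have hC0' : 0 ≤ C0 := by simpa using (abs_nonneg _).trans (h0 0)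
    have hC1' : 0 ≤ C1 := by simpa using (abs_nonneg _).trans (h1 0)
    refine ⟨C0 + C1, eventually_atTop.2 ⟨N + 3, fun n h => ?_⟩⟩
    obtain ⟨e, m, he, rfl⟩ := hn n (by omega)
    have hex : (((t' + 1 : ℕ) : ℤ) - 1) = ((t' : ℕ) : ℤ) := by push_cast; ring
    rw [hex, zpow_natCast]
    have hb : (b (N + e + 2 * m) : ℝ) ≤ (C0 + C1) * ((m : ℝ) + 1) ^ t' := by
      have hp : (0 : ℝ) ≤ ((m : ℝ) + 1) ^ t' := by positivity
      interval_cases e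
      · have := (le_abs_self _).trans (h0 m)
        nlinarith
      · have := (le_abs_self _).trans (h1 m)
        nlinarith
    refine hb.trans ?_
    gcongr
    have : m + 1 ≤ N + e + 2 * m := by omega
    exact_mod_cast this

end CT

namespace CT

section poly
open MvPolynomial
variable {K : Type u} [Field K] {c : ℕ}

noncomputable def gam (I : Ideal (MvPolynomial (Fin c) K)) (m : ℕ) : ℕ :=
  Module.finrank K ((restrictTotalDegree (Fin c) K m).map (Ideal.Quotient.mkₐ K I).toLinearMap)

theorem hc_mul_of_homog {a p : MvPolynomial (Fin c) K} {δ : ℕ} (hp : p.IsHomogeneous δ) (n : ℕ) :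
    homogeneousComponent n (a * p) = if δ ≤ n then homogeneousComponent (n - δ) a * p else 0 := by
  classical
  let _ := MvPolynomial.gradedAlgebra (σ := Fin c) (R := K)
  have key : ∀ (q : MvPolynomial (Fin c) K) i,
      (((DirectSum.decompose (homogeneousSubmodule (Fin c) K)) q i : _) : MvPolynomial (Fin c) K) =
        homogeneousComponent i q := fun q i => decomposition.decompose'_apply q i
  rw [← key, ← key]
  exact DirectSum.coe_decompose_mul_of_right_mem (homogeneousSubmodule (Fin c) K) n (a := a) (b := p)
    (i := δ) hp

theorem trunc_lemma {ι : Type} [Fintype ι] (p : ι → MvPolynomial (Fin c) K) (δ : ι → ℕ)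
    (hp : ∀ i, (p i).IsHomogeneous (δ i)) (a : ι → MvPolynomial (Fin c) K) (m : ℕ)
    (hf : (∑ i, a i * p i).totalDegree ≤ m) :
    ∃ a' : ι → MvPolynomial (Fin c) K, (∑ i, a i * p i) = ∑ i, a' i * p i ∧
      ∀ i, (δ i ≤ m → (a' i).totalDegree ≤ m - δ i) ∧ (m < δ i → a' i = 0) := by
  refine ⟨fun i => if δ i ≤ m then ∑ k ∈ Finset.range (m - δ i + 1), homogeneousComponent k (a i) else 0,
    ?_, fun i => ⟨fun h => ?_, fun h => ?_⟩⟩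
  · have h1 : (∑ i, a i * p i) = ∑ n ∈ Finset.range (m + 1), homogeneousComponent n (∑ i, a i * p i) := by
      conv_lhs => rw [← sum_homogeneousComponent (∑ i, a i * p i)]
      apply Finset.sum_subset
      · intro x hx; simp at hx ⊢; omega
      · intro x _ hx
        apply homogeneousComponent_eq_zero
        simp at hx; omega
    rw [h1]
    simp only [map_sum, hc_mul_of_homog (hp _)]
    rw [Finset.sum_comm]
    apply Finset.sum_congr rfl
    intro i _
    split_ifs with h
    · rw [Finset.sum_mul, ← Finset.sum_filter]
      refine Finset.sum_bij' (fun n _ => n - δ i) (fun k _ => k + δ i) ?_ ?_ ?_ ?_ ?_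
      · intro n hn; simp at hn ⊢; omega
      · intro n hn; simp at hn ⊢; omega
      · intro n hn; simp at hn ⊢; omega
      · intro n hn; simp at hn ⊢
      · intro n hn; rfl
    · rw [zero_mul]
      apply Finset.sum_eq_zero
      intro n hn
      rw [if_neg]
      simp at hn; omega
  · simp only [if_pos h]
    refine (totalDegree_finsetSum _ _).trans (Finset.sup_le fun k hk => ?_)
    refine ((homogeneousComponent_isHomogeneous k (a i)).totalDegree_le).trans ?_
    simp at hk; omega
  · simp only [if_neg (not_le.2 h)]

theorem gam_mono (I : Ideal (MvPolynomial (Fin c) K)) {m n : ℕ} (h : m ≤ n) : gam I m ≤ gam I n := by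
  apply Submodule.finrank_mono
  apply Submodule.map_mono
  intro p hp
  rw [mem_restrictTotalDegree] at hp ⊢
  exact hp.trans h

theorem gam_le_of_le {I J : Ideal (MvPolynomial (Fin c) K)} (h : I ≤ J) (m : ℕ) :
    gam J m ≤ gam I m := by
  have : (restrictTotalDegree (Fin c) K m).map (Ideal.Quotient.mkₐ K J).toLinearMap =
    ((restrictTotalDegree (Fin c) K m).map (Ideal.Quotient.mkₐ K I).toLinearMap).map
      (Ideal.Quotient.factorₐ K h).toLinearMap := by
    rw [← Submodule.map_comp]; rfl
  rw [gam, this]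
  exact Submodule.finrank_map_le _ _

/-- if the part of `J` of degree at most `m` is, modulo `I`, covered by multiples of the `p` -/
theorem gam_le_add {I J L : Ideal (MvPolynomial (Fin c) K)} (h : I ≤ J) (m : ℕ) {ι : Type} [Fintype ι]
    (p : ι → MvPolynomial (Fin c) K) (m' : ℕ) (hp : ∀ i, ∀ a ∈ L, a * p i ∈ I)
    (H : ∀ f ∈ J, f.totalDegree ≤ m → ∃ a : ι → MvPolynomial (Fin c) K,
      (∀ i, (a i).totalDegree ≤ m') ∧ f - ∑ i, a i * p i ∈ I) :
    gam I m ≤ gam J m + Fintype.card ι * gam L m' := by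
  classical
  let D := (restrictTotalDegree (Fin c) K m).map (Ideal.Quotient.mkₐ K I).toLinearMap
  let D' := (restrictTotalDegree (Fin c) K m').map (Ideal.Quotient.mkₐ K L).toLinearMap
  let φ : D →ₗ[K] (MvPolynomial (Fin c) K ⧸ J) := (Ideal.Quotient.factorₐ K h).toLinearMap.comp D.subtype
  have hr : LinearMap.range φ = (restrictTotalDegree (Fin c) K m).map (Ideal.Quotient.mkₐ K J).toLinearMap := by
    rw [LinearMap.range_comp, Submodule.range_subtype, ← Submodule.map_comp]; rfl
  have h1 := LinearMap.finrank_range_add_finrank_ker φ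
  rw [hr] at h1
  -- multiplication maps
  let μ : ι → (MvPolynomial (Fin c) K ⧸ L) →ₗ[K] (MvPolynomial (Fin c) K ⧸ I) := fun i =>
    Submodule.liftQ (L.restrictScalars K)
      ((Ideal.Quotient.mkₐ K I).toLinearMap.comp (LinearMap.mulRight K (p i))) (by
        intro a ha
        rw [LinearMap.mem_ker]
        exact Ideal.Quotient.eq_zero_iff_mem.2 (hp i a ha))
  have hμ : ∀ i a, μ i (Ideal.Quotient.mk L a) = Ideal.Quotient.mk I (a * p i) := fun i a => rfl
  let Φ : (ι → D') →ₗ[K] (MvPolynomial (Fin c) K ⧸ I) :=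
    LinearMap.lsum K (fun _ => D') K (fun i => (μ i).comp D'.subtype)
  have hΦ : ∀ x, Φ x = ∑ i, μ i (x i) := by intro x; simp [Φ]
  have h2 : (LinearMap.ker φ).map D.subtype ≤ LinearMap.range Φ := by
    rintro _ ⟨⟨_, ⟨f, hf, rfl⟩⟩, hk, rfl⟩
    have hfJ : f ∈ J := Ideal.Quotient.eq_zero_iff_mem.1 hk
    obtain ⟨a, ha, hfa⟩ := H f hfJ ((mem_restrictTotalDegree _ _ _).1 hf)
    refine ⟨fun i => ⟨Ideal.Quotient.mk L (a i), ⟨a i, (mem_restrictTotalDegree _ _ _).2 (ha i), rfl⟩⟩, ?_⟩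
    rw [hΦ]
    simp only [hμ]
    rw [← map_sum]
    exact (Ideal.Quotient.eq.2 hfa).symm
  have h3 : Module.finrank K (LinearMap.ker φ) ≤ Module.finrank K (LinearMap.range Φ) := by
    rw [(Submodule.equivMapOfInjective D.subtype D.injective_subtype (LinearMap.ker φ)).finrank_eq]
    exact Submodule.finrank_mono h2
  have h4 : Module.finrank K (LinearMap.range Φ) ≤ Fintype.card ι * gam L m' := by
    refine (LinearMap.finrank_range_le Φ).trans ?_
    rw [Module.finrank_pi_fintype, Finset.sum_const, smul_eq_mul]; rfl
  change Module.finrank K D ≤ _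
  rw [← h1]
  exact Nat.add_le_add_left (h3.trans h4) _

end poly
end CT

namespace CT

section poly2
open MvPolynomial
variable {K : Type u} [Field K] {c : ℕ}

theorem gam_step {ι : Type} [Fintype ι] (p : ι → MvPolynomial (Fin c) K) (δ : ι → ℕ)
    (hp : ∀ i, (p i).IsHomogeneous (δ i)) (η : MvPolynomial (Fin c) K) (d : ℕ) (hd : 0 < d)
    (hη : η.IsHomogeneous d) (m : ℕ) :
    gam (Ideal.span (Set.range p)) m ≤
      (m + 1) * gam (Ideal.span (Set.range p) ⊔ Ideal.span {η}) m := by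
  classical
  set I := Ideal.span (Set.range p)
  set J := I ⊔ Ideal.span {η}
  have hIJ : I ≤ J := le_sup_left
  have key : ∀ m : ℕ, ∀ f ∈ J, f.totalDegree ≤ m → ∃ a : MvPolynomial (Fin c) K,
      (d ≤ m → a.totalDegree ≤ m - d) ∧ (m < d → a = 0) ∧ f - a * η ∈ I := by
    intro m f hf hfm
    obtain ⟨y, hy, z, hz, rfl⟩ := Submodule.mem_sup.1 hf
    obtain ⟨b, rfl⟩ := Ideal.mem_span_singleton'.1 hz
    obtain ⟨a, ha⟩ := (Ideal.mem_span_range_iff_exists_fun).1 hy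
    have hsum : y + b * η = ∑ i : Option ι, (i.elim b a) * (i.elim η p) := by
      rw [Fintype.sum_option]; simp [ha, add_comm]
    obtain ⟨a', h1, h2⟩ := trunc_lemma (fun i : Option ι => i.elim η p) (fun i => i.elim d δ)
      (by rintro (_ | i); exacts [hη, hp i]) (fun i => i.elim b a) m (by rw [← hsum]; exact hfm)
    refine ⟨a' none, (h2 none).1, (h2 none).2, ?_⟩
    rw [hsum, h1, Fintype.sum_option]
    simp only [Option.elim, add_sub_cancel_left]
    exact Ideal.sum_mem _ fun i _ => Ideal.mul_mem_left _ _ (Ideal.subset_span ⟨i, rfl⟩)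
  induction m using Nat.strong_induction_on with
  | _ m ih =>
    by_cases h : d ≤ m
    · have h1 := gam_le_add (L := I) hIJ m (ι := Unit) (fun _ => η) (m - d)
        (fun _ a ha => Ideal.mul_mem_right _ _ ha)
        (fun f hf hfm => by
          obtain ⟨a, h1, -, h3⟩ := key m f hf hfm
          exact ⟨fun _ => a, fun _ => h1 h, by simpa using h3⟩)
      have h2 := ih (m - d) (by omega)
      have h3 : gam J (m - d) ≤ gam J m := gam_mono J (by omega)
      simp only [Fintype.card_unit, one_mul] at h1
      calc gam I m ≤ gam J m + (m - d + 1) * gam J m := 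
            h1.trans (Nat.add_le_add_left (h2.trans (Nat.mul_le_mul_left _ h3)) _)
        _ = (1 + (m - d + 1)) * gam J m := by ring
        _ ≤ _ := Nat.mul_le_mul_right _ (by omega)
    · have h1 := gam_le_add (L := I) hIJ m (ι := Empty) (fun _ => η) 0
        (fun _ a ha => Ideal.mul_mem_right _ _ ha)
        (fun f hf hfm => by
          obtain ⟨a, -, h1, h3⟩ := key m f hf hfm
          refine ⟨fun _ => a, fun i => i.elim, ?_⟩
          rw [h1 (by omega)] at h3
          simpa using h3)
      simp only [Fintype.card_empty, zero_mul, add_zero] at h1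
      exact h1.trans (Nat.le_mul_of_pos_left _ (by omega))

theorem gam_bot_ge (q : ℕ) : (q + 1) ^ c ≤ gam (⊥ : Ideal (MvPolynomial (Fin c) K)) (c * q) := by
  classical
  let e : (Fin c → Fin (q + 1)) → (Fin c →₀ ℕ) := fun s => Finsupp.equivFunOnFinite.symm (fun i => (s i : ℕ))
  have he : Function.Injective e := by
    intro s s' h
    funext i
    have := DFunLike.congr_fun h i
    exact Fin.ext this
  have hli : LinearIndependent K (fun s => (basisMonomials (Fin c) K) (e s)) :=
    (basisMonomials (Fin c) K).linearIndependent.comp e he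
  have hmem : ∀ s, (basisMonomials (Fin c) K) (e s) ∈ restrictTotalDegree (Fin c) K (c * q) := by
    intro s
    rw [mem_restrictTotalDegree, coe_basisMonomials]
    refine (totalDegree_monomial_le _ _).trans ?_
    rw [Finsupp.sum_fintype _ _ (by simp)]
    calc ∑ i, (e s i) ≤ ∑ i : Fin c, q := Finset.sum_le_sum fun i _ => Nat.lt_succ_iff.1 (s i).2
      _ = c * q := by simp
  have hli2 : LinearIndependent K (fun s => (⟨_, hmem s⟩ : restrictTotalDegree (Fin c) K (c * q))) := by
    apply LinearIndependent.of_comp (Submodule.subtype _)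
    exact hli
  have h1 := hli2.fintype_card_le_finrank
  have h2 : Module.finrank K (restrictTotalDegree (Fin c) K (c * q)) = gam (⊥ : Ideal (MvPolynomial (Fin c) K)) (c * q) := by
    apply (Submodule.equivMapOfInjective _ _ _).finrank_eq
    intro x y hxy
    have : x - y ∈ (⊥ : Ideal (MvPolynomial (Fin c) K)) := Ideal.Quotient.eq.1 hxy
    exact sub_eq_zero.1 (by simpa using this)
  rw [← h2]
  simpa using h1

theorem gam_span_ge (t : ℕ) (η : Fin t → MvPolynomial (Fin c) K) (deg : Fin t → ℕ)
    (hdeg : ∀ i, 0 < deg i ∧ (η i).IsHomogeneous (deg i)) (q : ℕ) :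
    (q + 1) ^ c ≤ (c * q + 1) ^ t * gam (Ideal.span (Set.range η)) (c * q) := by
  induction t with
  | zero =>
    have : Ideal.span (Set.range η) = ⊥ := by rw [Set.range_eq_empty]; simp
    rw [this, pow_zero, one_mul]
    exact gam_bot_ge q
  | succ t ih =>
    have h1 := ih (fun i => η i.castSucc) (fun i => deg i.castSucc) (fun i => hdeg _)
    have h2 := gam_step (fun i => η (Fin.castSucc i)) (fun i => deg i.castSucc) (fun i => (hdeg _).2)
      (η (Fin.last t)) _ (hdeg _).1 (hdeg _).2 (c * q)
    have h3 : Ideal.span (Set.range fun i => η (Fin.castSucc i)) ⊔ Ideal.span {η (Fin.last t)} =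
        Ideal.span (Set.range η) := by
      rw [← Ideal.span_union]
      congr 1
      ext x
      constructor
      · rintro (⟨i, rfl⟩ | rfl)
        · exact ⟨_, rfl⟩
        · exact ⟨_, rfl⟩
      · rintro ⟨i, rfl⟩
        induction i using Fin.lastCases with
        | last => exact Or.inr rfl
        | cast i => exact Or.inl ⟨i, rfl⟩
    rw [h3] at h2
    calc _ ≤ _ := h1
      _ ≤ (c * q + 1) ^ t * ((c * q + 1) * gam (Ideal.span (Set.range η)) (c * q)) := 
        Nat.mul_le_mul_left _ h2
      _ = _ := by ring

def HG (I : Ideal (MvPolynomial (Fin c) K)) : Prop :=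
  ∃ (n : ℕ) (p : Fin n → MvPolynomial (Fin c) K) (δ : Fin n → ℕ), (∀ i, (p i).IsHomogeneous (δ i)) ∧
    I = Ideal.span (Set.range p)

theorem HG.of_set {I : Ideal (MvPolynomial (Fin c) K)} (S : Set (MvPolynomial (Fin c) K)) (hS : S.Finite)
    (h : ∀ p ∈ S, ∃ δ, p.IsHomogeneous δ) (hI : I = Ideal.span S) : HG I := by
  obtain ⟨n, p, hp⟩ := hS.fin_param
  have : ∀ i, ∃ δ, (p i).IsHomogeneous δ := fun i => h _ (hp.2 ▸ ⟨i, rfl⟩)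
  choose δ hδ using this
  exact ⟨n, p, δ, hδ, by rw [hI, hp.2]⟩

theorem HG.mul {I J : Ideal (MvPolynomial (Fin c) K)} (hI : HG I) (hJ : HG J) : HG (I * J) := by
  obtain ⟨n, p, δ, hp, rfl⟩ := hI
  obtain ⟨n', p', δ', hp', rfl⟩ := hJ
  rw [Ideal.span_mul_span']
  refine HG.of_set _ ((Set.finite_range p).mul (Set.finite_range p')) ?_ rfl
  rintro _ ⟨_, ⟨i, rfl⟩, _, ⟨j, rfl⟩, rfl⟩
  exact ⟨_, (hp i).mul (hp' j)⟩

theorem HG.top : HG (⊤ : Ideal (MvPolynomial (Fin c) K)) :=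
  HG.of_set {1} (Set.finite_singleton _) (by rintro p rfl; exact ⟨0, isHomogeneous_one _ _⟩)
    (by rw [Ideal.span_singleton_one])

theorem HG.of_components {I : Ideal (MvPolynomial (Fin c) K)}
    (h : ∀ p ∈ I, ∀ n, homogeneousComponent n p ∈ I) : HG I := by
  classical
  obtain ⟨S, hS⟩ : I.FG := IsNoetherian.noetherian I
  refine HG.of_set (⋃ p ∈ S, ⋃ n ∈ Finset.range (p.totalDegree + 1), {homogeneousComponent n p}) ?_ ?_ ?_
  · exact Set.Finite.biUnion S.finite_toSet fun p _ => Set.Finite.biUnion (Finset.finite_toSet _)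
      fun _ _ => Set.finite_singleton _
  · intro p hp
    simp only [Set.mem_iUnion, Set.mem_singleton_iff] at hp
    obtain ⟨q, -, n, -, rfl⟩ := hp
    exact ⟨n, homogeneousComponent_isHomogeneous _ _⟩
  · apply le_antisymm
    · rw [← hS]
      refine Ideal.span_le.2 fun p hp => ?_
      rw [← sum_homogeneousComponent p]
      refine Ideal.sum_mem _ fun n hn => Ideal.subset_span ?_
      simp only [Set.mem_iUnion]
      exact ⟨p, hp, n, hn, rfl⟩
    · refine Ideal.span_le.2 fun p hp => ?_
      simp only [Set.mem_iUnion, Set.mem_singleton_iff] at hp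
      obtain ⟨q, hq, n, -, rfl⟩ := hp
      exact h q (hS ▸ Ideal.subset_span hq) n

theorem gam_pow_le {I : Ideal (MvPolynomial (Fin c) K)} (hI : HG I) (N : ℕ) :
    ∃ C : ℕ, ∀ m, gam (I ^ N) m ≤ C * gam I m := by
  have hN : ∀ N, HG (I ^ N) := by
    intro N
    induction N with
    | zero => rw [pow_zero, Ideal.one_eq_top]; exact HG.top
    | succ N ih => rw [pow_succ]; exact ih.mul hI
  induction N with
  | zero =>
    refine ⟨0, fun m => ?_⟩
    rw [pow_zero, Ideal.one_eq_top]
    have := Ideal.Quotient.subsingleton_iff (I := (⊤ : Ideal (MvPolynomial (Fin c) K))).2 rfl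
    unfold gam
    simp only [zero_mul, nonpos_iff_eq_zero]
    rw [Submodule.eq_bot_of_subsingleton (p := Submodule.map (Ideal.Quotient.mkₐ K ⊤).toLinearMap (restrictTotalDegree (Fin c) K m))]
    simp
  | succ N ih =>
    obtain ⟨C, hC⟩ := ih
    obtain ⟨n, p, δ, hp, hpI⟩ := hN N
    refine ⟨C + n, fun m => ?_⟩
    have h1 := gam_le_add (I := I ^ (N + 1)) (J := I ^ N) (L := I) (Ideal.pow_le_pow_right (by omega)) m
      p m (fun i a ha => by
        rw [pow_succ']
        exact Ideal.mul_mem_mul ha (hpI ▸ Ideal.subset_span ⟨i, rfl⟩))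
      (fun f hf hfm => by
        rw [hpI] at hf
        obtain ⟨a, rfl⟩ := (Ideal.mem_span_range_iff_exists_fun).1 hf
        obtain ⟨a', h1, h2⟩ := trunc_lemma p δ hp a m hfm
        refine ⟨a', fun i => ?_, by rw [h1, sub_self]; exact Ideal.zero_mem _⟩
        by_cases h : δ i ≤ m
        · exact ((h2 i).1 h).trans (Nat.sub_le _ _)
        · rw [(h2 i).2 (by omega)]; simp)
    rw [Fintype.card_fin] at h1
    calc _ ≤ _ := h1
      _ ≤ C * gam I m + n * gam I m := Nat.add_le_add_right (hC m) _
      _ = _ := by ring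

theorem gam_radical {I J : Ideal (MvPolynomial (Fin c) K)} (hI : HG I) (h : I ≤ J.radical) :
    ∃ C : ℕ, ∀ m, gam J m ≤ C * gam I m := by
  obtain ⟨N, hN⟩ := Ideal.exists_pow_le_of_le_radical_of_fg h (IsNoetherian.noetherian I)
  obtain ⟨C, hC⟩ := gam_pow_le hI N
  exact ⟨C, fun m => (gam_le_of_le hN m).trans (hC m)⟩

end poly2
end CT

namespace CT

section dsum
open MvPolynomial DirectSum
variable {K : Type u} [Field K] {c : ℕ} (V : ℕ → Type v) [∀ n, AddCommGroup (V n)] [∀ n, Module K (V n)]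
  [Module (MvPolynomial (Fin c) K) (⨁ n, V n)]
  (compat : ∀ (a : K) (x : ⨁ n, V n), (C a : MvPolynomial (Fin c) K) • x = a • x)
  (deg2 : ∀ (j : Fin c) (n : ℕ) (x : V n), ∃ y : V (n + 2),
    (X j : MvPolynomial (Fin c) K) • (DirectSum.of V n x) = DirectSum.of V (n + 2) y)

include compat deg2 in
theorem smul_monomial (s : Fin c →₀ ℕ) (a : K) (n : ℕ) (x : V n) :
    ∃ y : V (n + 2 * s.degree), (monomial s a : MvPolynomial (Fin c) K) • (DirectSum.of V n x) =
      DirectSum.of V _ y := by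
  classical
  have cast : ∀ {m m' : ℕ} (h : m = m') (y : V m), ∃ y' : V m', DirectSum.of V m y = DirectSum.of V m' y' := by
    rintro m _ rfl y; exact ⟨y, rfl⟩
  have hpow : ∀ (j : Fin c) (e n : ℕ) (x : V n), ∃ y : V (n + 2 * e),
      ((X j : MvPolynomial (Fin c) K) ^ e) • (DirectSum.of V n x) = DirectSum.of V _ y := by
    intro j e
    induction e with
    | zero => intro n x; exact ⟨x, by rw [pow_zero, one_smul]; rfl⟩
    | succ e ih =>
      intro n x
      obtain ⟨y, hy⟩ := ih n x
      obtain ⟨z, hz⟩ := deg2 j _ y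
      obtain ⟨w, hw⟩ := cast (show n + 2 * e + 2 = n + 2 * (e + 1) by ring) z
      exact ⟨w, by rw [pow_succ', mul_smul, hy, hz, hw]⟩
  induction s using Finsupp.induction generalizing n with
  | zero =>
    refine ⟨a • x, ?_⟩
    rw [show (monomial 0 a : MvPolynomial (Fin c) K) = C a from rfl, compat]
    exact (DirectSum.lof K ℕ V n).map_smul a x |>.symm
  | single_add j e s hj he ih =>
    obtain ⟨y, hy⟩ := ih n x
    obtain ⟨z, hz⟩ := hpow j e _ y
    obtain ⟨w, hw⟩ := cast (show n + 2 * s.degree + 2 * e = n + 2 * (Finsupp.single j e + s).degree by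
      rw [map_add, Finsupp.degree_single]; ring) z
    refine ⟨w, ?_⟩
    rw [monomial_single_add, mul_smul, hy, hz, hw]

include compat deg2 in
theorem smul_homog (p : MvPolynomial (Fin c) K) (d : ℕ) (hp : p.IsHomogeneous d) (n : ℕ) (x : V n) :
    ∃ y : V (n + 2 * d), p • (DirectSum.of V n x) = DirectSum.of V _ y := by
  classical
  have cast : ∀ {m m' : ℕ} (h : m = m') (y : V m), ∃ y' : V m', DirectSum.of V m y = DirectSum.of V m' y' := by
    rintro m _ rfl y; exact ⟨y, rfl⟩
  have : ∀ s ∈ p.support, ∃ y : V (n + 2 * d), (monomial s (p.coeff s)) • (DirectSum.of V n x) = DirectSum.of V _ y := by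
    intro s hs
    have h := hp (mem_support_iff.1 hs)
    obtain ⟨y, hy⟩ := smul_monomial V compat deg2 s (p.coeff s) n x
    obtain ⟨y', hy'⟩ := cast (show n + 2 * s.degree = n + 2 * d by
      rw [← h, Finsupp.degree_eq_weight_one]; rfl) y
    exact ⟨y', hy.trans hy'⟩
  choose! y hy using this
  refine ⟨∑ s ∈ p.support, y s, ?_⟩
  conv_lhs => rw [p.as_sum]
  rw [Finset.sum_smul, map_sum]
  exact Finset.sum_congr rfl hy

include compat deg2 in
theorem ann_HG : HG (Module.annihilator (MvPolynomial (Fin c) K) (⨁ n, V n)) := by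
  classical
  apply HG.of_components
  intro p hp d
  rw [Module.mem_annihilator] at hp ⊢
  intro x
  induction x using DirectSum.induction_on with
  | zero => simp
  | add x y hx hy => rw [smul_add, hx, hy, add_zero]
  | of n x =>
    by_cases hd : d ∈ Finset.range (p.totalDegree + 1)
    swap
    · rw [homogeneousComponent_eq_zero, zero_smul]
      simp at hd; omega
    have : ∀ e, ∃ y : V (n + 2 * e), homogeneousComponent e p • (DirectSum.of V n x) = DirectSum.of V _ y :=
      fun e => smul_homog V compat deg2 _ e (homogeneousComponent_isHomogeneous _ _) n x
    choose y hy using this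
    have h0 := hp (DirectSum.of V n x)
    rw [← sum_homogeneousComponent p, Finset.sum_smul] at h0
    have h1 := congrArg (fun z => z (n + 2 * d)) h0
    simp only [hy] at h1
    rw [show (∑ i ∈ Finset.range (p.totalDegree + 1), (DirectSum.of V (n + 2 * i)) (y i)) (n + 2 * d) =
      y d by
        have h2 := map_sum (DirectSum.component ℤ ℕ V (n + 2 * d)) (fun i => (DirectSum.of V (n + 2 * i)) (y i)) 
          (Finset.range (p.totalDegree + 1))
        simp only [DirectSum.apply_eq_component ℤ] at h2 ⊢
        rw [h2, Finset.sum_eq_single_of_mem d hd]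
        · exact DirectSum.of_eq_same _ _
        · intro e _ hne
          exact DirectSum.of_eq_of_ne _ _ _ (by omega)] at h1
    rw [hy, h1]
    simp

include compat deg2 in
theorem gam_ann_le [∀ n, Module.Finite K (V n)] [Module.Finite (MvPolynomial (Fin c) K) (⨁ n, V n)] :
    ∃ g e : ℕ, ∀ m, gam (Module.annihilator (MvPolynomial (Fin c) K) (⨁ n, V n)) m ≤
      g * ∑ n ∈ Finset.range (2 * m + e), Module.finrank K (V n) := by
  classical
  obtain ⟨g, s, hs⟩ := Module.Finite.exists_fin (R := MvPolynomial (Fin c) K) (M := ⨁ n, V n)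
  have hbd : ∃ e, ∀ i, ∀ n, e ≤ n → s i n = 0 := by
    refine ⟨(Finset.univ.sup fun i => (DFinsupp.support (s i)).sup id) + 1, fun i n hn => ?_⟩
    by_contra h
    have h1 : n ∈ DFinsupp.support (s i) := DFinsupp.mem_support_iff.2 h
    have h2 : n ≤ (DFinsupp.support (s i)).sup id := Finset.le_sup (f := id) h1
    have h3 := Finset.le_sup (f := fun i => (DFinsupp.support (s i)).sup id) (Finset.mem_univ i)
    simp only at h3
    omega
  obtain ⟨e, he⟩ := hbd
  refine ⟨g, e, fun m => ?_⟩
  let P := restrictTotalDegree (Fin c) K m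
  set I := Module.annihilator (MvPolynomial (Fin c) K) (⨁ n, V n)
  have hK : ∀ (a : K) (p : MvPolynomial (Fin c) K) (x : ⨁ n, V n), (a • p) • x = a • (p • x) := by
    intro a p x
    rw [smul_eq_C_mul, mul_smul, compat]
  let Φ : P →ₗ[K] (Fin g → ∀ n : Fin (2 * m + e), V n) :=
    { toFun := fun p i n => ((p : MvPolynomial (Fin c) K) • s i) n
      map_add' := by intro p q; funext i n; simp [add_smul]
      map_smul' := by intro a p; funext i n; simp only [Submodule.coe_smul, hK]; rfl }
  have hhigh : ∀ p ∈ P, ∀ i n, 2 * m + e ≤ n → (p • s i) n = 0 := by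
    intro p hp i n hn
    rw [mem_restrictTotalDegree] at hp
    rw [← DirectSum.sum_support_of (s i), Finset.smul_sum, ← sum_homogeneousComponent p]
    simp only [Finset.sum_smul]
    rw [DirectSum.apply_eq_component ℤ, map_sum]
    refine Finset.sum_eq_zero fun j hj => ?_
    rw [map_sum]
    refine Finset.sum_eq_zero fun d hd => ?_
    obtain ⟨y, hy⟩ := smul_homog V compat deg2 _ d (homogeneousComponent_isHomogeneous d p) j (s i j)
    rw [hy]
    refine DirectSum.of_eq_of_ne _ _ _ ?_
    have : j < e := by
      by_contra h
      exact (DFinsupp.mem_support_iff.1 hj) (he i j (by omega))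
    simp at hd
    omega
  let Ψ : P →ₗ[K] (MvPolynomial (Fin c) K ⧸ I) := (Ideal.Quotient.mkₐ K I).toLinearMap.comp P.subtype
  have hΨ : LinearMap.range Ψ = P.map (Ideal.Quotient.mkₐ K I).toLinearMap := by
    rw [LinearMap.range_comp, Submodule.range_subtype]
  have hker : LinearMap.ker Φ ≤ LinearMap.ker Ψ := by
    intro p hp
    rw [LinearMap.mem_ker] at hp ⊢
    apply Ideal.Quotient.eq_zero_iff_mem.2
    rw [Module.mem_annihilator]
    have h0 : ∀ i, (p : MvPolynomial (Fin c) K) • s i = 0 := by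
      intro i
      apply DFinsupp.ext
      intro n
      by_cases hn : n < 2 * m + e
      · exact congrFun (congrFun hp i) ⟨n, hn⟩
      · exact hhigh p p.2 i n (by omega)
    intro x
    have hx : x ∈ Submodule.span (MvPolynomial (Fin c) K) (Set.range s) := hs ▸ Submodule.mem_top
    induction hx using Submodule.span_induction with
    | mem x hx => obtain ⟨i, rfl⟩ := hx; exact h0 i
    | zero => simp
    | add x y _ _ hx hy => rw [smul_add, hx, hy, add_zero]
    | smul a x _ hx => rw [smul_comm, hx, smul_zero]
  have h1 := LinearMap.finrank_range_add_finrank_ker Φ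
  have h2 := LinearMap.finrank_range_add_finrank_ker Ψ
  have h3 := Submodule.finrank_mono hker
  have h4 := Submodule.finrank_le (LinearMap.range Φ)
  have h5 : Module.finrank K (Fin g → ∀ n : Fin (2 * m + e), V n) = g * ∑ n ∈ Finset.range (2 * m + e), Module.finrank K (V n) := by
    rw [Module.finrank_pi_fintype, Finset.sum_const, smul_eq_mul, Module.finrank_pi_fintype,
      Finset.sum_range]
    simp
  have h6 : gam I m = Module.finrank K (LinearMap.range Ψ) := by rw [hΨ]; rfl
  omega

include compat deg2 in
theorem sum_finrank_le [∀ n, Module.Finite K (V n)] [Module.Finite (MvPolynomial (Fin c) K) (⨁ n, V n)] :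
    ∃ C : ℝ, ∀ m : ℕ, ∑ n ∈ Finset.range m, (Module.finrank K (V n) : ℝ) ≤ C * ((m : ℝ) + 1) ^ c := by
  classical
  have deg2' := deg2
  choose f hf using deg2'
  have inj : ∀ n, Function.Injective (DirectSum.of V n) := fun n => DirectSum.of_injective n
  have hK : ∀ (a : K) (p : MvPolynomial (Fin c) K) (x : ⨁ n, V n), p • (a • x) = a • (p • x) := by
    intro a p x
    rw [← compat, ← compat, smul_comm]
  have hof : ∀ (a : K) n (x : V n), DirectSum.of V n (a • x) = a • DirectSum.of V n x := fun a n x =>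
    (DirectSum.lof K ℕ V n).map_smul a x
  let Y : Fin c → ∀ n, V n →ₗ[K] V (n + 2) := fun j n =>
    { toFun := f j n
      map_add' := by intro x y; apply inj; rw [← hf, map_add, map_add, smul_add, hf, hf]
      map_smul' := by
        intro a x; apply inj
        rw [← hf, hof, hK, hf, RingHom.id_apply, hof] }
  have hY : ∀ j n x, (X j : MvPolynomial (Fin c) K) • (DirectSum.of V n x) = DirectSum.of V _ (Y j n x) := hf
  have hc : ∀ i j n v, Y i (n + 2) (Y j n v) = Y j (n + 2) (Y i n v) := by
    intro i j n v
    apply inj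
    rw [← hY, ← hY, ← hY, ← hY, smul_comm]
  have hfg : FGFam Y (fun _ => ⊤) := by
    obtain ⟨g, s, hs⟩ := Module.Finite.exists_fin (R := MvPolynomial (Fin c) K) (M := ⨁ n, V n)
    have hbd : ∃ e, ∀ i, ∀ n, e ≤ n → s i n = 0 := by
      refine ⟨(Finset.univ.sup fun i => (DFinsupp.support (s i)).sup id) + 1, fun i n hn => ?_⟩
      by_contra h
      have h1 : n ∈ DFinsupp.support (s i) := DFinsupp.mem_support_iff.2 h
      have h2 : n ≤ (DFinsupp.support (s i)).sup id := Finset.le_sup (f := id) h1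
      have h3 := Finset.le_sup (f := fun i => (DFinsupp.support (s i)).sup id) (Finset.mem_univ i)
      simp only at h3
      omega
    obtain ⟨e, he⟩ := hbd
    have hYc : ∀ j (x : ⨁ n, V n) n, ((X j : MvPolynomial (Fin c) K) • x) (n + 2) = Y j n (x n) := by
      intro j x n
      induction x using DirectSum.induction_on with
      | zero => simp
      | add x y hx hy => rw [smul_add, DirectSum.add_apply, hx, hy, DirectSum.add_apply, map_add]
      | of i x =>
        rw [hY]
        by_cases h : i = n
        · subst h
          rw [DirectSum.of_eq_same, DirectSum.of_eq_same]
        · rw [DirectSum.of_eq_of_ne _ _ _ (by omega), DirectSum.of_eq_of_ne _ _ _ (by omega), map_zero]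
    have hall : ∀ x : ⨁ n, V n, ∀ n, e ≤ n → ∃ w : Fin c → V n, x (n + 2) = ∑ j, Y j n (w j) := by
      intro x
      have hx : x ∈ Submodule.span (MvPolynomial (Fin c) K) (Set.range s) := hs ▸ Submodule.mem_top
      induction hx using Submodule.span_induction with
      | mem x hx =>
        obtain ⟨i, rfl⟩ := hx
        intro n hn
        exact ⟨0, by rw [he i _ (by omega)]; simp⟩
      | zero => intro n hn; exact ⟨0, by simp⟩
      | add x y _ _ hx hy =>
        intro n hn
        obtain ⟨w, hw⟩ := hx n hn
        obtain ⟨w', hw'⟩ := hy n hn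
        exact ⟨w + w', by simp [hw, hw', Finset.sum_add_distrib]⟩
      | smul a x _ hx =>
        induction a using MvPolynomial.induction_on with
        | C a =>
          intro n hn
          obtain ⟨w, hw⟩ := hx n hn
          refine ⟨a • w, ?_⟩
          rw [compat, show (a • x) (n + 2) = a • (x (n + 2)) from rfl, hw]
          simp [Finset.smul_sum]
        | add p q hp hq =>
          intro n hn
          obtain ⟨w, hw⟩ := hp n hn
          obtain ⟨w', hw'⟩ := hq n hn
          exact ⟨w + w', by simp [add_smul, hw, hw', Finset.sum_add_distrib]⟩
        | mul_X p j hp =>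
          intro n hn
          refine ⟨Pi.single j ((p • x) n), ?_⟩
          rw [mul_comm, mul_smul, hYc, Finset.sum_eq_single j]
          · simp
          · intro b _ hb; simp [Pi.single_eq_of_ne hb]
          · simp
    refine ⟨e, fun n hn v _ => ?_⟩
    obtain ⟨w, hw⟩ := hall (DirectSum.of V (n + 2) v) n hn
    exact ⟨w, fun _ => trivial, by rw [← hw, DirectSum.of_eq_same]⟩
  exact EZ.sum_le (hilbert_serre K c V Y hc hfg)

include compat deg2 in
/-- lower bound -/
theorem sum_finrank_ge [∀ n, Module.Finite K (V n)] [Module.Finite (MvPolynomial (Fin c) K) (⨁ n, V n)]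
    (t : ℕ) (η : Fin t → MvPolynomial (Fin c) K) (deg : Fin t → ℕ)
    (hdeg : ∀ i, 0 < deg i ∧ (η i).IsHomogeneous (deg i))
    (hV : ∀ α : Fin c → AlgebraicClosure K, (∀ i, aeval α (η i) = 0) →
      ∀ f ∈ Module.annihilator (MvPolynomial (Fin c) K) (⨁ n, V n), aeval α f = 0) :
    ∃ C e : ℕ, ∀ q : ℕ, (q + 1) ^ c ≤ (c * q + 1) ^ t * 
      (C * ∑ n ∈ Finset.range (2 * (c * q) + e), Module.finrank K (V n)) := by
  obtain ⟨g, e, h1⟩ := gam_ann_le V compat deg2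
  have h2 : Module.annihilator (MvPolynomial (Fin c) K) (⨁ n, V n) ≤ (Ideal.span (Set.range η)).radical := by
    intro f hf
    rw [← MvPolynomial.vanishingIdeal_zeroLocus_eq_radical (K := AlgebraicClosure K),
      MvPolynomial.mem_vanishingIdeal_iff]
    intro α hα
    apply hV α _ f hf
    intro i
    exact (MvPolynomial.mem_zeroLocus_iff.1 hα) _ (Ideal.subset_span ⟨i, rfl⟩)
  obtain ⟨C, hC⟩ := gam_radical (ann_HG V compat deg2) h2
  refine ⟨C * g, e, fun q => ?_⟩
  refine (gam_span_ge t η deg hdeg q).trans (Nat.mul_le_mul_left _ ?_)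
  rw [mul_assoc]
  exact (hC _).trans (Nat.mul_le_mul_left _ (h1 _))

end dsum
end CT

namespace CT
open Abelian

section ses
variable {A : Type u} [CommRing A]

/-- short exact sequences of modules -/
structure SES {X Y Z : ModuleCat.{u} A} (f : X ⟶ Y) (g : Y ⟶ Z) : Prop where
  inj : Function.Injective f
  exact : Function.Exact f g
  surj : Function.Surjective g

namespace SES
variable {X Y Z : ModuleCat.{u} A} {f : X ⟶ Y} {g : Y ⟶ Z} (h : SES f g)
  {X' Y' Z' : ModuleCat.{u} A} {f' : X' ⟶ Y'} {g' : Y' ⟶ Z'} (h' : SES f' g')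
include h

theorem zero : f ≫ g = 0 := by
  ext x
  exact h.exact.apply_apply_eq_zero x

/-- the short complex -/
abbrev sc : ShortComplex (ModuleCat.{u} A) := ShortComplex.mk f g h.zero

theorem se : h.sc.ShortExact where
  exact := by
    rw [ShortComplex.ShortExact.moduleCat_exact_iff_function_exact]
    exact h.exact
  mono_f := (ModuleCat.mono_iff_injective _).2 h.inj
  epi_g := (ModuleCat.epi_iff_surjective _).2 h.surj

/-- the extension class -/
noncomputable def cls : Ext Z X 1 := h.se.extClass

theorem nat (a : X ⟶ X') (b : Y ⟶ Y') (c : Z ⟶ Z') (h1 : f ≫ b = a ≫ f') (h2 : g ≫ c = b ≫ g') :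
    h.cls.comp (Ext.mk₀ a) (add_zero 1) = (Ext.mk₀ c).comp h'.cls (zero_add 1) :=
  ShortComplex.ShortExact.extClass_naturality h.se h'.se
    (ShortComplex.homMk (S₁ := h.sc) (S₂ := h'.sc) a b c h1.symm h2.symm)

theorem cls_f : h.cls.comp (Ext.mk₀ f) (add_zero 1) = 0 := h.se.extClass_comp
theorem g_cls : (Ext.mk₀ g).comp h.cls (zero_add 1) = 0 := h.se.comp_extClass

theorem con1 {N : ModuleCat.{u} A} {n m : ℕ} (x : Ext X N n) (hm : 1 + n = m)
    (hx : h.cls.comp x hm = 0) : ∃ y : Ext Y N n, (Ext.mk₀ f).comp y (zero_add n) = x :=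
  Ext.contravariant_sequence_exact₁ h.se N x hm hx
theorem con2 {N : ModuleCat.{u} A} {n : ℕ} (x : Ext Y N n) 
    (hx : (Ext.mk₀ f).comp x (zero_add n) = 0) : ∃ y : Ext Z N n, (Ext.mk₀ g).comp y (zero_add n) = x :=
  Ext.contravariant_sequence_exact₂ h.se N x hx
theorem con3 {N : ModuleCat.{u} A} {n m : ℕ} (x : Ext Z N m) (hm : 1 + n = m)
    (hx : (Ext.mk₀ g).comp x (zero_add m) = 0) : ∃ y : Ext X N n, h.cls.comp y hm = x :=
  Ext.contravariant_sequence_exact₃ h.se N x hx hm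
theorem cov1 {N : ModuleCat.{u} A} {n m : ℕ} (x : Ext N X m) (hm : n + 1 = m)
    (hx : x.comp (Ext.mk₀ f) (add_zero m) = 0) : ∃ y : Ext N Z n, y.comp h.cls hm = x :=
  Ext.covariant_sequence_exact₁ N h.se x hx hm
theorem cov2 {N : ModuleCat.{u} A} {n : ℕ} (x : Ext N Y n) 
    (hx : x.comp (Ext.mk₀ g) (add_zero n) = 0) : ∃ y : Ext N X n, y.comp (Ext.mk₀ f) (add_zero n) = x :=
  Ext.covariant_sequence_exact₂ N h.se x hx
theorem cov3 {N : ModuleCat.{u} A} {n m : ℕ} (x : Ext N Z n) (hm : n + 1 = m)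
    (hx : x.comp h.cls hm = 0) : ∃ y : Ext N Y n, y.comp (Ext.mk₀ g) (add_zero n) = x :=
  Ext.covariant_sequence_exact₃ N h.se x hm hx

/-- vanishing forms -/
theorem con_surj [Projective Y] {N : ModuleCat.{u} A} {n m : ℕ} (x : Ext Z N m) (hm : 1 + n = m) :
    ∃ y : Ext X N n, h.cls.comp y hm = x := by
  subst hm
  refine h.con3 x rfl ?_
  have : Subsingleton (Ext Y N (1 + n)) := by
    rw [add_comm]; exact Ext.subsingleton_of_projective Y N n
  exact Subsingleton.elim _ _

end SES

theorem SES.mk' {X Y Z : Type u} [AddCommGroup X] [Module A X] [AddCommGroup Y] [Module A Y]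
    [AddCommGroup Z] [Module A Z] {f : X →ₗ[A] Y} {g : Y →ₗ[A] Z} (h1 : Function.Injective f)
    (h2 : Function.Exact f g) (h3 : Function.Surjective g) : SES (ModuleCat.ofHom f) (ModuleCat.ofHom g) :=
  ⟨h1, h2, h3⟩

end ses

/-- A central operator of degree two. -/
structure CentralOp (A : Type u) [CommRing A] where
  op : ∀ L : ModuleCat.{u} A, Ext L L 2
  central : ∀ (n : ℕ) (L N : ModuleCat.{u} A) (ξ : Ext L N n),
    (op L).comp ξ (add_comm 2 n) = ξ.comp (op N) rfl

end CT

namespace CT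
open Abelian

/-- `A = B/(f)` with `f` regular -/
structure Hyp (B A : Type u) [CommRing B] [CommRing A] where
  ψ : B →+* A
  f : B
  surj : Function.Surjective ψ
  ker : ∀ b, ψ b = 0 → ∃ b', b = f * b'
  psi_f : ψ f = 0
  reg : ∀ b, f * b = 0 → b = 0

section
variable {B A : Type u} [CommRing B] [CommRing A]

/-- descending semilinear maps along surjective semilinear maps -/
noncomputable def desc {ψ : B →+* A} (hψ : Function.Surjective ψ) {X N N' : Type u} [AddCommGroup X] [Module B X]
    [AddCommGroup N] [Module A N] [AddCommGroup N'] [Module A N'] (p : X →ₛₗ[ψ] N)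
    (hp : Function.Surjective p) (g : X →ₛₗ[ψ] N') (h : ∀ x, p x = 0 → g x = 0) : N →ₗ[A] N' :=
  have key : ∀ x y, p x = p y → g x = g y := fun x y hxy => by
    rw [← sub_eq_zero, ← map_sub]; apply h; rw [map_sub, hxy, sub_self]
  { toFun := fun n => g (Function.surjInv hp n)
    map_add' := fun x y => by
      rw [← map_add]; apply key; rw [map_add]; simp only [Function.surjInv_eq]
    map_smul' := fun a x => by
      obtain ⟨b, rfl⟩ := hψ a
      rw [RingHom.id_apply, ← map_smulₛₗ]; apply key; rw [map_smulₛₗ]; simp only [Function.surjInv_eq] }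

theorem desc_apply {ψ : B →+* A} (hψ : Function.Surjective ψ) {X N N' : Type u} [AddCommGroup X] [Module B X]
    [AddCommGroup N] [Module A N] [AddCommGroup N'] [Module A N'] (p : X →ₛₗ[ψ] N)
    (hp : Function.Surjective p) (g : X →ₛₗ[ψ] N') (h : ∀ x, p x = 0 → g x = 0) (x : X) :
    desc hψ p hp g h (p x) = g x := by
  change g _ = g _
  rw [← sub_eq_zero, ← map_sub]; apply h; rw [map_sub, Function.surjInv_eq hp, sub_self]

namespace Hyp
variable (H : Hyp B A) (X : Type u) [AddCommGroup X] [Module B X]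

abbrev Red : Type u := X ⧸ LinearMap.range (LinearMap.lsmul B X H.f)

theorem red_key (b b' : B) (h : H.ψ b = H.ψ b') (x : H.Red X) : b • x = b' • x := by
  obtain ⟨c, hc⟩ := H.ker (b - b') (by rw [map_sub, h, sub_self])
  induction x using Submodule.Quotient.induction_on with
  | _ x =>
  rw [← sub_eq_zero, ← sub_smul, hc, ← Submodule.Quotient.mk_smul]
  apply (Submodule.Quotient.mk_eq_zero _).2
  exact ⟨c • x, by rw [LinearMap.lsmul_apply, mul_smul]⟩

@[reducible]
noncomputable def redModule : Module A (H.Red X) where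
  smul a x := Function.surjInv H.surj a • x
  one_smul x := (H.red_key X _ 1 (by simp [Function.surjInv_eq]) x).trans (one_smul _ _)
  mul_smul a b x := (H.red_key X _ _ (by simp [Function.surjInv_eq]) x).trans (mul_smul _ _ _)
  smul_zero a := smul_zero (Function.surjInv H.surj a)
  smul_add a := smul_add (Function.surjInv H.surj a)
  add_smul a b x := (H.red_key X _ (Function.surjInv H.surj a + Function.surjInv H.surj b)
    (by simp [Function.surjInv_eq]) x).trans (add_smul _ _ _)
  zero_smul x := (H.red_key X _ 0 (by simp [Function.surjInv_eq]) x).trans (zero_smul _ _)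

noncomputable def red : ModuleCat.{u} A :=
  letI := H.redModule X
  ModuleCat.of A (H.Red X)

noncomputable def toRed : X →ₛₗ[H.ψ] H.red X where
  toFun x := (Submodule.Quotient.mk x : H.Red X)
  map_add' x y := rfl
  map_smul' b x := H.red_key X b _ (by simp [Function.surjInv_eq]) (Submodule.Quotient.mk x)

theorem toRed_surj : Function.Surjective (H.toRed X) := Submodule.Quotient.mk_surjective _

theorem toRed_zero (x : X) : H.toRed X x = 0 ↔ ∃ y, x = H.f • y := by
  refine (Submodule.Quotient.mk_eq_zero _).trans ?_
  constructor
  · rintro ⟨y, rfl⟩; exact ⟨y, rfl⟩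
  · rintro ⟨y, rfl⟩; exact ⟨y, rfl⟩

end Hyp

/-- a (free) cover of a module, given by a generating family -/
structure Cov (L : ModuleCat.{u} A) where
  ι : Type u
  s : ι → L
  hs : Submodule.span A (Set.range s) = ⊤

namespace Cov
variable (H : Hyp B A) {L : ModuleCat.{u} A} (c : Cov L)

abbrev F : Type u := c.ι →₀ A
noncomputable def q : c.F →ₗ[A] L := Finsupp.linearCombination A c.s
theorem q_surj : Function.Surjective c.q := by
  rw [← LinearMap.range_eq_top, q, Finsupp.range_linearCombination, c.hs]
abbrev Z : Type u := LinearMap.ker c.q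

/-- default cover -/
def std (L : ModuleCat.{u} A) : Cov L := ⟨L, id, by simp⟩

theorem ses_δ : SES (ModuleCat.ofHom (X := c.Z) (Y := c.F) (LinearMap.ker c.q).subtype) (ModuleCat.ofHom c.q) :=
  SES.mk' Subtype.val_injective (LinearMap.exact_subtype_ker_map c.q) c.q_surj

instance : Projective (ModuleCat.of A c.F) := ModuleCat.projective_of_free (Finsupp.basisSingleOne)

/-- lift of F to B -/
noncomputable def r (ι : Type u) : (ι →₀ B) →ₛₗ[H.ψ] (ι →₀ A) where
  toFun x := x.mapRange H.ψ (map_zero _)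
  map_add' x y := Finsupp.mapRange_add (by simp) x y
  map_smul' b x := by ext i; simp

theorem r_surj (ι : Type u) : Function.Surjective (r H ι) :=
  Finsupp.mapRange_surjective _ (map_zero _) H.surj

theorem r_zero (ι : Type u) (x : ι →₀ B) : r H ι x = 0 ↔ ∃ y, x = H.f • y := by
  classical
  constructor
  · intro h
    have h1 : ∀ i, ∃ b', x i = H.f * b' := fun i => H.ker _ (by simpa [r] using DFunLike.congr_fun h i)
    choose g hg using h1
    refine ⟨Finsupp.onFinset x.support g ?_, ?_⟩
    · intro i hi
      rw [Finsupp.mem_support_iff, hg]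
      exact fun h0 => hi (H.reg _ h0)
    · ext i; simp [hg]
  · rintro ⟨y, rfl⟩
    rw [map_smulₛₗ, H.psi_f, zero_smul]

theorem F_reg {ι : Type u} (x : ι →₀ B) (h : H.f • x = 0) : x = 0 := by
  ext i
  exact H.reg _ (by simpa using DFunLike.congr_fun h i)

noncomputable def π : (c.ι →₀ B) →ₛₗ[H.ψ] L := c.q.comp (r H c.ι)
theorem π_surj : Function.Surjective (c.π H) := c.q_surj.comp (r_surj H _)
theorem π_apply (x) : c.π H x = c.q (r H c.ι x) := rfl

abbrev Zt : Type u := LinearMap.ker (c.π H)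

noncomputable def ρ : c.Zt H →ₛₗ[H.ψ] c.Z where
  toFun x := ⟨r H c.ι x, x.2⟩
  map_add' x y := by ext1; simp
  map_smul' b x := by ext1; simp

theorem ρ_surj : Function.Surjective (c.ρ H) := by
  rintro ⟨z, hz⟩
  obtain ⟨x, rfl⟩ := r_surj H _ z
  exact ⟨⟨x, hz⟩, rfl⟩

theorem ρ_zero (x : c.Zt H) : c.ρ H x = 0 ↔ ∃ y, (x : c.ι →₀ B) = H.f • y := by
  rw [← r_zero, ← Subtype.val_inj]; rfl

noncomputable abbrev L1 : ModuleCat.{u} A := H.red (c.Zt H)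

/-- multiplication by `f`, from the free module to `Zt` -/
noncomputable def mulf : (c.ι →₀ B) →ₗ[B] c.Zt H :=
  LinearMap.codRestrict _ (LinearMap.lsmul B _ H.f) (fun x => by
    rw [LinearMap.mem_ker, LinearMap.lsmul_apply, map_smulₛₗ, H.psi_f, zero_smul])

noncomputable def i : L →ₗ[A] c.L1 H :=
  desc H.surj (c.π H) (c.π_surj H) ((H.toRed _).comp (c.mulf H)) (by
    intro x hx
    exact (H.toRed_zero _ _).2 ⟨⟨x, hx⟩, rfl⟩)

theorem i_apply (x) : c.i H (c.π H x) = H.toRed _ (c.mulf H x) := desc_apply _ _ _ _ _ _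

noncomputable def p : c.L1 H →ₗ[A] c.Z :=
  desc H.surj (X := c.Zt H) (N := H.red (c.Zt H)) (N' := c.Z) (H.toRed (c.Zt H)) (H.toRed_surj _) (c.ρ H) (by
    intro x hx
    obtain ⟨y, rfl⟩ := (H.toRed_zero _ _).1 hx
    rw [map_smulₛₗ, H.psi_f, zero_smul])

theorem p_apply (x) : c.p H (H.toRed _ x) = c.ρ H x :=
  desc_apply H.surj (X := c.Zt H) (N := H.red (c.Zt H)) (N' := c.Z) (H.toRed (c.Zt H)) (H.toRed_surj _) (c.ρ H) _ _

theorem ses_ε : SES (ModuleCat.ofHom (Y := c.L1 H) (c.i H)) (ModuleCat.ofHom (Y := c.Z) (c.p H)) := by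
  constructor
  · change Function.Injective (c.i H)
    rw [injective_iff_map_eq_zero]
    intro l hl
    obtain ⟨x, rfl⟩ := c.π_surj H l
    rw [i_apply, H.toRed_zero] at hl
    obtain ⟨y, hy⟩ := hl
    have : x = y := by
      rw [← sub_eq_zero]
      apply F_reg H
      rw [smul_sub, sub_eq_zero]
      exact congrArg Subtype.val hy
    rw [this]
    exact y.2
  · intro w
    change c.p H w = 0 ↔ ∃ l, c.i H l = w
    constructor
    · intro hw
      obtain ⟨z, rfl⟩ := H.toRed_surj _ w
      rw [p_apply, ρ_zero] at hw
      obtain ⟨y, hy⟩ := hw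
      refine ⟨c.π H y, ?_⟩
      rw [i_apply]
      congr 1
      exact Subtype.ext hy.symm
    · rintro ⟨l, rfl⟩
      obtain ⟨x, rfl⟩ := c.π_surj H l
      rw [i_apply, p_apply, ρ_zero]
      exact ⟨x, rfl⟩
  · intro z
    obtain ⟨x, rfl⟩ := c.ρ_surj H z
    exact ⟨_, c.p_apply H x⟩

noncomputable def χ : Ext L L 2 := c.ses_δ.cls.comp (c.ses_ε H).cls rfl

theorem χ_nat {L' : ModuleCat.{u} A} (c' : Cov L') (φ : L ⟶ L') :
    (c.χ H).comp (Ext.mk₀ φ) rfl = (Ext.mk₀ φ).comp (c'.χ H) rfl := by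
  -- lift
  have hl : ∀ j : c.ι, ∃ y, c'.π H y = φ (c.s j) := fun j => c'.π_surj H _
  choose y hy using hl
  let φt : (c.ι →₀ B) →ₗ[B] (c'.ι →₀ B) := Finsupp.linearCombination B y
  have hφt : ∀ x, c'.π H (φt x) = φ (c.π H x) := by
    intro x
    induction x using Finsupp.induction_linear with
    | zero => simp
    | add x x' h1 h2 => rw [map_add, map_add, h1, h2, map_add, map_add]
    | single j b =>
      rw [Finsupp.linearCombination_single, map_smulₛₗ, hy, π_apply]
      simp [r, q]
  let φF : c.F →ₗ[A] c'.F := desc H.surj (r H c.ι) (r_surj H _) ((r H c'.ι).comp φt) (by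
    intro x hx
    obtain ⟨y, rfl⟩ := (r_zero H _ _).1 hx
    exact (r_zero H _ _).2 ⟨φt y, by rw [map_smul]⟩)
  have hφF : ∀ x, φF (r H c.ι x) = r H c'.ι (φt x) := desc_apply _ _ _ _ _
  have hqF : ∀ x, c'.q (φF x) = φ (c.q x) := by
    intro x
    obtain ⟨x, rfl⟩ := r_surj H _ x
    rw [hφF]; exact hφt x
  let φZ : c.Z →ₗ[A] c'.Z := φF.restrict (fun x hx => by
    rw [LinearMap.mem_ker] at hx ⊢; rw [hqF, hx, map_zero])
  let φZt : c.Zt H →ₗ[B] c'.Zt H := φt.restrict (fun x hx => by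
    rw [LinearMap.mem_ker] at hx ⊢; rw [hφt, hx, map_zero])
  let φ1 : c.L1 H →ₗ[A] c'.L1 H := desc H.surj (X := c.Zt H) (N := c.L1 H) (N' := c'.L1 H) (H.toRed _) (H.toRed_surj _) ((H.toRed _).comp φZt) (by
    intro x hx
    obtain ⟨y, rfl⟩ := (H.toRed_zero _ _).1 hx
    exact (H.toRed_zero _ _).2 ⟨φZt y, by rw [map_smul]⟩)
  have hφ1 : ∀ x, φ1 (H.toRed _ x) = H.toRed _ (φZt x) := desc_apply _ _ _ _ _
  have e1 := c.ses_δ.nat c'.ses_δ (ModuleCat.ofHom φZ) (ModuleCat.ofHom φF) φ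
    (by ext x; rfl) (by ext1; exact LinearMap.ext fun x => (hqF x).symm)
  have e2 := (c.ses_ε H).nat (c'.ses_ε H) φ (ModuleCat.ofHom φ1) (ModuleCat.ofHom φZ)
    (by
      ext1
      refine LinearMap.ext fun l => ?_
      obtain ⟨x, rfl⟩ := c.π_surj H l
      change φ1 (c.i H (c.π H x)) = c'.i H (φ (c.π H x))
      rw [i_apply, hφ1, ← hφt, i_apply]
      congr 1
      apply Subtype.ext
      change φt (H.f • x) = H.f • φt x
      rw [map_smul])
    (by
      ext1
      refine LinearMap.ext fun l => ?_
      obtain ⟨x, rfl⟩ := H.toRed_surj _ l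
      change φZ (c.p H (H.toRed _ x)) = c'.p H (φ1 (H.toRed _ x))
      rw [p_apply, hφ1, p_apply]
      apply Subtype.ext
      exact hφF _)
  rw [χ, χ, Ext.comp_assoc (a₂₃ := 1) _ _ _ rfl rfl rfl, e2, ← Ext.comp_assoc (a₁₂ := 1) _ _ _ rfl rfl rfl, e1,
    Ext.comp_assoc (a₂₃ := 2) _ _ _ rfl rfl rfl]

theorem χ_indep (c' : Cov L) : c.χ H = c'.χ H := by
  have := c.χ_nat H c' (𝟙 L)
  simpa using this

/-- the operator on a syzygy -/
theorem χ_Z (e : Cov (ModuleCat.of A c.Z)) : e.χ H = (c.ses_ε H).cls.comp c.ses_δ.cls rfl := by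
  have hl : ∀ j : e.ι, ∃ y, c.ρ H y = e.s j := fun j => c.ρ_surj H _
  choose y hy using hl
  let d : (e.ι →₀ B) →ₗ[B] c.Zt H := Finsupp.linearCombination B y
  have hd : ∀ x, c.ρ H (d x) = e.π H x := by
    intro x
    induction x using Finsupp.induction_linear with
    | zero => simp
    | add x x' h1 h2 => rw [map_add, map_add, h1, h2, map_add]
    | single j b =>
      rw [Finsupp.linearCombination_single, map_smulₛₗ, hy, π_apply]
      simp [r, q]
  have hdiv : ∀ x : e.Zt H, ∃ z, (d x : c.ι →₀ B) = H.f • z := by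
    intro x
    rw [← ρ_zero, hd]
    exact x.2
  choose g0 hg0 using hdiv
  have huniq : ∀ z z' : c.ι →₀ B, H.f • z = H.f • z' → z = z' := by
    intro z z' h
    rw [← sub_eq_zero]; apply F_reg H; rw [smul_sub, h, sub_self]
  let g : e.Zt H →ₗ[B] (c.ι →₀ B) :=
    { toFun := g0
      map_add' := fun x x' => by
        apply huniq
        rw [smul_add, ← hg0, ← hg0, ← hg0]
        simp
      map_smul' := fun b x => by
        apply huniq
        rw [RingHom.id_apply, smul_comm, ← hg0, ← hg0]
        simp }
  have hg : ∀ x : e.Zt H, (d x : c.ι →₀ B) = H.f • g x := hg0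
  let h : e.Z →ₗ[A] L := desc H.surj (X := e.Zt H) (N := e.Z) (N' := L) (e.ρ H) (e.ρ_surj H) ((c.π H).comp g) (by
    intro x hx
    obtain ⟨w, hw⟩ := (e.ρ_zero H _).1 hx
    have : g x = d w := by
      apply huniq
      rw [← hg, hw, map_smul]; rfl
    change c.π H (g x) = 0
    rw [this]
    exact (d w).2)
  have hh : ∀ x, h (e.ρ H x) = c.π H (g x) := desc_apply _ _ _ _ _
  let m : e.L1 H →ₗ[A] c.F := desc H.surj (X := e.Zt H) (N := e.L1 H) (N' := c.F) (H.toRed _) (H.toRed_surj _) ((r H _).comp g) (by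
    intro x hx
    obtain ⟨y, rfl⟩ := (H.toRed_zero _ _).1 hx
    exact (r_zero H _ _).2 ⟨g y, by rw [map_smul]⟩)
  have hm : ∀ x, m (H.toRed _ x) = r H _ (g x) := desc_apply _ _ _ _ _
  have e1 := (e.ses_ε H).nat c.ses_δ (𝟙 _) (ModuleCat.ofHom m) (ModuleCat.ofHom h)
    (by
      ext1
      refine LinearMap.ext fun l => ?_
      obtain ⟨x, rfl⟩ := e.π_surj H l
      change m (e.i H (e.π H x)) = ((e.π H x : c.Z) : c.F)
      rw [i_apply, hm, ← hd]
      change _ = r H _ (d x : c.ι →₀ B)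
      congr 1
      apply huniq
      rw [← hg]
      change ((d (H.f • x) : c.Zt H) : c.ι →₀ B) = _
      rw [map_smul]; rfl)
    (by
      ext1
      refine LinearMap.ext fun l => ?_
      obtain ⟨x, rfl⟩ := H.toRed_surj _ l
      change h (e.p H (H.toRed _ x)) = c.q (m (H.toRed _ x))
      rw [p_apply, hm, hh]; rfl)
  let n : e.F →ₗ[A] c.L1 H := desc H.surj (N := e.F) (N' := c.L1 H) (r H _) (r_surj H _) ((H.toRed _).comp d) (by
    intro x hx
    obtain ⟨y, rfl⟩ := (r_zero H _ _).1 hx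
    exact (H.toRed_zero _ _).2 ⟨d y, by rw [map_smul]⟩)
  have hn : ∀ x, n (r H _ x) = H.toRed _ (d x) := desc_apply _ _ _ _ _
  have e2 := e.ses_δ.nat (c.ses_ε H) (ModuleCat.ofHom h) (ModuleCat.ofHom n) (𝟙 _)
    (by
      ext1
      refine LinearMap.ext fun l => ?_
      obtain ⟨x, rfl⟩ := e.ρ_surj H l
      change n (r H _ x) = c.i H (h (e.ρ H x))
      rw [hn, hh, i_apply]
      congr 1
      exact Subtype.ext (hg x))
    (by
      ext1
      refine LinearMap.ext fun l => ?_
      obtain ⟨x, rfl⟩ := r_surj H _ l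
      change e.q (r H _ x) = c.p H (n (r H _ x))
      rw [hn, p_apply, hd]; rfl)
  simp only [Ext.comp_mk₀_id, Ext.mk₀_id_comp] at e1 e2
  rw [χ, e1, ← e2, Ext.comp_assoc (a₂₃ := 1) _ _ _ rfl rfl rfl]

theorem χ_cls : (c.χ H).comp c.ses_δ.cls rfl = c.ses_δ.cls.comp ((std _).χ H) rfl := by
  rw [c.χ_Z H, χ, Ext.comp_assoc (a₂₃ := 2) _ _ _ rfl rfl rfl]

end Cov

/-- the central operator of a hypersurface -/
noncomputable def Hyp.central (H : Hyp B A) : CentralOp A where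
  op L := (Cov.std L).χ H
  central n := by
    induction n with
    | zero =>
      intro L N ξ
      obtain ⟨φ, rfl⟩ := Ext.mk₀_bijective L N |>.2 ξ
      exact Cov.χ_nat H _ _ φ
    | succ n ih =>
      intro L N ξ
      obtain ⟨ξ', rfl⟩ := (Cov.std L).ses_δ.con_surj ξ (add_comm 1 n)
      rw [Ext.comp_assoc (a₂₃ := n + 2) _ _ _ (add_comm 1 n) rfl (by omega), ← ih,
        ← Ext.comp_assoc (a₁₂ := 3) _ _ _ rfl (by omega) (by omega),
        ← Ext.comp_assoc (a₁₂ := 3) _ _ _ rfl (by omega) (by omega), (Cov.std L).χ_cls H]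

end
end CT

namespace CT
open Abelian

section
variable {A : Type u} [CommRing A] {r : ℕ} (ω : Fin r → CentralOp A)

/-- action of central operators on Ext -/
noncomputable def extOp (L N : ModuleCat.{u} A) (j : Fin r) (n : ℕ) :
    Ext L N n →ₗ[A] Ext L N (n + 2) :=
  ((ω j).op N).postcompOfLinear A L rfl

theorem extOp_apply (L N : ModuleCat.{u} A) (j : Fin r) (n : ℕ) (x : Ext L N n) :
    extOp ω L N j n x = x.comp ((ω j).op N) rfl := rfl

theorem extOp_comm (L N : ModuleCat.{u} A) (i j : Fin r) (n : ℕ) (x : Ext L N n) :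
    extOp ω L N i (n + 2) (extOp ω L N j n x) = extOp ω L N j (n + 2) (extOp ω L N i n x) := by
  simp only [extOp_apply]
  rw [Ext.comp_assoc (a₂₃ := 4) _ _ _ rfl rfl rfl, Ext.comp_assoc (a₂₃ := 4) _ _ _ rfl rfl rfl,
    (ω i).central 2 N N ((ω j).op N)]

/-- precomposition -/
noncomputable def pre {L L' : ModuleCat.{u} A} {p : ℕ} (ξ : Ext L L' p) (N : ModuleCat.{u} A) {n m : ℕ}
    (h : p + n = m) : Ext L' N n →ₗ[A] Ext L N m := ξ.precompOfLinear A N h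

theorem pre_apply {L L' : ModuleCat.{u} A} {p : ℕ} (ξ : Ext L L' p) (N : ModuleCat.{u} A) {n m : ℕ}
    (h : p + n = m) (x : Ext L' N n) : pre ξ N h x = ξ.comp x h := rfl

theorem pre_extOp {L L' : ModuleCat.{u} A} {p : ℕ} (ξ : Ext L L' p) (N : ModuleCat.{u} A) {n m : ℕ}
    (h : p + n = m) (x : Ext L' N n) (j : Fin r) (h' : p + (n + 2) = m + 2) :
    pre ξ N h' (extOp ω L' N j n x) = extOp ω L N j m (pre ξ N h x) := by
  simp only [extOp_apply, pre_apply]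
  rw [Ext.comp_assoc (a₂₃ := n + 2) _ _ _ h rfl (by omega)]

/-- finite generation of Ext over the operators -/
def FGE (L N : ModuleCat.{u} A) : Prop := FGFam (extOp ω L N) (fun _ => ⊤)

theorem FGE.of_vanish {L N : ModuleCat.{u} A} (h : ∃ n0, ∀ n, n0 ≤ n → Subsingleton (Ext L N n)) :
    FGE ω L N := by
  obtain ⟨n0, h⟩ := h
  refine ⟨n0, fun n hn v _ => ⟨fun _ => 0, fun _ => trivial, ?_⟩⟩
  have := h (n+2) (by omega)
  exact Subsingleton.elim _ _

variable [IsNoetherianRing A]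

theorem FGE.step {B : Type u} [CommRing B] (H : Hyp B A) {L N : ModuleCat.{u} A} (c : Cov L)
    [Module.Finite A (c.L1 H)] [Module.Finite A N] (h : FGE ω (c.L1 H) N) :
    FGE (Fin.cons H.central ω : Fin (r + 1) → CentralOp A) L N := by
  let W : ∀ n, Submodule A (Ext (c.L1 H) N n) := fun n =>
    LinearMap.ker (pre (Ext.mk₀ (ModuleCat.ofHom (Y := c.L1 H) (c.i H))) N (zero_add n))
  have hs : Stable (extOp ω (c.L1 H) N) W := by
    intro j n v hv
    rw [LinearMap.mem_ker] at hv ⊢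
    rw [pre_extOp ω _ _ (zero_add n), hv, map_zero]
  obtain ⟨n0, hn0⟩ := fgFam_of_stable _ (extOp_comm ω _ _) h W hs
  refine ⟨n0 + 1, fun n hn ξ _ => ?_⟩
  obtain ⟨k, rfl⟩ : ∃ k, n = k + 1 := ⟨n - 1, by omega⟩
  obtain ⟨ξ', hξ'⟩ := c.ses_δ.con_surj ξ (n := k + 2) (by omega)
  have hε := c.ses_ε H
  obtain ⟨w, hw, hsum⟩ := hn0 k (by omega)
    ((Ext.mk₀ (ModuleCat.ofHom (Y := c.Z) (c.p H))).comp ξ' (zero_add (k + 2))) (by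
      rw [LinearMap.mem_ker, pre_apply, ← Ext.comp_assoc (a₁₂ := 0) _ _ _ rfl (by omega) (by omega),
        Ext.mk₀_comp_mk₀, hε.zero, Ext.mk₀_zero, Ext.zero_comp])
  have hz : ∀ j, ∃ z, (Ext.mk₀ (ModuleCat.ofHom (Y := c.Z) (c.p H))).comp z (zero_add k) = w j :=
    fun j => hε.con2 (w j) (hw j)
  choose z hz using hz
  obtain ⟨ζ, hζ⟩ := hε.con3 (n := k + 1) (ξ' - ∑ j, extOp ω _ N j k (z j)) (by omega) (by
    rw [← pre_apply, map_sub, pre_apply, hsum, map_sum, sub_eq_zero]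
    refine Finset.sum_congr rfl fun j _ => ?_
    rw [pre_extOp ω _ _ (zero_add k), pre_apply, hz])
  refine ⟨Fin.cons ζ (fun j => c.ses_δ.cls.comp (z j) (by omega)), fun _ => trivial, ?_⟩
  rw [Fin.sum_univ_succ]
  simp only [Fin.cons_zero, Fin.cons_succ, extOp_apply]
  rw [← H.central.central (k + 1) L N ζ]
  change _ = ((Cov.std L).χ H).comp ζ _ + _
  rw [(Cov.std L).χ_indep H c, Cov.χ, Ext.comp_assoc (a₂₃ := k + 2) _ _ _ rfl (by omega) (by omega),
    hζ, ← hξ', ← pre_apply, ← pre_apply, map_sub, map_sum, sub_add_eq_add_sub, eq_comm, sub_eq_iff_eq_add]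
  congr 1
  refine Finset.sum_congr rfl fun j _ => ?_
  rw [pre_extOp ω _ _ (m := k + 1) (by omega)]
  rfl
end
end CT

namespace CT
open Abelian

theorem SES.pd3 {A : Type u} [CommRing A] {X Y Z : ModuleCat.{u} A} {f : X ⟶ Y} {g : Y ⟶ Z} (h : SES f g)
    [hY : Projective Y] (n : ℕ) : HasProjectiveDimensionLT Z (n + 2) ↔ HasProjectiveDimensionLT X (n + 1) :=
  h.se.hasProjectiveDimensionLT_X₃_iff n hY

theorem pd_red {C C' : Type u} [CommRing C] [CommRing C'] (ψ : C →+* C')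
    (hψ : Function.Surjective ψ) (f : C) (hker : ∀ b, ψ b = 0 → ∃ b', b = f * b') (hf0 : ψ f = 0)
    (hreg : f = 0 ∨ ∀ b, f * b = 0 → b = 0) (n : ℕ) (X : ModuleCat.{u} C) (N : ModuleCat.{u} C')
    (p : X →ₛₗ[ψ] N) (hp : Function.Surjective p) (hpk : ∀ x, p x = 0 → ∃ y, x = f • y)
    (hX : f = 0 ∨ ∀ x : X, f • x = 0 → x = 0) (h : HasProjectiveDimensionLT X n) :
    HasProjectiveDimensionLT N n := by
  induction n generalizing X N with
  | zero =>
    have : Subsingleton X := ModuleCat.subsingleton_of_isZero (isZero_of_hasProjectiveDimensionLT_zero X)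
    have : Subsingleton N := hp.subsingleton
    exact (ModuleCat.isZero_of_subsingleton N).hasProjectiveDimensionLT_zero
  | succ n ih =>
    let g : (X →₀ C) →ₗ[C] X := Finsupp.linearCombination C id
    have hg : Function.Surjective g := Finsupp.linearCombination_id_surjective C X
    let q : (X →₀ C') →ₗ[C'] N := Finsupp.linearCombination C' p
    let rr : (X →₀ C) →ₛₗ[ψ] (X →₀ C') :=
      { toFun := fun x => x.mapRange ψ (map_zero _)
        map_add' := fun x y => Finsupp.mapRange_add (by simp) x y
        map_smul' := fun b x => by ext i; simp }
    have rr_surj : Function.Surjective rr := Finsupp.mapRange_surjective _ (map_zero _) hψ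
    have rr_ker : ∀ x, rr x = 0 → ∃ y, x = f • y := by
      intro x hx
      have h1 : ∀ i, ∃ b, x i = f * b ∧ (x i = 0 → b = 0) := by
        intro i
        by_cases h0 : x i = 0
        · exact ⟨0, by simp [h0], fun _ => rfl⟩
        · obtain ⟨b, hb⟩ := hker (x i) (DFunLike.congr_fun hx i)
          exact ⟨b, hb, fun h => absurd h h0⟩
      choose b hb hb0 using h1
      refine ⟨Finsupp.onFinset x.support b (fun i hi => ?_), ?_⟩
      · rw [Finsupp.mem_support_iff]; exact fun h => hi (hb0 i h)
      · ext i; simp [hb i]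
    have comm : ∀ x, q (rr x) = p (g x) := by
      intro x
      induction x using Finsupp.induction_linear with
      | zero => simp
      | add x y hx hy => simp [map_add, hx, hy]
      | single i c =>
        have : rr (Finsupp.single i c) = Finsupp.single i (ψ c) := Finsupp.mapRange_single (hf := map_zero ψ)
        rw [this]; simp [q, g]
    have hq : Function.Surjective q := by
      intro y
      obtain ⟨x, rfl⟩ := hp y
      obtain ⟨z, rfl⟩ := hg x
      exact ⟨rr z, comm z⟩
    match n, ih, h with
    | 0, ih, h =>
      have hP : Projective X := (projective_iff_hasProjectiveDimensionLT_one (X := X)).2 h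
      have hP' : Module.Projective C X := (IsProjective.iff_projective X).2 hP
      obtain ⟨s, hs⟩ := Module.projective_lifting_property g LinearMap.id hg
      have hs' : ∀ x, g (s x) = x := fun x => LinearMap.congr_fun hs x
      let s' : N →ₗ[C'] (X →₀ C') := desc hψ p hp (rr.comp s) (by
        intro x hx
        obtain ⟨y, rfl⟩ := hpk x hx
        simp [hf0])
      have : Module.Projective C' N := by
        refine Module.Projective.of_split s' q ?_
        ext y
        obtain ⟨x, rfl⟩ := hp y
        change q (s' (p x)) = p x
        rw [show s' (p x) = rr (s x) from desc_apply _ _ _ _ _ _, comm, hs']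
      exact (projective_iff_hasProjectiveDimensionLT_one (X := N)).1 ((IsProjective.iff_projective N).1 this)
    | n + 1, ih, h =>
      have s1 : SES (ModuleCat.ofHom (X := LinearMap.ker g) (Y := X →₀ C) (LinearMap.ker g).subtype)
          (ModuleCat.ofHom g) :=
        SES.mk' Subtype.val_injective (LinearMap.exact_subtype_ker_map g) hg
      have s2 : SES (ModuleCat.ofHom (X := LinearMap.ker q) (Y := X →₀ C') (LinearMap.ker q).subtype)
          (ModuleCat.ofHom q) :=
        SES.mk' Subtype.val_injective (LinearMap.exact_subtype_ker_map q) hq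
      have : Projective (ModuleCat.of C (X →₀ C)) := ModuleCat.projective_of_free (Finsupp.basisSingleOne)
      have : Projective (ModuleCat.of C' (X →₀ C')) := ModuleCat.projective_of_free (Finsupp.basisSingleOne)
      refine (s2.pd3 n).2 ?_
      let ρ : LinearMap.ker g →ₛₗ[ψ] LinearMap.ker q :=
        { toFun := fun x => ⟨rr x, by rw [LinearMap.mem_ker, comm, LinearMap.mem_ker.1 x.2, map_zero]⟩
          map_add' := fun x y => by ext1; simp
          map_smul' := fun x y => by ext1; simp }
      have hreg' : f = 0 ∨ ∀ w : X →₀ C, f • w = 0 → w = 0 := by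
        refine hreg.imp id fun h w hw => ?_
        ext i
        exact h _ (by simpa using DFunLike.congr_fun hw i)
      refine ih (ModuleCat.of C (LinearMap.ker g)) (ModuleCat.of C' (LinearMap.ker q)) ρ ?_ ?_ ?_ ((s1.pd3 n).1 h)
      · rintro ⟨y, hy⟩
        obtain ⟨x, rfl⟩ := rr_surj y
        rw [LinearMap.mem_ker, comm] at hy
        obtain ⟨z, hz⟩ := hpk _ hy
        obtain ⟨w, rfl⟩ := hg z
        refine ⟨⟨x - f • w, by simp [hz]⟩, Subtype.ext ?_⟩
        change rr (x - f • w) = rr x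
        simp [hf0]
      · rintro ⟨x, hx⟩ hx0
        obtain ⟨w, hw⟩ := rr_ker x (congrArg Subtype.val hx0)
        rcases hX with h0 | hX
        · refine ⟨0, Subtype.ext ?_⟩
          simp [hw, h0]
        · refine ⟨⟨w, ?_⟩, Subtype.ext hw⟩
          rw [LinearMap.mem_ker, hw, map_smul] at hx
          exact hX _ hx
      · refine hreg'.imp id fun h w hw => Subtype.ext (h w.1 (congrArg Subtype.val hw))

theorem pd_finsupp {C : Type u} [CommRing C] {X : Type u} [AddCommGroup X] [Module C X] (n : ℕ)
    (h : HasProjectiveDimensionLT (ModuleCat.of C X) n) (ι : Type u) [Finite ι] :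
    HasProjectiveDimensionLT (ModuleCat.of C (ι →₀ X)) n := by
  classical
  have := Fintype.ofFinite ι
  rw [hasProjectiveDimensionLT_iff]
  intro i hi Y e
  have key : Ext.mk₀ (𝟙 (ModuleCat.of C (ι →₀ X))) = ∑ j : ι,
      Ext.mk₀ (ModuleCat.ofHom ((Finsupp.lsingle j : X →ₗ[C] _).comp (Finsupp.lapply j))) := by
    rw [← Ext.mk₀_sum]
    congr 1
    refine ModuleCat.hom_ext (LinearMap.ext fun x => ?_)
    rw [ModuleCat.hom_sum, LinearMap.sum_apply]
    exact (Finsupp.univ_sum_single x).symm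
  rw [← Ext.mk₀_id_comp e, key, Ext.sum_comp]
  refine Finset.sum_eq_zero fun j _ => ?_
  rw [ModuleCat.ofHom_comp, ← Ext.mk₀_comp_mk₀, Ext.comp_assoc (a₂₃ := i) _ _ _ (by omega) (by omega) (by omega)]
  have := h.subsingleton _ _ i hi Y
  rw [Subsingleton.elim ((Ext.mk₀ (ModuleCat.ofHom (Finsupp.lsingle j : X →ₗ[C] _))).comp e (zero_add i)) 0, Ext.comp_zero]
end CT

namespace CT
open Abelian RingTheory.Sequence
open scoped Pointwise

/-- the semilinear identity -/
def rsId {C A : Type u} [CommRing C] [CommRing A] (ψ : C →+* A) (L : ModuleCat.{u} A) :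
    ((ModuleCat.restrictScalars ψ).obj L) →ₛₗ[ψ] L where
  toFun x := x
  map_add' _ _ := rfl
  map_smul' _ _ := rfl

theorem exists_cov {A : Type u} [CommRing A] (L : ModuleCat.{u} A) [Module.Finite A L] :
    ∃ c : Cov L, Finite c.ι := by
  obtain ⟨n, s, hs⟩ := Module.Finite.exists_fin (R := A) (M := L)
  refine ⟨⟨ULift (Fin n), fun i => s i.down, ?_⟩, (inferInstance : Finite (ULift (Fin n)))⟩
  rw [← hs]; congr 1
  ext x; simp [Set.mem_range, ULift.exists]

theorem finite_L1 {B A : Type u} [CommRing B] [CommRing A] [IsNoetherianRing B] (H : Hyp B A)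
    {L : ModuleCat.{u} A} (c : Cov L) [Finite c.ι] : Module.Finite A (c.L1 H) := by
  have : RingHomSurjective H.ψ := ⟨H.surj⟩
  exact Module.Finite.of_surjective (H.toRed (c.Zt H)) (H.toRed_surj _)

theorem fg_tower (i : ℕ) : ∀ (C A : Type u) [CommRing C] [IsLocalRing C] [IsNoetherianRing C] [CommRing A]
    (ψ : C →+* A) (_ : Function.Surjective ψ) (rs : List C) (_ : rs.length = i) (_ : IsRegular C rs)
    (_ : RingHom.ker ψ = Ideal.ofList rs), ∃ (r : ℕ) (ω : Fin r → CentralOp A), ∀ L N : ModuleCat.{u} A,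
    Module.Finite A L → Module.Finite A N →
    (∃ n, HasProjectiveDimensionLT ((ModuleCat.restrictScalars ψ).obj L) n) → FGE ω L N := by
  induction i with
  | zero =>
    intro C A _ _ _ _ ψ hψ rs hlen hreg hk
    obtain rfl := List.length_eq_zero_iff.1 hlen
    refine ⟨0, Fin.elim0, fun L N _ _ ⟨n, hn⟩ => ?_⟩
    have hk' : ∀ b, ψ b = 0 → b = 0 := fun b hb => by
      have : b ∈ RingHom.ker ψ := hb
      rw [hk] at this; simpa using this
    have : HasProjectiveDimensionLT L n := pd_red ψ hψ 0 (fun b hb => ⟨0, by simp [hk' b hb]⟩) (map_zero _)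
      (Or.inl rfl) n _ L (rsId ψ L) Function.surjective_id (fun x hx => ⟨0, by
        rw [zero_smul]; exact hx⟩) (Or.inl rfl) hn
    exact FGE.of_vanish _ ⟨n, fun m hm => this.subsingleton L n m hm N⟩
  | succ i ih =>
    intro C A _ _ _ _ ψ hψ rs hlen hreg hk
    match rs, hlen, hreg, hk with
    | f :: rs', hlen, hreg, hk =>
    have hlen : rs'.length = i := by simpa using hlen
    have mem : ∀ x ∈ f :: rs', x ∈ maximalIdeal C := by
      intro x hx
      apply IsLocalRing.le_maximalIdeal hreg.2.symm
      rw [smul_eq_mul, Ideal.mul_top]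
      exact Ideal.subset_span hx
    have hfm : f ∈ maximalIdeal C := mem f (by simp)
    have hψf : ψ f = 0 := by
      change f ∈ RingHom.ker ψ
      rw [hk, Ideal.ofList_cons]
      exact Ideal.mem_sup_left (Ideal.mem_span_singleton_self f)
    have hψrs : ∀ a ∈ Ideal.ofList rs', ψ a = 0 := by
      intro a ha
      change a ∈ RingHom.ker ψ
      rw [hk, Ideal.ofList_cons]
      exact Ideal.mem_sup_right ha
    -- C' 
    have hCz : Ideal.span {f} ≠ (⊤ : Ideal C) := by
      intro h
      have : (⊤ : Ideal C) ≤ maximalIdeal C := h ▸ (Ideal.span_singleton_le_iff_mem _).2 hfm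
      exact (IsLocalRing.maximalIdeal.isMaximal C).ne_top (top_le_iff.1 this)
    have : Nontrivial (C ⧸ Ideal.span {f}) := Ideal.Quotient.nontrivial_iff.2 hCz
    have : IsLocalRing (C ⧸ Ideal.span {f}) :=
      IsLocalRing.of_surjective' (Ideal.Quotient.mk _) Ideal.Quotient.mk_surjective
    let ψ' : C ⧸ Ideal.span {f} →+* A := Ideal.Quotient.lift _ ψ (by
      intro a ha
      obtain ⟨b, rfl⟩ := Ideal.mem_span_singleton'.1 ha
      rw [map_mul, hψf, mul_zero])
    have hreg2 := (isRegular_cons_iff' C f rs').1 hreg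
    have hreg' : IsRegular (C ⧸ Ideal.span {f}) (rs'.map (Ideal.Quotient.mk (Ideal.span {f}))) := by
      refine (AddEquiv.isRegular_congr (e := (Submodule.quotEquivOfEq (f • (⊤ : Submodule C C)) (Ideal.span {f}) ?_).toAddEquiv) ?_).1 hreg2.2
      · rw [← Submodule.ideal_span_singleton_smul, smul_eq_mul, Ideal.mul_top]
      · rw [List.forall₂_same]
        intro r _ x
        obtain ⟨r, rfl⟩ := Ideal.Quotient.mk_surjective r
        obtain ⟨x, rfl⟩ := Submodule.Quotient.mk_surjective _ x
        rfl
    obtain ⟨r, ω, hω⟩ := ih (C ⧸ Ideal.span {f}) A ψ' (Ideal.Quotient.lift_surjective_of_surjective _ _ hψ)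
      (rs'.map (Ideal.Quotient.mk _)) (by simpa using hlen) hreg' (by
        refine (Ideal.ker_quotient_lift ψ (by
          rw [Ideal.span_singleton_le_iff_mem]; exact hψf)).trans ?_
        rw [hk, Ideal.ofList_cons, Ideal.map_sup, Ideal.map_ofList, Ideal.map_quotient_self,
          bot_sup_eq])
    -- B
    have hw : IsWeaklyRegular C (rs' ++ [f]) := (IsLocalRing.isRegular_of_perm hreg (by
      rw [← List.singleton_append]; exact List.perm_append_comm)).1
    rw [isWeaklyRegular_append_iff] at hw
    have hIeq : (Ideal.ofList rs' • (⊤ : Submodule C C)) = Ideal.ofList rs' := by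
      rw [smul_eq_mul, Ideal.mul_top]
    have hfreg : ∀ a, f * a ∈ Ideal.ofList rs' → a ∈ Ideal.ofList rs' := by
      intro a ha
      have h1 := ((isWeaklyRegular_cons_iff _ _ _).1 hw.2).1
      have h2 : (Submodule.Quotient.mk a : C ⧸ (Ideal.ofList rs' • (⊤ : Submodule C C))) = 0 := by
        refine h1 ?_
        refine Eq.trans ?_ (smul_zero f).symm
        change (Submodule.Quotient.mk (f • a) : C ⧸ (Ideal.ofList rs' • (⊤ : Submodule C C))) = 0
        rw [Submodule.Quotient.mk_eq_zero, hIeq]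
        exact ha
      rw [Submodule.Quotient.mk_eq_zero, hIeq] at h2
      exact h2
    let ψB : C ⧸ Ideal.ofList rs' →+* A := Ideal.Quotient.lift _ ψ hψrs
    let H : Hyp (C ⧸ Ideal.ofList rs') A :=
      { ψ := ψB
        f := Ideal.Quotient.mk _ f
        surj := Ideal.Quotient.lift_surjective_of_surjective _ _ hψ
        ker := by
          intro b hb
          obtain ⟨b, rfl⟩ := Ideal.Quotient.mk_surjective b
          have : b ∈ RingHom.ker ψ := hb
          rw [hk, Ideal.ofList_cons, Submodule.mem_sup] at this
          obtain ⟨y, hy, z, hz, rfl⟩ := this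
          obtain ⟨a, rfl⟩ := Ideal.mem_span_singleton'.1 hy
          refine ⟨Ideal.Quotient.mk _ a, ?_⟩
          rw [← map_mul, Ideal.Quotient.eq]
          convert hz using 1; ring
        psi_f := hψf
        reg := by
          intro b hb
          obtain ⟨b, rfl⟩ := Ideal.Quotient.mk_surjective b
          rw [← map_mul, Ideal.Quotient.eq_zero_iff_mem] at hb
          exact Ideal.Quotient.eq_zero_iff_mem.2 (hfreg b hb) }
    have hpdB : ∃ n, HasProjectiveDimensionLT (ModuleCat.of C (C ⧸ Ideal.ofList rs')) n := by
      have := ModuleCat.projectiveDimension_quotient_eq_add_length_of_isWeaklyRegular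
        (ModuleCat.of C C) rs' hw.1 (fun r hr => mem r (by simp [hr]))
      refine ⟨rs'.length + 1, ?_⟩
      have h1 : HasProjectiveDimensionLE (ModuleCat.of C (C ⧸ (Ideal.ofList rs' • (⊤ : Submodule C C)))) rs'.length := by
        rw [← projectiveDimension_le_iff]
        rw [this, ModuleCat.projectiveDimension_eq_zero_of_projective, zero_add]
      rw [hIeq] at h1
      exact h1
    obtain ⟨n1, hn1⟩ := hpdB
    refine ⟨r + 1, Fin.cons H.central ω, fun L N _ _ ⟨n2, hn2⟩ => ?_⟩
    obtain ⟨c, hc⟩ := exists_cov L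
    have := finite_L1 H c
    have : IsNoetherianRing A := isNoetherianRing_of_surjective C A ψ hψ
    refine FGE.step ω H c (hω _ _ inferInstance inferInstance ?_)
    let πC : (c.ι →₀ (C ⧸ Ideal.ofList rs')) →ₗ[C] (ModuleCat.restrictScalars ψ).obj L :=
      { toFun := fun x => c.π H x
        map_add' := fun x y => map_add _ x y
        map_smul' := fun a x => by
          have : a • x = (Ideal.Quotient.mk (Ideal.ofList rs') a) • x := by
            ext i; simp [Algebra.smul_def]
          rw [this, map_smulₛₗ]; rfl }
    have s1 : SES (ModuleCat.ofHom (X := c.Zt H) (Y := c.ι →₀ (C ⧸ Ideal.ofList rs'))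
        ((LinearMap.ker (c.π H)).subtype.restrictScalars C)) (ModuleCat.ofHom πC) :=
      SES.mk' (Subtype.val_injective) (by
        intro x
        change c.π H x = 0 ↔ _
        exact ⟨fun h => ⟨⟨x, h⟩, rfl⟩, by rintro ⟨y, rfl⟩; exact y.2⟩) (c.π_surj H)
    have hZ : HasProjectiveDimensionLT (ModuleCat.of C (c.Zt H)) (n1 + n2) :=
      s1.se.hasProjectiveDimensionLT_X₁ (n1 + n2)
        (by
          have := pd_finsupp n1 hn1 c.ι
          exact hasProjectiveDimensionLT_of_ge _ n1 _ (by omega))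
        (by
          exact hasProjectiveDimensionLT_of_ge _ n2 _ (by omega))
    have hsm : ∀ x : c.Zt H, f • x = H.f • x := fun x => by
      apply Subtype.ext; ext i; 
      change f • ((x : c.ι →₀ (C ⧸ Ideal.ofList rs')) i) = _
      rw [Algebra.smul_def]; rfl
    refine ⟨n1 + n2, pd_red (Ideal.Quotient.mk (Ideal.span {f})) Ideal.Quotient.mk_surjective f ?_
      (Ideal.Quotient.eq_zero_iff_mem.2 (Ideal.mem_span_singleton_self f)) (Or.inr ?_) (n1 + n2) (ModuleCat.of C (c.Zt H))
      ((ModuleCat.restrictScalars ψ').obj (c.L1 H)) ?_ ?_ ?_ (Or.inr ?_) hZ⟩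
    · intro b hb
      obtain ⟨b', rfl⟩ := Ideal.mem_span_singleton'.1 (Ideal.Quotient.eq_zero_iff_mem.1 hb)
      exact ⟨b', mul_comm _ _⟩
    · intro b hb
      exact hreg2.1 (by simpa using hb)
    · exact
        { toFun := fun x => H.toRed (c.Zt H) x
          map_add' := fun x y => map_add _ x y
          map_smul' := fun a x => by
            have : a • x = (Ideal.Quotient.mk (Ideal.ofList rs') a) • x := by
              apply Subtype.ext; ext i
              change a • ((x : c.ι →₀ (C ⧸ Ideal.ofList rs')) i) = _
              rw [Algebra.smul_def]; rfl
            rw [this, map_smulₛₗ]; rfl }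
    · exact H.toRed_surj _
    · intro x hx
      obtain ⟨y, rfl⟩ := (H.toRed_zero (c.Zt H) x).1 hx
      exact ⟨y, (hsm y).symm⟩
    · intro x hx
      have : H.f • x = 0 := by rw [← hsm]; exact hx
      exact Subtype.ext (Cov.F_reg H _ (congrArg Subtype.val this))
end CT

namespace CT
open Abelian RingTheory.Sequence
open scoped Pointwise

theorem regular_aux (n : ℕ) : ∀ (Q : Type u) [CommRing Q] [IsLocalRing Q] [IsNoetherianRing Q] (x : Fin n → Q)
    (_ : Ideal.span (Set.range x) = maximalIdeal Q) (_ : (n : WithBot ℕ∞) ≤ ringKrullDim Q),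
    IsDomain Q ∧ ∃ rs : List Q, IsRegular Q rs ∧ Ideal.ofList rs = maximalIdeal Q := by
  induction n with
  | zero =>
    intro Q _ _ _ x hx _
    have h0 : maximalIdeal Q = ⊥ := by rw [← hx]; simp
    refine ⟨?_, [], ?_, by simp [h0]⟩
    · have hf : IsField Q := IsLocalRing.isField_iff_maximalIdeal_eq.2 h0
      exact hf.isDomain
    · exact IsRegular.nil Q Q
  | succ n ih =>
    intro Q _ _ _ x hx hd
    have hm : maximalIdeal Q ∉ minimalPrimes Q := by
      intro h
      have h1 := Ideal.height_eq_zero_iff.2 h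
      have h2 := IsLocalRing.maximalIdeal_height_eq_ringKrullDim (R := Q)
      rw [h1] at h2
      rw [← h2] at hd
      have : ((n + 1 : ℕ) : ℕ∞) ≤ 0 := by exact_mod_cast hd
      simp at this
    have hbot : maximalIdeal Q ≠ ⊥ := by
      intro h
      apply hm
      have hf : IsField Q := IsLocalRing.isField_iff_maximalIdeal_eq.2 h
      have := hf.isDomain
      rw [h, IsDomain.minimalPrimes_eq_singleton_bot]
      rfl
    have hsq : ¬ maximalIdeal Q ≤ maximalIdeal Q ^ 2 := by
      intro h
      apply hbot
      apply Submodule.eq_bot_of_le_smul_of_le_jacobson_bot (maximalIdeal Q) _ (IsNoetherian.noetherian _)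
      · rw [smul_eq_mul, ← pow_two]; exact h
      · exact IsLocalRing.maximalIdeal_le_jacobson _
    have hav : ∃ y ∈ maximalIdeal Q, y ∉ maximalIdeal Q ^ 2 ∧ ∀ p ∈ minimalPrimes Q, y ∉ p := by
      by_contra! hcon
      have := (Ideal.subset_union_prime_finite (s := insert (maximalIdeal Q ^ 2) (minimalPrimes Q))
        ((minimalPrimes.finite_of_isNoetherianRing Q).insert _) (f := id) (I := maximalIdeal Q)
        (maximalIdeal Q ^ 2) (maximalIdeal Q ^ 2) (by
          intro i hi h1 _
          exact ((Set.mem_insert_iff.1 hi).resolve_left h1).1.1)).1 (by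
          intro y hy
          by_cases h2 : y ∈ maximalIdeal Q ^ 2
          · exact Set.mem_biUnion (Set.mem_insert _ _) h2
          · obtain ⟨p, hp, hyp⟩ := hcon y hy h2
            exact Set.mem_biUnion (Set.mem_insert_of_mem _ hp) hyp)
      obtain ⟨p, hp, hle⟩ := this
      rcases hp with rfl | hp
      · exact hsq hle
      · have : maximalIdeal Q = p := (IsLocalRing.maximalIdeal.isMaximal Q).eq_of_le hp.1.1.ne_top hle
        exact hm (this ▸ hp)
    obtain ⟨y, hym, hy2, hyp⟩ := hav
    -- exchange
    have hex : ∃ i, maximalIdeal Q ≤ Ideal.span {y} ⊔ Ideal.span (Set.range (fun j => x (Fin.succAbove i j))) := by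
      have : y ∈ Ideal.span (Set.range x) := hx ▸ hym
      obtain ⟨a, ha⟩ := (Submodule.mem_span_range_iff_exists_fun Q).1 this
      have hu : ∃ i, IsUnit (a i) := by
        by_contra! hcon
        apply hy2
        rw [← ha, pow_two]
        refine Ideal.sum_mem _ fun i _ => Ideal.mul_mem_mul ((IsLocalRing.mem_maximalIdeal _).2 (hcon i)) ?_
        rw [← hx]; exact Ideal.subset_span ⟨i, rfl⟩
      obtain ⟨i, hi⟩ := hu
      refine ⟨i, ?_⟩
      rw [← hx, Ideal.span_le]
      have hothers : ∀ j, x (Fin.succAbove i j) ∈ Ideal.span {y} ⊔ Ideal.span (Set.range (fun j => x (Fin.succAbove i j))) :=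
        fun j => Ideal.mem_sup_right (Ideal.subset_span ⟨j, rfl⟩)
      rintro _ ⟨k, rfl⟩
      rcases eq_or_ne k i with rfl | hk
      · rw [Fin.sum_univ_succAbove _ k] at ha
        have h3 : a k * x k ∈ Ideal.span {y} ⊔ Ideal.span (Set.range (fun j => x (Fin.succAbove k j))) := by
          have : a k * x k = y - ∑ j, a (k.succAbove j) * x (k.succAbove j) := by
            rw [← ha]; simp [smul_eq_mul]
          rw [this]
          exact Ideal.sub_mem _ (Ideal.mem_sup_left (Ideal.mem_span_singleton_self y))
            (Ideal.sum_mem _ fun j _ => Ideal.mul_mem_left _ _ (hothers j))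
        exact (Ideal.unit_mul_mem_iff_mem _ hi).1 h3
      · obtain ⟨j, rfl⟩ := Fin.exists_succAbove_eq hk
        exact hothers j
    obtain ⟨i, hi⟩ := hex
    have hCz : Ideal.span {y} ≠ (⊤ : Ideal Q) := by
      intro h
      have : (⊤ : Ideal Q) ≤ maximalIdeal Q := h ▸ (Ideal.span_singleton_le_iff_mem _).2 hym
      exact (IsLocalRing.maximalIdeal.isMaximal Q).ne_top (top_le_iff.1 this)
    have : Nontrivial (Q ⧸ Ideal.span {y}) := Ideal.Quotient.nontrivial_iff.2 hCz
    have : IsLocalRing (Q ⧸ Ideal.span {y}) :=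
      IsLocalRing.of_surjective' (Ideal.Quotient.mk _) Ideal.Quotient.mk_surjective
    have hmap : (maximalIdeal Q).map (Ideal.Quotient.mk (Ideal.span {y})) = maximalIdeal (Q ⧸ Ideal.span {y}) := by
      have := Ideal.map_eq_top_or_isMaximal_of_surjective (Ideal.Quotient.mk (Ideal.span {y}))
        Ideal.Quotient.mk_surjective (IsLocalRing.maximalIdeal.isMaximal Q)
      refine IsLocalRing.eq_maximalIdeal (this.resolve_left ?_)
      intro htop
      have h4 := congrArg (Ideal.comap (Ideal.Quotient.mk (Ideal.span {y}))) htop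
      rw [Ideal.comap_map_of_surjective _ Ideal.Quotient.mk_surjective, Ideal.comap_top] at h4
      have h5 : Ideal.comap (Ideal.Quotient.mk (Ideal.span {y})) ⊥ ≤ maximalIdeal Q := by
        rw [← RingHom.ker_eq_comap_bot, Ideal.mk_ker]
        exact (Ideal.span_singleton_le_iff_mem _).2 hym
      rw [sup_eq_left.2 h5] at h4
      exact (IsLocalRing.maximalIdeal.isMaximal Q).ne_top h4
    have hdim : (n : WithBot ℕ∞) ≤ ringKrullDim (Q ⧸ Ideal.span {y}) := by
      have h6 := ringKrullDim_le_ringKrullDim_quotSMulTop_succ hym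
      rw [← Submodule.ideal_span_singleton_smul, smul_eq_mul, Ideal.mul_top] at h6
      have h7 := hd.trans h6
      rw [Nat.cast_add, Nat.cast_one] at h7
      exact ENat.WithBot.add_le_add_one_right_iff.1 h7
    obtain ⟨hdom, rs, hrs, hrs2⟩ := ih (Q ⧸ Ideal.span {y}) (fun j => Ideal.Quotient.mk _ (x (Fin.succAbove i j))) (by
      rw [← hmap]
      refine le_antisymm ?_ ?_
      · rw [Ideal.span_le]
        rintro _ ⟨j, rfl⟩
        refine Ideal.mem_map_of_mem _ ?_
        rw [← hx]; exact Ideal.subset_span ⟨_, rfl⟩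
      · refine (Ideal.map_mono hi).trans ?_
        rw [Ideal.map_sup, Ideal.map_quotient_self, bot_sup_eq, Ideal.map_span, ← Set.range_comp]
        rfl) hdim
    have hprime : (Ideal.span {y}).IsPrime := (Ideal.Quotient.isDomain_iff_prime _).1 hdom
    have hD : IsDomain Q := by
      obtain ⟨p, hp, hpy⟩ := Ideal.exists_minimalPrimes_le (I := ⊥) (J := Ideal.span {y}) bot_le
      have hp0 : p = ⊥ := by
        apply Submodule.eq_bot_of_le_smul_of_le_jacobson_bot (maximalIdeal Q) _ (IsNoetherian.noetherian _)
        · intro z hz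
          obtain ⟨a, rfl⟩ := Ideal.mem_span_singleton'.1 (hpy hz)
          have ha : a ∈ p := (hp.1.1.mem_or_mem hz).resolve_right (hyp p hp)
          rw [mul_comm]
          exact Ideal.mul_mem_mul hym ha
        · exact IsLocalRing.maximalIdeal_le_jacobson _
      have : (⊥ : Ideal Q).IsPrime := hp0 ▸ hp.1.1
      exact IsDomain.of_bot_isPrime Q
    refine ⟨hD, ?_⟩
    have hy0 : y ≠ 0 := fun h => hy2 (h ▸ zero_mem _)
    obtain ⟨rs', rfl⟩ : ∃ rs' : List Q, rs'.map (Ideal.Quotient.mk (Ideal.span {y})) = rs :=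
      List.map_surjective_iff.2 Ideal.Quotient.mk_surjective rs
    refine ⟨y :: rs', ?_, ?_⟩
    · rw [isRegular_cons_iff']
      refine ⟨?_, ?_⟩
      · intro a b hab
        exact mul_left_cancel₀ hy0 hab
      · refine (AddEquiv.isRegular_congr (e := (Submodule.quotEquivOfEq (y • (⊤ : Submodule Q Q)) (Ideal.span {y}) ?_).toAddEquiv) ?_).2 hrs
        · rw [← Submodule.ideal_span_singleton_smul, smul_eq_mul, Ideal.mul_top]
        · rw [List.forall₂_same]
          intro r _ x
          obtain ⟨r, rfl⟩ := Ideal.Quotient.mk_surjective r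
          obtain ⟨x, rfl⟩ := Submodule.Quotient.mk_surjective _ x
          rfl
    · rw [Ideal.ofList_cons]
      rw [← Ideal.map_ofList, ← hmap] at hrs2
      have h8 := congrArg (Ideal.comap (Ideal.Quotient.mk (Ideal.span {y}))) hrs2
      rw [Ideal.comap_map_of_surjective _ Ideal.Quotient.mk_surjective,
        Ideal.comap_map_of_surjective _ Ideal.Quotient.mk_surjective, ← RingHom.ker_eq_comap_bot, Ideal.mk_ker,
        sup_eq_left.2 ((Ideal.span_singleton_le_iff_mem _).2 hym)] at h8
      rw [sup_comm]; exact h8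

/-- residue field of quotient has finite projective dimension over a regular local ring -/
theorem pd_residue {Q A : Type u} [CommRing Q] [IsLocalRing Q] [IsNoetherianRing Q] [CommRing A] [IsLocalRing A]
    (n : ℕ) (x : Fin n → Q)
    (hx : Ideal.span (Set.range x) = maximalIdeal Q) (hd : (n : WithBot ℕ∞) ≤ ringKrullDim Q)
    (g : Q →+* A) (hg : Function.Surjective g) :
    ∃ n, HasProjectiveDimensionLT ((ModuleCat.restrictScalars g).obj (ModuleCat.of A (ResidueField A))) n := by
  obtain ⟨_, rs, h1, h2⟩ := regular_aux n Q x hx hd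
  have := ModuleCat.projectiveDimension_quotient_eq_add_length_of_isWeaklyRegular
        (ModuleCat.of Q Q) rs h1.1 (fun r hr => by rw [← h2]; exact Ideal.subset_span hr)
  refine ⟨rs.length + 1, ?_⟩
  have h3 : HasProjectiveDimensionLE (ModuleCat.of Q (Q ⧸ (Ideal.ofList rs • (⊤ : Submodule Q Q)))) rs.length := by
    rw [← projectiveDimension_le_iff]
    rw [this, ModuleCat.projectiveDimension_eq_zero_of_projective, zero_add]
  rw [h2, smul_eq_mul, Ideal.mul_top] at h3
  let φ : Q →ₗ[Q] ((ModuleCat.restrictScalars g).obj (ModuleCat.of A (ResidueField A))) :=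
    { toFun := fun q => residue A (g q)
      map_add' := fun a b => by simp; rfl
      map_smul' := fun a b => by
        rw [smul_eq_mul, map_mul, map_mul]; rfl }
  have hφ : Function.Surjective φ := (residue_surjective (R := A)).comp hg
  have hk : LinearMap.ker φ = maximalIdeal Q := by
    ext q
    change residue A (g q) = 0 ↔ _
    rw [residue_eq_zero_iff, mem_maximalIdeal, mem_maximalIdeal, mem_nonunits_iff, mem_nonunits_iff]
    have := IsLocalHom.of_surjective g hg
    rw [isUnit_map_iff]
  let e := (Submodule.quotEquivOfEq _ _ hk).symm.trans (φ.quotKerEquivOfSurjective hφ)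
  exact hasProjectiveDimensionLT_of_iso (X := ModuleCat.of Q (Q ⧸ maximalIdeal Q)) e.toModuleIso (rs.length + 1) 
end CT

namespace CT
open Abelian
open scoped Pointwise

/-- devissage for finitely generated modules over a Noetherian local ring -/
theorem devissage {A : Type u} [CommRing A] [IsLocalRing A] [IsNoetherianRing A]
    (P : ModuleCat.{u} A → Prop) (h0 : ∀ L : ModuleCat.{u} A, Subsingleton L → P L)
    (hk : P (ModuleCat.of A (ResidueField A)))
    (hext : ∀ {X Y Z : ModuleCat.{u} A} (f : X ⟶ Y) (g : Y ⟶ Z), SES f g → Module.Finite A X →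
      Module.Finite A Y → Module.Finite A Z → P X → P Z → P Y)
    (hreg : ∀ (L Z : ModuleCat.{u} A) (g : L ⟶ Z) (x : A), x ∈ maximalIdeal A → Module.Finite A L →
      Module.Finite A Z → SES (x • 𝟙 L) g → P Z → P L)
    (L : ModuleCat.{u} A) [Module.Finite A L] : P L := by
  suffices H : ∀ (I : Ideal A) (L : ModuleCat.{u} A), Module.Finite A L → I ≤ Module.annihilator A L → P L from
    H ⊥ L inferInstance bot_le
  intro I
  induction I using IsNoetherian.induction with
  | hgt I ih =>
  intro L hL hI
  have hiso : ∀ {X Y : Type u} [AddCommGroup X] [Module A X] [AddCommGroup Y] [Module A Y] (e : X ≃ₗ[A] Y)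
      [Module.Finite A X] (_ : P (ModuleCat.of A X)), P (ModuleCat.of A Y) := by
    intro X Y _ _ _ _ e _ hX
    have : Module.Finite A Y := Module.Finite.equiv e
    have := hext _ _ (SES.mk' (f := e.toLinearMap) (g := (0 : Y →ₗ[A] PUnit.{u+1})) e.injective
      ((e.exact_zero_iff_surjective _).2 e.surjective) (Function.surjective_to_subsingleton _)) inferInstance
      inferInstance inferInstance hX (h0 _ (inferInstanceAs (Subsingleton PUnit.{u+1})))
    exact this
  refine IsNoetherianRing.induction_on_isQuotientEquivQuotientPrime (A := A) (M := L) hL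
    (motive := fun N _ _ _ => I ≤ Module.annihilator A N → P (ModuleCat.of A N)) ?_ ?_ ?_ hI
  · intro N _ _ _ hN _
    exact h0 _ hN
  · intro N _ _ _ p e hN
    have hann : Module.annihilator A N = p.1 := by rw [e.annihilator_eq, Ideal.annihilator_quotient]
    rcases hN.lt_or_eq with h | h
    · exact ih _ h (ModuleCat.of A N) inferInstance le_rfl
    rw [hann] at h
    by_cases hp : p.1 = maximalIdeal A
    · exact hiso ((Submodule.quotEquivOfEq _ _ hp.symm).trans e.symm : (A ⧸ maximalIdeal A) ≃ₗ[A] N) hk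
    obtain ⟨x, hx, hxp⟩ : ∃ x ∈ maximalIdeal A, x ∉ p.1 := by
      by_contra! hcon
      exact hp (le_antisymm (IsLocalRing.le_maximalIdeal p.2.ne_top) hcon)
    have hr : IsSMulRegular N x := by
      rw [isSMulRegular_iff_right_eq_zero_of_smul]
      intro y hy
      apply e.injective
      rw [map_zero]
      obtain ⟨b, hb⟩ := Ideal.Quotient.mk_surjective (e y)
      have : x • e y = 0 := by rw [← map_smul, hy, map_zero]
      rw [← hb, Algebra.smul_def, Ideal.Quotient.algebraMap_eq, ← map_mul, Ideal.Quotient.eq_zero_iff_mem] at this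
      rw [← hb, Ideal.Quotient.eq_zero_iff_mem]
      exact (p.2.mem_or_mem this).resolve_left hxp
    let q := Submodule.mkQ (x • (⊤ : Submodule A N))
    have hq : Function.Surjective q := Submodule.mkQ_surjective _
    have hqx : ∀ y, q y = 0 ↔ ∃ z, x • z = y := by
      intro y
      rw [Submodule.mkQ_apply, Submodule.Quotient.mk_eq_zero, Submodule.mem_smul_pointwise_iff_exists]
      simp
    have hses : SES (x • 𝟙 (ModuleCat.of A N)) (ModuleCat.ofHom q) :=
      ⟨fun a b hab => hr hab, fun y => hqx y, hq⟩
    refine hreg (ModuleCat.of A N) _ (ModuleCat.ofHom q) x hx inferInstance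
      (Module.Finite.of_surjective q hq) hses (ih (I ⊔ Ideal.span {x}) ?_ _ (Module.Finite.of_surjective q hq) ?_)
    · refine lt_of_le_of_ne le_sup_left fun h' => hxp ?_
      rw [← h, h']
      exact Ideal.mem_sup_right (Ideal.mem_span_singleton_self x)
    · refine sup_le ?_ ?_
      · rw [h, ← hann]
        exact LinearMap.annihilator_le_of_surjective q hq
      · rw [Ideal.span_singleton_le_iff_mem, Module.mem_annihilator]
        intro m
        obtain ⟨m, rfl⟩ := hq m
        rw [← map_smul]
        exact (hqx _).2 ⟨m, rfl⟩
  · intro N1 _ _ _ N2 _ _ _ N3 _ _ _ f g hf hg hfg h1 h3 hN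
    exact hext _ _ (SES.mk' hf hfg hg) inferInstance inferInstance inferInstance
      (h1 (hN.trans (LinearMap.annihilator_le_of_injective f hf)))
      (h3 (hN.trans (LinearMap.annihilator_le_of_surjective g hg)))

/-- the cohomology operators over a quotient of a regular local ring -/
theorem exists_ops {Q A : Type u} [CommRing Q] [IsLocalRing Q] [IsNoetherianRing Q] [CommRing A] [IsLocalRing A]
    (n : ℕ) (x : Fin n → Q)
    (hx : Ideal.span (Set.range x) = maximalIdeal Q) (hd : (n : WithBot ℕ∞) ≤ ringKrullDim Q)
    (g : Q →+* A) (hg : Function.Surjective g) (rs : List Q) (hrs : RingTheory.Sequence.IsRegular Q rs)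
    (hker : RingHom.ker g = Ideal.ofList rs) :
    ∃ r, ∃ ω : Fin r → CentralOp A, ∀ L N : ModuleCat.{u} A, Module.Finite A L → Module.Finite A N → FGE ω L N := by
  have : IsNoetherianRing A := isNoetherianRing_of_surjective Q A g hg
  obtain ⟨r, ω, hω⟩ := fg_tower rs.length Q A g hg rs rfl hrs hker
  refine ⟨r, ω, fun L N hL hN => hω L N hL hN ?_⟩
  have hfin : ∀ L : ModuleCat.{u} A, Module.Finite A L → Module.Finite Q ((ModuleCat.restrictScalars g).obj L) := by
    intro L hL
    obtain ⟨m, s, hs⟩ := Module.Finite.exists_fin (R := A) (M := L)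
    classical
    refine ⟨⟨Finset.univ.image (fun i => (show ((ModuleCat.restrictScalars g).obj L) from s i)), ?_⟩⟩
    rw [eq_top_iff]
    intro y _
    have hy : (rsId g L y) ∈ Submodule.span A (Set.range s) := by rw [hs]; trivial
    obtain ⟨w, hw⟩ := (Submodule.mem_span_range_iff_exists_fun A).1 hy
    choose w' hw' using fun i => hg (w i)
    have : y = ∑ i, w' i • (show ((ModuleCat.restrictScalars g).obj L) from s i) := by
      refine hw.symm.trans ?_
      refine Finset.sum_congr rfl fun i _ => ?_
      rw [← hw']; rfl
    rw [this]
    exact Submodule.sum_mem _ fun i _ => Submodule.smul_mem _ _ (Submodule.subset_span (Finset.mem_coe.2 (Finset.mem_image_of_mem _ (Finset.mem_univ i))))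
  refine devissage (P := fun L => ∃ n, HasProjectiveDimensionLT ((ModuleCat.restrictScalars g).obj L) n)
    ?_ (pd_residue n x hx hd g hg) ?_ ?_ L
  · intro L hL
    refine ⟨0, ?_⟩
    have : Subsingleton ((ModuleCat.restrictScalars g).obj L) := hL
    exact (ModuleCat.isZero_of_subsingleton _).hasProjectiveDimensionLT_zero
  · rintro X Y Z f k h _ _ _ ⟨a, ha⟩ ⟨b, hb⟩
    refine ⟨max a b, ?_⟩
    have h' : SES ((ModuleCat.restrictScalars g).map f) ((ModuleCat.restrictScalars g).map k) := ⟨h.inj, h.exact, h.surj⟩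
    exact h'.se.hasProjectiveDimensionLT_X₂ _ (hasProjectiveDimensionLT_of_ge _ a _ (le_max_left _ _))
      (hasProjectiveDimensionLT_of_ge _ b _ (le_max_right _ _))
  · rintro L Z q x hx hL _ hs ⟨n, hn⟩
    have := hfin L hL
    obtain ⟨y, rfl⟩ := hg x
    have := IsLocalHom.of_surjective g hg
    have hy : y ∈ maximalIdeal Q := by
      rw [mem_maximalIdeal, mem_nonunits_iff] at hx ⊢
      exact fun h => hx (h.map g)
    have hr' : IsSMulRegular ((ModuleCat.restrictScalars g).obj L) y := fun a b hab => hs.inj hab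
    have key := ModuleCat.projectiveDimension_quotSMulTop_eq_succ_of_isSMulRegular
      ((ModuleCat.restrictScalars g).obj L) y hr' hy
    let q' := ((ModuleCat.restrictScalars g).map q).hom
    have hq' : Function.Surjective q' := hs.surj
    have hk : LinearMap.ker q' = y • ⊤ := by
      ext z
      rw [Submodule.mem_smul_pointwise_iff_exists, LinearMap.mem_ker]
      refine (hs.exact z).trans ?_
      simp only [Submodule.mem_top, true_and]
      rfl
    let e : QuotSMulTop y ((ModuleCat.restrictScalars g).obj L) ≃ₗ[Q] 
      (ModuleCat.restrictScalars g).obj Z := (Submodule.quotEquivOfEq _ _ hk.symm).trans (q'.quotKerEquivOfSurjective hq')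
    have hn' := hasProjectiveDimensionLT_of_iso e.symm.toModuleIso n
    refine ⟨n, ?_⟩
    rw [← projectiveDimension_lt_iff] at hn' ⊢
    refine lt_of_le_of_lt ?_ hn'
    change _ ≤ projectiveDimension (ModuleCat.of Q (QuotSMulTop y ((ModuleCat.restrictScalars g).obj L)))
    rw [key]
    exact le_add_of_nonneg_right zero_le_one
end CT

namespace CT
open Abelian

section nu
variable (A : Type u) [CommRing A] [IsLocalRing A]

/-- minimal number of generators -/
noncomputable def nu (X : Type v) [AddCommGroup X] [Module A X] : ℕ :=
  Module.finrank (ResidueField A) (TensorProduct A (ResidueField A) X)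

variable {X Y Z : Type*} [AddCommGroup X] [Module A X] [AddCommGroup Y] [Module A Y]
  [AddCommGroup Z] [Module A Z]

variable {A}

theorem nu_exact [Module.Finite A X] [Module.Finite A Y] [Module.Finite A Z] (f : X →ₗ[A] Y) (g : Y →ₗ[A] Z)
    (h : Function.Exact f g) (hg : Function.Surjective g) :
    nu A Y ≤ nu A X + nu A Z := by
  let f' := f.baseChange (ResidueField A)
  let g' := g.baseChange (ResidueField A)
  have hex : Function.Exact f' g' := lTensor_exact (ResidueField A) h hg
  have := LinearMap.finrank_range_add_finrank_ker g'
  have h1 : Module.finrank (ResidueField A) (LinearMap.range g') ≤ nu A Z := Submodule.finrank_le _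
  have h2 : Module.finrank (ResidueField A) (LinearMap.ker g') ≤ nu A X := by
    rw [hex.linearMap_ker_eq]
    exact LinearMap.finrank_range_le f'
  unfold nu at *
  omega

theorem nu_le_of_surj [Module.Finite A Y] (g : Y →ₗ[A] Z) (hg : Function.Surjective g) : nu A Z ≤ nu A Y := by
  have : Function.Surjective (g.baseChange (ResidueField A)) := LinearMap.lTensor_surjective (ResidueField A) hg
  exact LinearMap.finrank_le_finrank_of_surjective this

theorem nu_congr (e : X ≃ₗ[A] Y) : nu A X = nu A Y :=
  (e.baseChange A (ResidueField A) X Y).finrank_eq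

theorem nu_small [Module.Finite A Y] [Module.Finite A Z] (f : X →ₗ[A] Y) (g : Y →ₗ[A] Z)
    (h : Function.Exact f g) (hg : Function.Surjective g) (x : A) (hx : x ∈ maximalIdeal A)
    (hf : ∀ y, ∃ z, f y = x • z) :
    nu A Y ≤ nu A Z := by
  let f' := f.baseChange (ResidueField A)
  let g' := g.baseChange (ResidueField A)
  have hex : Function.Exact f' g' := lTensor_exact (ResidueField A) h hg
  have hf' : ∀ z, f' z = 0 := by
    intro z
    induction z with
    | zero => simp
    | add a b ha hb => rw [map_add, ha, hb, add_zero]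
    | tmul a b =>
      obtain ⟨z, hz⟩ := hf b
      have : x • a = 0 := by
        rw [Algebra.smul_def, ResidueField.algebraMap_eq, (residue_eq_zero_iff x).2 hx, zero_mul]
      rw [LinearMap.baseChange_tmul, hz, TensorProduct.tmul_smul, TensorProduct.smul_tmul', this, TensorProduct.zero_tmul]
  refine LinearMap.finrank_le_finrank_of_injective (f := g') ?_
  rw [injective_iff_map_eq_zero]
  intro a ha
  obtain ⟨b, rfl⟩ := (hex a).1 ha
  exact hf' b

theorem nu_sub (h : ∀ a ∈ maximalIdeal A, ∀ x : X, a • x = 0) [Module.Finite A X] (W : Submodule A X) :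
    nu A W ≤ nu A X := by
  have h' : Module.IsTorsionBySet A X (maximalIdeal A : Set A) := fun x a => h a.1 a.2 x
  let _ : Module (ResidueField A) X := h'.module
  have hs : ∀ (a : A) (x : X), residue A a • x = a • x := fun a x => rfl
  let W' : Submodule (ResidueField A) X :=
    { W with
      smul_mem' := by
        intro a x hx
        obtain ⟨a, rfl⟩ := residue_surjective a
        rw [hs]
        exact W.smul_mem a hx }
  obtain ⟨p, hp⟩ := W'.subtype.exists_leftInverse_of_injective (by simp)
  let p' : X →ₗ[A] W :=
    { toFun := fun x => p x
      map_add' := map_add p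
      map_smul' := fun a x => by
        rw [← hs, map_smul]
        rfl }
  refine nu_le_of_surj p' fun w => ⟨w, ?_⟩
  exact LinearMap.congr_fun hp w
end nu

/-- growth bounded by mu -/
def Bdd (μ a : ℕ → ℕ) : Prop := ∃ C e : ℕ, ∀ m, ∑ n ∈ Finset.range m, a n ≤ C * ∑ n ∈ Finset.range (m + e), μ n

theorem Bdd.mono {μ a b : ℕ → ℕ} (h : Bdd μ b) (hab : ∀ n, a n ≤ b n) : Bdd μ a := by
  obtain ⟨C, e, h⟩ := h
  exact ⟨C, e, fun m => (Finset.sum_le_sum fun n _ => hab n).trans (h m)⟩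

theorem Bdd.add {μ a b : ℕ → ℕ} (ha : Bdd μ a) (hb : Bdd μ b) : Bdd μ (fun n => a n + b n) := by
  obtain ⟨C, e, h⟩ := ha
  obtain ⟨C', e', h'⟩ := hb
  refine ⟨C + C', e + e', fun m => ?_⟩
  rw [Finset.sum_add_distrib, add_mul]
  refine add_le_add ((h m).trans (Nat.mul_le_mul_left _ ?_)) ((h' m).trans (Nat.mul_le_mul_left _ ?_)) <;>
  exact Finset.sum_le_sum_of_subset (Finset.range_mono (by omega))

theorem Bdd.shift {μ a : ℕ → ℕ} (h : Bdd μ a) : Bdd μ (fun n => a (n + 1)) := by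
  obtain ⟨C, e, h⟩ := h
  refine ⟨C, e + 1, fun m => ?_⟩
  refine le_trans ?_ ((h (m + 1)).trans (by rw [show m + 1 + e = m + (e + 1) by omega]))
  rw [Finset.sum_range_succ']
  exact Nat.le_add_right _ _

section cmp
variable {A : Type u} [CommRing A] [IsLocalRing A] [IsNoetherianRing A] {r : ℕ} (ω : Fin r → CentralOp A)
  (T : ModuleCat.{u} A) [Module.Finite A T]

/-- the comparison property -/
def Cmp (L : ModuleCat.{u} A) : Prop :=
  ∀ W : ∀ n, Submodule A (Ext L T n), Stable (extOp ω L T) W →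
    Bdd (fun n => nu A (Ext (ModuleCat.of A (ResidueField A)) T n)) (fun n => nu A (W n))

/-- colon family -/
noncomputable def colon {L : ModuleCat.{u} A} (x : A) (W : ∀ n, Submodule A (Ext L T n)) : ∀ n, Submodule A (Ext L T n) :=
  fun n => (W n).comap (x • LinearMap.id)

theorem mem_colon {L : ModuleCat.{u} A} (x : A) (W : ∀ n, Submodule A (Ext L T n)) (n : ℕ) (v : Ext L T n) :
    v ∈ colon T x W n ↔ x • v ∈ W n := Iff.rfl

theorem cmp_reg {L Z : ModuleCat.{u} A} (g : L ⟶ Z) (x : A) (hx : x ∈ maximalIdeal A) [Module.Finite A L]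
    [Module.Finite A Z] (hs : SES (x • 𝟙 L) g) (hL : FGE ω L T) (h : Cmp ω T Z) : Cmp ω T L := by
  let δ : ∀ n, Ext L T n →ₗ[A] Ext Z T (n + 1) := fun n => pre hs.cls T (add_comm 1 n)
  have hpre : ∀ n (v : Ext L T n), (Ext.mk₀ (x • 𝟙 L)).comp v (zero_add n) = x • v := by
    intro n v
    rw [Ext.mk₀_smul, Ext.smul_comp, Ext.mk₀_id_comp]
  have hδ1 : ∀ n v, δ n v = 0 → ∃ y, x • y = v := by
    intro n v hv
    obtain ⟨y, hy⟩ := hs.con1 v (add_comm 1 n) hv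
    exact ⟨y, (hpre n y).symm.trans hy⟩
  have hδ2 : ∀ n v, δ n (x • v) = 0 := by
    intro n v
    rw [← hpre]
    change hs.cls.comp _ (add_comm 1 n) = 0
    rw [← Ext.comp_assoc (a₁₂ := 1) _ _ _ rfl (by omega) (by omega), hs.cls_f, Ext.zero_comp]
  have hδs : ∀ W : ∀ n, Submodule A (Ext L T n), Stable (extOp ω L T) W → 
      Bdd (fun n => nu A (Ext (ModuleCat.of A (ResidueField A)) T n)) (fun n => nu A ((W n).map (δ n))) := by
    intro W hW
    let W' : ∀ n, Submodule A (Ext Z T n) := fun n => match n with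
      | 0 => ⊥
      | n + 1 => (W n).map (δ n)
    refine (h W' ?_).shift
    intro j n v hv
    match n, v, hv with
    | 0, v, hv =>
      rw [(Submodule.mem_bot A).1 hv, map_zero]; exact zero_mem _
    | n + 1, _, ⟨w, hw, rfl⟩ =>
      exact ⟨_, hW j n w hw, pre_extOp ω _ _ _ _ _ _⟩
  have hcs : ∀ W : ∀ n, Submodule A (Ext L T n), Stable (extOp ω L T) W → Stable (extOp ω L T) (colon T x W) := by
    intro W hW j n v hv
    rw [mem_colon] at hv ⊢
    rw [← map_smul]
    exact hW j n _ hv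
  have step : ∀ W : ∀ n, Submodule A (Ext L T n), Stable (extOp ω L T) W → 
      Bdd (fun n => nu A (Ext (ModuleCat.of A (ResidueField A)) T n)) (fun n => nu A (colon T x W n)) →
      Bdd (fun n => nu A (Ext (ModuleCat.of A (ResidueField A)) T n)) (fun n => nu A (W n)) := by
    intro W hW hb
    refine (hb.add (hδs W hW)).mono fun n => ?_
    refine nu_exact ((x • (LinearMap.id : Ext L T n →ₗ[A] Ext L T n)).restrict (p := colon T x W n) (q := W n) fun w hw => hw)
      ((δ n).restrict (p := W n) (q := (W n).map (δ n)) fun w hw => ⟨w, hw, rfl⟩) ?_ ?_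
    · rintro ⟨w, hw⟩
      constructor
      · intro h
        obtain ⟨y, rfl⟩ := hδ1 n w (congrArg Subtype.val h)
        exact ⟨⟨y, hw⟩, rfl⟩
      · rintro ⟨⟨y, hy'⟩, hy⟩
        obtain rfl := congrArg Subtype.val hy
        exact Subtype.ext (hδ2 n y)
    · rintro ⟨_, w, hw, rfl⟩
      exact ⟨⟨w, hw⟩, rfl⟩
  have last : ∀ W : ∀ n, Submodule A (Ext L T n), Stable (extOp ω L T) W → (∀ n, colon T x W n = W n) → 
      Bdd (fun n => nu A (Ext (ModuleCat.of A (ResidueField A)) T n)) (fun n => nu A (W n)) := by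
    intro W hW hb
    refine (hδs W hW).mono fun n => ?_
    refine nu_small ((x • (LinearMap.id : W n →ₗ[A] W n)))
      ((δ n).restrict (p := W n) (q := (W n).map (δ n)) fun w hw => ⟨w, hw, rfl⟩) ?_ ?_ x hx (fun y => ⟨y, rfl⟩)
    · rintro ⟨w, hw⟩
      constructor
      · intro h
        obtain ⟨y, rfl⟩ := hδ1 n w (congrArg Subtype.val h)
        exact ⟨⟨y, by rw [← hb]; exact hw⟩, rfl⟩
      · rintro ⟨⟨y, hy'⟩, hy⟩
        obtain rfl := congrArg Subtype.val hy
        exact Subtype.ext (hδ2 n y)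
    · rintro ⟨_, w, hw, rfl⟩
      exact ⟨⟨w, hw⟩, rfl⟩
  intro W hW
  let U : ℕ → ∀ n, Submodule A (Ext L T n) := fun i => (colon T x)^[i] W
  have hU1 : ∀ i, U (i + 1) = colon T x (U i) := fun i => Function.iterate_succ_apply' _ _ _
  have hUs : ∀ i, Stable (extOp ω L T) (U i) := by
    intro i
    induction i with
    | zero => exact hW
    | succ i ih => rw [hU1]; exact hcs _ ih
  have hmono : ∀ n, Monotone (fun i => U i n) := by
    intro n
    refine monotone_nat_of_le_succ fun i => ?_
    rw [hU1]
    intro v hv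
    exact (U i n).smul_mem x hv
  obtain ⟨a, ha⟩ := acc_stable (extOp ω L T) (extOp_comm ω _ _) hL U hUs (fun i j hij n => hmono n hij)
  have hd : ∀ i, i ≤ a → Bdd (fun n => nu A (Ext (ModuleCat.of A (ResidueField A)) T n)) (fun n => nu A (U (a - i) n)) := by
    intro i
    induction i with
    | zero =>
      intro _
      refine last (U a) (hUs a) fun n => ?_
      rw [← hU1]
      exact ha (a + 1) (by omega) n
    | succ i ih =>
      intro hi
      refine step _ (hUs _) ?_
      rw [← hU1, show a - (i + 1) + 1 = a - i by omega]
      exact ih (by omega)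
  have := hd a le_rfl
  rw [Nat.sub_self] at this
  exact this

theorem cmp_ext {X Y Z : ModuleCat.{u} A} (f : X ⟶ Y) (g : Y ⟶ Z) [Module.Finite A X] [Module.Finite A Y]
    [Module.Finite A Z] (hs : SES f g) (h1 : Cmp ω T X) (h3 : Cmp ω T Z) : Cmp ω T Y := by
  intro W hW
  let F : ∀ n, Ext Y T n →ₗ[A] Ext X T n := fun n => pre (Ext.mk₀ f) T (zero_add n)
  let G : ∀ n, Ext Z T n →ₗ[A] Ext Y T n := fun n => pre (Ext.mk₀ g) T (zero_add n)
  have b1 := h1 (fun n => (W n).map (F n)) (by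
    rintro j n _ ⟨w, hw, rfl⟩
    refine ⟨_, hW j n w hw, ?_⟩
    exact pre_extOp ω _ _ (zero_add n) _ _ _)
  have b3 := h3 (fun n => (W n).comap (G n)) (by
    intro j n w hw
    rw [Submodule.mem_comap] at hw ⊢
    have := hW j n _ hw
    rwa [← pre_extOp ω _ _ (zero_add n) _ _ (zero_add (n+2))] at this)
  refine (b3.add b1).mono fun n => ?_
  refine nu_exact ((G n).restrict (p := (W n).comap (G n)) (q := W n) fun w hw => hw)
    ((F n).restrict (p := W n) (q := (W n).map (F n)) fun w hw => ⟨w, hw, rfl⟩) ?_ ?_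
  · rintro ⟨w, hw⟩
    constructor
    · intro h
      obtain ⟨y, hy⟩ := hs.con2 w (congrArg Subtype.val h)
      exact ⟨⟨y, by rw [Submodule.mem_comap]; exact (congrArg (· ∈ W n) hy).mpr hw⟩, Subtype.ext hy⟩
    · rintro ⟨⟨y, hy'⟩, hy⟩
      obtain rfl := congrArg Subtype.val hy
      apply Subtype.ext
      change (Ext.mk₀ f).comp ((Ext.mk₀ g).comp y (zero_add n)) (zero_add n) = 0
      rw [← Ext.comp_assoc (a₁₂ := 0) _ _ _ rfl (by omega) (by omega),
        Ext.mk₀_comp_mk₀, hs.zero, Ext.mk₀_zero, Ext.zero_comp]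
  · rintro ⟨_, w, hw, rfl⟩
    exact ⟨⟨w, hw⟩, rfl⟩

theorem cmp_all (hω : ∀ L N : ModuleCat.{u} A, Module.Finite A L → Module.Finite A N → FGE ω L N)
    (L : ModuleCat.{u} A) [Module.Finite A L] : Cmp ω T L := by
  refine devissage (P := Cmp ω T) ?_ ?_ ?_ ?_ L
  · intro L hL W hW
    refine ⟨0, 0, fun m => ?_⟩
    rw [zero_mul, Nat.le_zero, Finset.sum_eq_zero_iff]
    intro n _
    have : Subsingleton (Ext L T n) := by
      refine ⟨fun a b => ?_⟩
      have h : 𝟙 L = 0 := by ext x; exact Subsingleton.elim _ _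
      rw [← Ext.mk₀_id_comp a, ← Ext.mk₀_id_comp b, h]
      simp
    have := Module.finrank_zero_of_subsingleton (R := ResidueField A) (M := TensorProduct A (ResidueField A) (W n))
    exact this
  · intro W hW
    refine ⟨1, 0, fun m => ?_⟩
    rw [one_mul, add_zero]
    refine Finset.sum_le_sum fun n _ => nu_sub ?_ _
    intro a ha x
    have h : a • 𝟙 (ModuleCat.of A (ResidueField A)) = 0 := by
      ext x
      change a • x = 0
      rw [Algebra.smul_def, ResidueField.algebraMap_eq, (residue_eq_zero_iff a).2 ha, zero_mul]
    rw [← Ext.mk₀_id_comp (a • x), Ext.comp_smul, ← Ext.smul_comp, ← Ext.mk₀_smul, h]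
    simp
  · intro X Y Z f g h _ _ _ h1 h2
    exact cmp_ext ω T f g h h1 h2
  · intro L Z g x hx _ _ hs hZ
    exact cmp_reg ω T g x hx hs (hω _ _ inferInstance inferInstance) hZ
end cmp
end CT

namespace CT
open Abelian

section isH
variable {A : Type u} [CommRing A] {Q R H H' : Type*} [AddCommGroup Q] [Module A Q] [AddCommGroup R] [Module A R]
  [AddCommGroup H] [Module A H] [AddCommGroup H'] [Module A H']

/-- `H` is the homology of cycles `ker g` modulo `B` -/
def IsH (B : Submodule A Q) (g : Q →ₗ[A] R) (H : Type*) [AddCommGroup H] [Module A H] : Prop :=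
  ∃ p : LinearMap.ker g →ₗ[A] H, Function.Surjective p ∧ ∀ z, p z = 0 ↔ (z : Q) ∈ B

theorem IsH.equiv {B : Submodule A Q} {g : Q →ₗ[A] R} (h : IsH B g H) (h' : IsH B g H') : Nonempty (H ≃ₗ[A] H') := by
  obtain ⟨p, hp, hp2⟩ := h
  obtain ⟨p', hp', hp2'⟩ := h'
  refine ⟨(p.quotKerEquivOfSurjective hp).symm.trans ((Submodule.quotEquivOfEq _ _ ?_).trans
    (p'.quotKerEquivOfSurjective hp'))⟩
  ext z
  rw [LinearMap.mem_ker, LinearMap.mem_ker, hp2, hp2']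

theorem IsH.of_equiv {B : Submodule A Q} {g : Q →ₗ[A] R} (h : IsH B g H) (e : H ≃ₗ[A] H') : IsH B g H' := by
  obtain ⟨p, hp, hp2⟩ := h
  exact ⟨e.toLinearMap.comp p, e.surjective.comp hp, fun z => by simp [hp2]⟩
end isH

variable {A : Type u} [CommRing A]

/-- projective resolutions, concretely -/
structure PRes (M : ModuleCat.{u} A) where
  X : ℕ → ModuleCat.{u} A
  proj : ∀ n, Projective (X n)
  d : ∀ n, X (n + 1) ⟶ X n
  aug : X 0 ⟶ M
  surj : Function.Surjective aug
  ex0 : Function.Exact (d 0) aug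
  exs : ∀ n, Function.Exact (d (n + 1)) (d n)

namespace PRes
variable {M : ModuleCat.{u} A} (P : PRes M) (N : ModuleCat.{u} A)

/-- dual differential -/
def D (n : ℕ) : (P.X n ⟶ N) →ₗ[A] (P.X (n + 1) ⟶ N) := Linear.leftComp A N (P.d n)

theorem D_apply (n : ℕ) (φ : P.X n ⟶ N) : P.D N n φ = P.d n ≫ φ := rfl

/-- first syzygy -/
def syz : ModuleCat.{u} A := ModuleCat.of A (LinearMap.ker P.aug.hom)

/-- inclusion of the syzygy -/
def inc : P.syz ⟶ P.X 0 := ModuleCat.ofHom (LinearMap.ker P.aug.hom).subtype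

theorem ses : SES P.inc P.aug :=
  ⟨Subtype.val_injective, fun y => by
    constructor
    · intro h; exact ⟨⟨y, h⟩, rfl⟩
    · rintro ⟨⟨z, hz⟩, rfl⟩; exact hz, P.surj⟩

/-- augmentation of the shifted resolution -/
def aug' : P.X 1 ⟶ P.syz := ModuleCat.ofHom ((P.d 0).hom.codRestrict _ fun x => P.ex0.apply_apply_eq_zero x)

theorem aug'_inc : P.aug' ≫ P.inc = P.d 0 := rfl

/-- shifted resolution -/
def shift : PRes P.syz where
  X n := P.X (n + 1)
  proj n := P.proj (n + 1)
  d n := P.d (n + 1)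
  aug := P.aug'
  surj := by
    rintro ⟨y, hy⟩
    obtain ⟨z, rfl⟩ := (P.ex0 y).1 hy
    exact ⟨z, rfl⟩
  ex0 := by
    intro y
    refine Iff.trans ?_ (P.exs 0 y)
    exact Subtype.ext_iff
  exs n := P.exs (n + 1)

theorem isH_hom : ∃ p : LinearMap.ker (P.D N 0) →ₗ[A] (M ⟶ N), Function.Bijective p ∧ ∀ z, P.aug ≫ p z = z.1 := by
  have hepi : Epi P.aug := (ModuleCat.epi_iff_surjective _).2 P.surj
  let q : (M ⟶ N) →ₗ[A] LinearMap.ker (P.D N 0) := (Linear.leftComp A N P.aug).codRestrict _ (fun φ => by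
    rw [LinearMap.mem_ker, D_apply]
    change P.d 0 ≫ P.aug ≫ φ = 0
    have : P.d 0 ≫ P.aug = 0 := by ext x; exact P.ex0.apply_apply_eq_zero x
    rw [← Category.assoc, this, Limits.zero_comp])
  have hq : Function.Bijective q := by
    constructor
    · intro φ ψ h
      exact (cancel_epi P.aug).1 (congrArg Subtype.val h)
    · rintro ⟨φ, hφ⟩
      rw [LinearMap.mem_ker, D_apply] at hφ
      have hle : LinearMap.ker P.aug.hom ≤ LinearMap.ker φ.hom := by
        intro x hx
        obtain ⟨y, rfl⟩ := (P.ex0 x).1 hx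
        exact congrArg (fun f => f.hom y) hφ
      refine ⟨ModuleCat.ofHom (((LinearMap.ker P.aug.hom).liftQ φ.hom hle).comp 
        (P.aug.hom.quotKerEquivOfSurjective P.surj).symm.toLinearMap), ?_⟩
      apply Subtype.ext
      ext x
      change ((LinearMap.ker P.aug.hom).liftQ φ.hom hle) ((P.aug.hom.quotKerEquivOfSurjective P.surj).symm (P.aug.hom x)) = _
      have : (P.aug.hom.quotKerEquivOfSurjective P.surj).symm (P.aug.hom x) = Submodule.Quotient.mk x := by
        rw [LinearEquiv.symm_apply_eq]; rfl
      rw [this]; rfl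
  refine ⟨(LinearEquiv.ofBijective q hq).symm.toLinearMap, (LinearEquiv.ofBijective q hq).symm.bijective, fun z => ?_⟩
  exact congrArg Subtype.val ((LinearEquiv.ofBijective q hq).apply_symm_apply z)

theorem isH_zero : IsH ⊥ (P.D N 0) (Ext M N 0) := by
  obtain ⟨p, hp, -⟩ := P.isH_hom N
  refine IsH.of_equiv ⟨p, hp.2, fun z => ?_⟩ (Ext.linearEquiv₀ (R := A)).symm
  rw [map_eq_zero_iff p hp.1, Submodule.mem_bot]
  exact Subtype.ext_iff

theorem isH_succ (n : ℕ) : IsH (LinearMap.range (P.D N n)) (P.D N (n + 1)) (Ext M N (n + 1)) := by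
  induction n generalizing M with
  | zero =>
    have := P.proj 0
    obtain ⟨p, hp, hp2⟩ := P.shift.isH_hom N
    let δ : Ext P.syz N 0 →ₗ[A] Ext M N (0 + 1) := pre P.ses.cls N (by omega)
    refine ⟨δ.comp ((Ext.linearEquiv₀ (R := A)).symm.toLinearMap.comp p), ?_, ?_⟩
    · refine Function.Surjective.comp (g := δ) ?_ ((Ext.linearEquiv₀ (R := A)).symm.surjective.comp hp.2)
      exact fun x => P.ses.con_surj x (by omega)
    · intro z
      constructor
      · intro h
        obtain ⟨y, hy⟩ := P.ses.con1 _ (by omega) h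
        obtain ⟨φ, rfl⟩ := (Ext.mk₀_bijective _ _).2 y
        refine ⟨φ, ?_⟩
        rw [Ext.mk₀_comp_mk₀] at hy
        have hy2 : P.inc ≫ φ = p z := (Ext.mk₀_bijective _ _).1 hy
        rw [D_apply, ← P.aug'_inc, Category.assoc, hy2]
        exact hp2 z
      · rintro ⟨φ, hφ⟩
        have : p z = P.inc ≫ φ := by
          have hepi : Epi P.aug' := (ModuleCat.epi_iff_surjective _).2 P.shift.surj
          rw [← cancel_epi P.aug']
          exact (hp2 z).trans hφ.symm
        change P.ses.cls.comp (Ext.mk₀ (p z)) (by omega) = 0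
        rw [this, ← Ext.mk₀_comp_mk₀, ← Ext.comp_assoc (a₁₂ := 1) _ _ _ rfl (by omega) (by omega), P.ses.cls_f,
          Ext.zero_comp]
  | succ n ih =>
    have := P.proj 0
    have := ih P.shift
    refine this.of_equiv (LinearEquiv.ofBijective (pre P.ses.cls N (by omega)) ⟨?_, ?_⟩)
    · rw [injective_iff_map_eq_zero]
      intro x hx
      obtain ⟨y, rfl⟩ := P.ses.con1 _ (by omega) hx
      have : Subsingleton (Ext (P.X 0) N (n + 1)) := Ext.subsingleton_of_projective _ _ _
      rw [Subsingleton.elim y 0, Ext.comp_zero]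
    · exact fun x => P.ses.con_surj x (by omega)
end PRes

theorem isH_sc (S : ShortComplex (ModuleCat.{u} A)) : IsH (LinearMap.range S.f.hom) S.g.hom S.homology := by
  refine IsH.of_equiv (H := S.moduleCatLeftHomologyData.H) ?_ S.moduleCatHomologyIso.symm.toLinearEquiv
  refine ⟨Submodule.mkQ _, Submodule.mkQ_surjective _, fun z => ?_⟩
  refine (Submodule.Quotient.mk_eq_zero (LinearMap.range S.moduleCatToCycles) (x := z)).trans ?_
  constructor
  · rintro ⟨w, rfl⟩
    exact ⟨w, rfl⟩
  · rintro ⟨w, hw⟩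
    exact ⟨w, Subtype.ext hw⟩

/-- comparison of the two Ext modules -/
theorem ext_bridge (M N : ModuleCat.{u} A) (n : ℕ) :
    Nonempty (((_root_.Ext A (ModuleCat.{u} A) n).obj (op M)).obj N ≃ₗ[A] Ext M N n) := by
  let P := projectiveResolution M
  let P' : PRes M :=
    { X := P.complex.X
      proj := P.projective
      d := fun n => P.complex.d (n + 1) n
      aug := P.π.f 0
      surj := (ModuleCat.epi_iff_surjective (P.π.f 0)).1 inferInstance
      ex0 := (ShortComplex.ShortExact.moduleCat_exact_iff_function_exact _).1 P.exact₀
      exs := fun n => (ShortComplex.ShortExact.moduleCat_exact_iff_function_exact _).1 (P.exact_succ n) }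
  let e := (P.isoExt (R := A) n N).toLinearEquiv
  cases n with
  | zero =>
    let e' := ((P.complex.linearYonedaObj A N).homologyIsoSc' 0 0 1 (by simp) (by simp)).toLinearEquiv
    have h1 := isH_sc ((P.complex.linearYonedaObj A N).sc' 0 0 1)
    have h2 := P'.isH_zero N
    have h3 : LinearMap.range ((P.complex.linearYonedaObj A N).sc' 0 0 1).f.hom = ⊥ := by
      rw [LinearMap.range_eq_bot]
      change ((P.complex.linearYonedaObj A N).d 0 0).hom = 0
      rw [(P.complex.linearYonedaObj A N).shape 0 0 (by simp)]; rfl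
    rw [h3] at h1
    obtain ⟨e2⟩ := h1.equiv h2
    exact ⟨e.trans (e'.trans e2)⟩
  | succ n =>
    let e' := ((P.complex.linearYonedaObj A N).homologyIsoSc' n (n+1) (n+2) (by simp) (by simp)).toLinearEquiv
    have h1 := isH_sc ((P.complex.linearYonedaObj A N).sc' n (n+1) (n+2))
    have h2 := P'.isH_succ N n
    obtain ⟨e2⟩ := h1.equiv h2
    exact ⟨e.trans (e'.trans e2)⟩
end CT

namespace CT
open Abelian

/-- free resolutions -/
structure FRes (A : Type u) [CommRing A] (M : Type u) [AddCommGroup M] [Module A M] : Type u where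
  b : ℕ → ℕ
  d : (n : ℕ) → ((Fin (b (n + 1)) → A) →ₗ[A] (Fin (b n) → A))
  aug : (Fin (b 0) → A) →ₗ[A] M
  surj : Function.Surjective aug
  ex0 : Function.Exact (d 0) aug
  exs : ∀ n, Function.Exact (d (n + 1)) (d n)

variable {A : Type u} [CommRing A]

/-- underlying projective resolution -/
noncomputable def FRes.toPRes {M : Type u} [AddCommGroup M] [Module A M] (F : FRes A M) : PRes (ModuleCat.of A M) where
  X n := ModuleCat.of A (Fin (F.b n) → A)
  proj n := ModuleCat.projective_of_free (Pi.basisFun A (Fin (F.b n)))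
  d n := ModuleCat.ofHom (F.d n)
  aug := ModuleCat.ofHom F.aug
  surj := F.surj
  ex0 := F.ex0
  exs := F.exs

theorem exists_cover [IsLocalRing A] (M : Type u) [AddCommGroup M] [Module A M] [Module.Finite A M] :
    ∃ (b : ℕ) (f : (Fin b → A) →ₗ[A] M), Function.Surjective f ∧ ∀ x, f x = 0 → ∀ i, x i ∈ maximalIdeal A := by
  classical
  let b := Module.finrank (ResidueField A) (TensorProduct A (ResidueField A) M)
  let B : Module.Basis (Fin b) (ResidueField A) (TensorProduct A (ResidueField A) M) := Module.finBasis _ _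
  have hs : Function.Surjective (TensorProduct.mk A (ResidueField A) M 1) :=
    TensorProduct.mk_surjective A M (ResidueField A) (IsLocalRing.residue_surjective)
  choose w hw using fun i => hs (B i)
  have htop := IsLocalRing.span_eq_top_of_tmul_eq_basis w B hw
  refine ⟨b, Fintype.linearCombination A w, ?_, ?_⟩
  · rw [← LinearMap.range_eq_top, Fintype.range_linearCombination, htop]
  · intro x hx i
    have h1 : ∑ j, (residue A (x j)) • B j = 0 := by
      have h2 := congrArg (TensorProduct.mk A (ResidueField A) M 1) hx
      rw [Fintype.linearCombination_apply, map_sum, map_zero] at h2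
      rw [← h2]
      refine Finset.sum_congr rfl fun j _ => ?_
      rw [map_smul, hw]
      exact algebraMap_smul (ResidueField A) (x j) (B j)
    have := (Fintype.linearIndependent_iff.1 B.linearIndependent) _ h1 i
    exact (residue_eq_zero_iff _).1 this

section exist
variable [IsLocalRing A] [IsNoetherianRing A]

/-- minimal cover rank -/
noncomputable def covB (M : ModuleCat.{u} A) [Module.Finite A M] : ℕ := (exists_cover (A := A) M).choose
/-- minimal cover map -/
noncomputable def cov (M : ModuleCat.{u} A) [Module.Finite A M] : (Fin (covB M) → A) →ₗ[A] M :=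
  (exists_cover (A := A) M).choose_spec.choose
theorem cov_surj (M : ModuleCat.{u} A) [Module.Finite A M] : Function.Surjective (cov M) :=
  (exists_cover (A := A) M).choose_spec.choose_spec.1
theorem cov_min (M : ModuleCat.{u} A) [Module.Finite A M] : ∀ x, cov M x = 0 → ∀ i, x i ∈ maximalIdeal A :=
  (exists_cover (A := A) M).choose_spec.choose_spec.2

/-- iterated syzygies -/
noncomputable def syzs (M : {M : ModuleCat.{u} A // Module.Finite A M}) : ℕ → {M : ModuleCat.{u} A // Module.Finite A M}
  | 0 => M
  | n + 1 => haveI := (syzs M n).2; ⟨ModuleCat.of A (LinearMap.ker (cov (syzs M n).1)), inferInstance⟩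

theorem exists_minres (M : Type u) [AddCommGroup M] [Module A M] [hM : Module.Finite A M] :
    ∃ F : FRes A M, ∀ n x i, F.d n x i ∈ maximalIdeal A := by
  let S := syzs (A := A) ⟨ModuleCat.of A M, hM⟩
  have hS : ∀ n, Module.Finite A (S n).1 := fun n => (S n).2
  let c : ∀ n, (Fin (covB (S n).1) → A) →ₗ[A] (S n).1 := fun n => cov (S n).1
  have hc : ∀ n, Function.Surjective (c n) := fun n => cov_surj (S n).1
  let s : ∀ n, (S (n+1)).1 →ₗ[A] (Fin (covB (S n).1) → A) := fun n => (LinearMap.ker (cov (S n).1)).subtype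
  have hsi : ∀ n, Function.Injective (s n) := fun n => Subtype.val_injective
  have hsc : ∀ n, Function.Exact (s n) (c n) := fun n => LinearMap.exact_subtype_ker_map _
  have key : ∀ n, Function.Exact ((s n).comp (c (n+1))) (c n) := by
    intro n y
    rw [hsc n y]
    constructor
    · rintro ⟨z, rfl⟩
      obtain ⟨w, rfl⟩ := hc (n+1) z
      exact ⟨w, rfl⟩
    · rintro ⟨w, rfl⟩; exact ⟨c (n+1) w, rfl⟩
  refine ⟨⟨fun n => covB (S n).1, fun n => (s n).comp (c (n+1)), c 0, hc 0, key 0, fun n y => ?_⟩, fun n x i => ?_⟩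
  · rw [← key (n+1) y]
    change s n (c (n+1) y) = 0 ↔ _
    rw [map_eq_zero_iff _ (hsi n)]
  · exact cov_min (S n).1 _ ((hsc n).apply_apply_eq_zero _) i

end exist

/-- vanishing differentials -/
theorem FRes.D_eq_zero [IsLocalRing A] {M : Type u} [AddCommGroup M] [Module A M] (F : FRes A M)
    (hF : ∀ n x i, F.d n x i ∈ maximalIdeal A) (n : ℕ) : 
    F.toPRes.D (ModuleCat.of A (ResidueField A)) n = 0 := by
  classical
  ext φ x
  let ψ : (Fin (F.b n) → A) →ₗ[A] ResidueField A := φ.hom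
  let y : Fin (F.b (n+1)) → A := x
  change ψ (F.d n y) = 0
  have : F.d n y = ∑ i, (F.d n y i) • (Pi.single i (1:A) : Fin (F.b n) → A) := by
    ext j; simp [Finset.sum_apply, Pi.single_apply]
  rw [this, map_sum]
  refine Finset.sum_eq_zero fun i _ => ?_
  rw [map_smul]
  change (F.d n y i) • (_ : ResidueField A) = 0
  rw [Algebra.smul_def]
  have : algebraMap A (ResidueField A) (F.d n y i) = 0 := (residue_eq_zero_iff _).2 (hF n y i)
  rw [this, zero_mul]

theorem nu_eq_finrank [IsLocalRing A] (X : Type*) [AddCommGroup X] [Module A X] [Module (ResidueField A) X]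
    [IsScalarTower A (ResidueField A) X] : nu A X = Module.finrank (ResidueField A) X := by
  have : TensorProduct.CompatibleSMul A (ResidueField A) (ResidueField A) X :=
    .of_algebraMap_surjective _ _ residue_surjective
  exact LinearEquiv.finrank_eq ((TensorProduct.equivOfCompatibleSMul A (ResidueField A) (ResidueField A) (ResidueField A) X).symm ≪≫ₗ TensorProduct.lid _ _)

theorem FRes.nu_ext [IsLocalRing A] {M : Type u} [AddCommGroup M] [Module A M] (F : FRes A M)
    (hF : ∀ n x i, F.d n x i ∈ maximalIdeal A) (n : ℕ) :
    nu A (Ext (ModuleCat.of A M) (ModuleCat.of A (ResidueField A)) n) = F.b n := by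
  have key : Nonempty ((F.toPRes.X n ⟶ ModuleCat.of A (ResidueField A)) ≃ₗ[A]
      Ext (ModuleCat.of A M) (ModuleCat.of A (ResidueField A)) n) := by
    have hker : LinearMap.ker (F.toPRes.D (ModuleCat.of A (ResidueField A)) n) = ⊤ := by
      rw [F.D_eq_zero hF, LinearMap.ker_zero]
    have : IsH ⊥ (F.toPRes.D (ModuleCat.of A (ResidueField A)) n) 
        (Ext (ModuleCat.of A M) (ModuleCat.of A (ResidueField A)) n) := by
      cases n with
      | zero => exact F.toPRes.isH_zero _
      | succ n =>
        have := F.toPRes.isH_succ (ModuleCat.of A (ResidueField A)) n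
        rwa [F.D_eq_zero hF n, LinearMap.range_zero] at this
    obtain ⟨p, hp, hp2⟩ := this
    have hpi : Function.Injective p := by
      rw [injective_iff_map_eq_zero]
      intro z hz
      exact Subtype.ext ((hp2 z).1 hz)
    exact ⟨(LinearEquiv.ofTop _ hker).symm.trans (LinearEquiv.ofBijective p ⟨hpi, hp⟩)⟩
  obtain ⟨e⟩ := key
  rw [← nu_congr e]
  let e1 : (F.toPRes.X n ⟶ ModuleCat.of A (ResidueField A)) ≃ₗ[A] (Fin (F.b n) → ResidueField A) :=
    (ModuleCat.homLinearEquiv (S := A)).trans ((LinearMap.lsum A (fun _ => A) A).symm.trans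
      (LinearEquiv.piCongrRight fun _ => LinearMap.ringLmapEquivSelf A A (ResidueField A)))
  rw [nu_congr e1]
  rw [nu_eq_finrank, Module.finrank_pi]
  simp

end CT

namespace CT
open Abelian TensorProduct

section
variable {A B : Type u} [CommRing A] [CommRing B] [Algebra A B] [Module.Flat A B]

theorem IsH.baseChange {P Q R H P' Q' R' : Type u} [AddCommGroup P] [Module A P] [AddCommGroup Q] [Module A Q]
    [AddCommGroup R] [Module A R] [AddCommGroup H] [Module A H]
    [AddCommGroup P'] [Module B P'] [AddCommGroup Q'] [Module B Q']
    [AddCommGroup R'] [Module B R']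
    (f : P →ₗ[A] Q) (g : Q →ₗ[A] R) (f' : P' →ₗ[B] Q') (g' : Q' →ₗ[B] R')
    (eP : B ⊗[A] P ≃ₗ[B] P') (eQ : B ⊗[A] Q ≃ₗ[B] Q') (eR : B ⊗[A] R ≃ₗ[B] R')
    (hf : ∀ x, f' (eP (1 ⊗ₜ x)) = eQ (1 ⊗ₜ f x)) (hg : ∀ x, g' (eQ (1 ⊗ₜ x)) = eR (1 ⊗ₜ g x))
    (hfg : ∀ x, g (f x) = 0)
    (h : IsH (LinearMap.range f) g H) : IsH (LinearMap.range f') g' (B ⊗[A] H) := by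
  obtain ⟨p, hp, hp2⟩ := h
  have hf2 : ∀ w, f' (eP w) = eQ (f.baseChange B w) := by
    intro w
    induction w with
    | zero => simp
    | add a b ha hb => rw [map_add, map_add, ha, hb, map_add, map_add]
    | tmul b x =>
      have hb : ∀ (Z : Type u) [AddCommGroup Z] [Module A Z] (z : Z), (b ⊗ₜ[A] z : B ⊗[A] Z) = b • (1 ⊗ₜ[A] z) := by
        intro Z _ _ z; rw [TensorProduct.smul_tmul', smul_eq_mul, mul_one]
      rw [LinearMap.baseChange_tmul, hb, hb, map_smul, map_smul, map_smul, hf]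
  have hg2 : ∀ w, g' (eQ w) = eR (g.baseChange B w) := by
    intro w
    induction w with
    | zero => simp
    | add a b ha hb => rw [map_add, map_add, ha, hb, map_add, map_add]
    | tmul b x =>
      have hb : ∀ (Z : Type u) [AddCommGroup Z] [Module A Z] (z : Z), (b ⊗ₜ[A] z : B ⊗[A] Z) = b • (1 ⊗ₜ[A] z) := by
        intro Z _ _ z; rw [TensorProduct.smul_tmul', smul_eq_mul, mul_one]
      rw [LinearMap.baseChange_tmul, hb, hb, map_smul, map_smul, map_smul, hg]
  let s : LinearMap.ker g →ₗ[A] Q := (LinearMap.ker g).subtype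
  have hsinj : Function.Injective (s.baseChange B) :=
    Module.Flat.lTensor_preserves_injective_linearMap s Subtype.val_injective
  have hsex : Function.Exact (s.baseChange B) (g.baseChange B) :=
    Module.Flat.lTensor_exact B (LinearMap.exact_subtype_ker_map g)
  let j : B ⊗[A] LinearMap.ker g →ₗ[B] LinearMap.ker g' :=
    (eQ.toLinearMap.comp (s.baseChange B)).codRestrict _ (fun w => by
      rw [LinearMap.mem_ker]
      change g' (eQ (s.baseChange B w)) = 0
      rw [hg2, hsex.apply_apply_eq_zero, map_zero])
  have hj : Function.Bijective j := by
    constructor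
    · intro a b hab
      exact hsinj (eQ.injective (congrArg Subtype.val hab))
    · rintro ⟨z, hz⟩
      obtain ⟨z, rfl⟩ := eQ.surjective z
      rw [LinearMap.mem_ker, hg2, map_eq_zero_iff _ eR.injective] at hz
      obtain ⟨w, rfl⟩ := (hsex z).1 hz
      exact ⟨w, rfl⟩
  let J := LinearEquiv.ofBijective j hj
  let f0 : P →ₗ[A] LinearMap.ker g := f.codRestrict _ (fun x => hfg x)
  have hex : Function.Exact f0 p := by
    intro z
    rw [hp2]
    constructor
    · rintro ⟨x, hx⟩; exact ⟨x, Subtype.ext hx⟩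
    · rintro ⟨x, rfl⟩; exact ⟨x, rfl⟩
  have hexB : Function.Exact (f0.baseChange B) (p.baseChange B) := lTensor_exact B hex hp
  have hsf : ∀ w, s.baseChange B (f0.baseChange B w) = f.baseChange B w := by
    intro w
    rw [← LinearMap.comp_apply, ← LinearMap.baseChange_comp]; rfl
  refine ⟨(p.baseChange B).comp J.symm.toLinearMap, ?_, ?_⟩
  · exact (LinearMap.lTensor_surjective B hp).comp J.symm.surjective
  · intro z
    obtain ⟨w, rfl⟩ := J.surjective z
    change p.baseChange B (J.symm (J w)) = 0 ↔ _
    rw [J.symm_apply_apply, hexB w]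
    change _ ↔ eQ (s.baseChange B w) ∈ _
    constructor
    · rintro ⟨v, rfl⟩
      exact ⟨eP v, by rw [hf2, hsf]⟩
    · rintro ⟨v, hv⟩
      obtain ⟨v, rfl⟩ := eP.surjective v
      rw [hf2, eQ.injective.eq_iff, ← hsf] at hv
      exact ⟨v, hsinj hv⟩

/-- Hom and base change -/
theorem exists_homBC (X N : ModuleCat.{u} A) [Module.Free A X] [Module.Finite A X] :
    ∃ e : B ⊗[A] (X ⟶ N) ≃ₗ[B] (ModuleCat.of B (B ⊗[A] X) ⟶ ModuleCat.of B (B ⊗[A] N)),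
      ∀ φ : X ⟶ N, e (1 ⊗ₜ φ) = ModuleCat.ofHom (φ.hom.baseChange B) := by
  have hbc := (TensorProduct.isBaseChange A X B).linearMapLeftRight (TensorProduct.isBaseChange A N B)
  let e1 : B ⊗[A] (X ⟶ N) ≃ₗ[B] B ⊗[A] (X →ₗ[A] N) := (ModuleCat.homLinearEquiv (S := A)).baseChange A B _ _
  let e2 : (B ⊗[A] X →ₗ[B] B ⊗[A] N) ≃ₗ[B] (ModuleCat.of B (B ⊗[A] X) ⟶ ModuleCat.of B (B ⊗[A] N)) :=
    (ModuleCat.homLinearEquiv (S := B) (M := ModuleCat.of B (B ⊗[A] X)) (N := ModuleCat.of B (B ⊗[A] N))).symm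
  refine ⟨e1 ≪≫ₗ hbc.equiv ≪≫ₗ e2, fun φ => ?_⟩
  have : hbc.equiv (1 ⊗ₜ φ.hom) = φ.hom.baseChange B := by
    rw [IsBaseChange.equiv_tmul, one_smul]
    ext x
    have := IsBaseChange.linearMapLeftRightHom_comp_apply (TensorProduct.isBaseChange A X B) (TensorProduct.mk A B N 1) φ.hom x
    simpa using this
  exact congrArg ModuleCat.ofHom this

/-- base change of a projective resolution -/
noncomputable def PRes.baseChange {L : ModuleCat.{u} A} (P : PRes L) : PRes (ModuleCat.of B (B ⊗[A] L)) where
  X n := ModuleCat.of B (B ⊗[A] P.X n)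
  proj n := by
    have := P.proj n
    have : Module.Projective A (P.X n) := (IsProjective.iff_projective (P.X n)).2 this
    exact (IsProjective.iff_projective _).1 inferInstance
  d n := ModuleCat.ofHom ((P.d n).hom.baseChange B)
  aug := ModuleCat.ofHom (P.aug.hom.baseChange B)
  surj := LinearMap.lTensor_surjective B P.surj
  ex0 := Module.Flat.lTensor_exact B P.ex0
  exs n := Module.Flat.lTensor_exact B (P.exs n)

theorem ext_baseChange {L : Type u} [AddCommGroup L] [Module A L] (F : FRes A L) (N : Type u) [AddCommGroup N] [Module A N]
    (n : ℕ) : Nonempty (B ⊗[A] Ext (ModuleCat.of A L) (ModuleCat.of A N) n ≃ₗ[B]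
      Ext (ModuleCat.of B (B ⊗[A] L)) (ModuleCat.of B (B ⊗[A] N)) n) := by
  let P := F.toPRes
  let P' : PRes (ModuleCat.of B (B ⊗[A] L)) := P.baseChange
  let N0 := ModuleCat.of A N
  have hfree : ∀ m, Module.Free A (P.X m) := fun m => inferInstanceAs (Module.Free A (Fin (F.b m) → A))
  have hfin : ∀ m, Module.Finite A (P.X m) := fun m => inferInstanceAs (Module.Finite A (Fin (F.b m) → A))
  choose e he using fun m => exists_homBC (B := B) (P.X m) N0
  have hD : ∀ m φ, P'.D (ModuleCat.of B (B ⊗[A] N)) m (e m (1 ⊗ₜ φ)) = e (m + 1) (1 ⊗ₜ P.D N0 m φ) := by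
    intro m φ
    rw [he, he]
    change _ = ModuleCat.ofHom ((φ.hom.comp (P.d m).hom).baseChange B)
    rw [LinearMap.baseChange_comp]
    rfl
  cases n with
  | zero =>
    have h1 := P.isH_zero N0
    have h2 := P'.isH_zero (ModuleCat.of B (B ⊗[A] N))
    rw [← LinearMap.range_zero (τ₁₂ := RingHom.id A) (M := (P.X 0 ⟶ N0))] at h1
    rw [← LinearMap.range_zero (τ₁₂ := RingHom.id B) (M := (P'.X 0 ⟶ (ModuleCat.of B (B ⊗[A] N))))] at h2
    exact (IsH.baseChange (B := B) 0 (P.D N0 0) 0 (P'.D (ModuleCat.of B (B ⊗[A] N)) 0) (e 0) (e 0) (e 1)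
      (fun x => by
        rw [LinearMap.zero_apply, LinearMap.zero_apply, TensorProduct.tmul_zero]; exact (map_zero (e 0)).symm) (hD 0) (fun x => by simp) h1).equiv h2
  | succ n =>
    have h1 := P.isH_succ N0 n
    have h2 := P'.isH_succ (ModuleCat.of B (B ⊗[A] N)) n
    refine (IsH.baseChange (B := B) _ (P.D N0 (n + 1)) _ (P'.D (ModuleCat.of B (B ⊗[A] N)) (n+1)) (e n) (e (n+1)) (e (n+2))
      (hD n) (hD (n+1)) (fun x => ?_) h1).equiv h2
    rw [PRes.D_apply, PRes.D_apply]
    have : P.d (n+1) ≫ P.d n = 0 := by ext x; exact (P.exs n).apply_apply_eq_zero x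
    rw [← Category.assoc, this, Limits.zero_comp]

end

section
variable {A B : Type u} [CommRing A] [CommRing B] [Algebra A B] [IsLocalRing A] [IsLocalRing B] [IsLocalHom (algebraMap A B)]

theorem nu_baseChange (H : Type u) [AddCommGroup H] [Module A H] : nu B (B ⊗[A] H) = nu A H := by
  let kA := ResidueField A
  let kB := ResidueField B
  let e1 : kB ⊗[B] (B ⊗[A] H) ≃ₗ[kB] kB ⊗[A] H := AlgebraTensorModule.cancelBaseChange A B kB kB H
  let e2 : kB ⊗[kA] (kA ⊗[A] H) ≃ₗ[kB] kB ⊗[A] H := AlgebraTensorModule.cancelBaseChange A kA kB kB H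
  rw [nu, nu, LinearEquiv.finrank_eq (e1 ≪≫ₗ e2.symm), Module.finrank_baseChange]

end
end CT

namespace CT
open Abelian TensorProduct

theorem nu_ext_congr {B : Type u} [CommRing B] [IsLocalRing B] {L L' N N' : ModuleCat.{u} B} (e : L ≅ L') (e' : N ≅ N') (n : ℕ) :
    nu B (Ext L N n) = nu B (Ext L' N' n) := by
  refine nu_congr (LinearEquiv.ofLinearMap 
    ((pre (Ext.mk₀ e.inv) N' (zero_add n)).comp ((Ext.mk₀ e'.hom).postcompOfLinear B L (add_zero n)))
    ((pre (Ext.mk₀ e.hom) N (zero_add n)).comp ((Ext.mk₀ e'.inv).postcompOfLinear B L' (add_zero n))) ?_ ?_)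
  · ext x
    change (Ext.mk₀ e.inv).comp (((Ext.mk₀ e.hom).comp (x.comp (Ext.mk₀ e'.inv) (add_zero n)) (zero_add n)).comp
      (Ext.mk₀ e'.hom) (add_zero n)) (zero_add n) = x
    rw [Ext.comp_assoc (a₁₂ := n) (a₂₃ := n) _ _ _ (zero_add n) (add_zero n) (by omega),
      Ext.comp_assoc (a₁₂ := n) (a₂₃ := 0) _ _ _ (add_zero n) (add_zero 0) (by omega), Ext.mk₀_comp_mk₀,
      ← Ext.comp_assoc (a₁₂ := 0) (a₂₃ := n) _ _ _ (add_zero 0) (zero_add n) (by omega), Ext.mk₀_comp_mk₀]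
    simp
  · ext x
    change (Ext.mk₀ e.hom).comp (((Ext.mk₀ e.inv).comp (x.comp (Ext.mk₀ e'.hom) (add_zero n)) (zero_add n)).comp
      (Ext.mk₀ e'.inv) (add_zero n)) (zero_add n) = x
    rw [Ext.comp_assoc (a₁₂ := n) (a₂₃ := n) _ _ _ (zero_add n) (add_zero n) (by omega),
      Ext.comp_assoc (a₁₂ := n) (a₂₃ := 0) _ _ _ (add_zero n) (add_zero 0) (by omega), Ext.mk₀_comp_mk₀,
      ← Ext.comp_assoc (a₁₂ := 0) (a₂₃ := n) _ _ _ (add_zero 0) (zero_add n) (by omega), Ext.mk₀_comp_mk₀]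
    simp

variable {A B : Type u} [CommRing A] [CommRing B] [Algebra A B] [IsLocalRing A] [IsLocalRing B] 
  [IsLocalHom (algebraMap A B)] [Module.Flat A B] [IsNoetherianRing A]

theorem nu_ext_baseChange (L N : Type u) [AddCommGroup L] [Module A L] [Module.Finite A L] [AddCommGroup N] [Module A N] (n : ℕ) :
    nu B (Ext (ModuleCat.of B (B ⊗[A] L)) (ModuleCat.of B (B ⊗[A] N)) n) = 
      nu A (Ext (ModuleCat.of A L) (ModuleCat.of A N) n) := by
  obtain ⟨F, -⟩ := exists_minres (A := A) L
  obtain ⟨e⟩ := ext_baseChange (B := B) F N n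
  rw [← nu_congr e, nu_baseChange]

theorem resBC (hm : maximalIdeal B = (maximalIdeal A).map (algebraMap A B)) : 
    Nonempty (ModuleCat.of B (B ⊗[A] ResidueField A) ≅ ModuleCat.of B (ResidueField B)) := by
  have e := (Algebra.TensorProduct.quotIdealMapEquivTensorQuot B (maximalIdeal A)).toLinearEquiv
  exact ⟨(e.symm ≪≫ₗ (Submodule.quotEquivOfEq _ _ hm.symm)).toModuleIso⟩

theorem nu_ext_k_left (hm : maximalIdeal B = (maximalIdeal A).map (algebraMap A B))
    (N : Type u) [AddCommGroup N] [Module A N] (n : ℕ) :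
    nu B (Ext (ModuleCat.of B (ResidueField B)) (ModuleCat.of B (B ⊗[A] N)) n) = 
      nu A (Ext (ModuleCat.of A (ResidueField A)) (ModuleCat.of A N) n) := by
  obtain ⟨e⟩ := resBC hm
  rw [← nu_ext_baseChange (A := A) (B := B), nu_ext_congr e (Iso.refl _)]

theorem nu_ext_k_right (hm : maximalIdeal B = (maximalIdeal A).map (algebraMap A B))
    (L : Type u) [AddCommGroup L] [Module A L] [Module.Finite A L] (n : ℕ) :
    nu B (Ext (ModuleCat.of B (B ⊗[A] L)) (ModuleCat.of B (ResidueField B)) n) = 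
      nu A (Ext (ModuleCat.of A L) (ModuleCat.of A (ResidueField A)) n) := by
  obtain ⟨e⟩ := resBC hm
  rw [← nu_ext_baseChange (A := A) (B := B), nu_ext_congr (Iso.refl _) e]

end CT

namespace CT
open Abelian TensorProduct

section nu2
variable {A : Type u} [CommRing A] [IsLocalRing A]

theorem exists_retr {X Y : Type v} [AddCommGroup X] [Module A X] [AddCommGroup Y] [Module A Y] (f : X →ₗ[A] Y) 
    (hf : Function.Injective f) (h : ∀ a ∈ maximalIdeal A, ∀ y : Y, a • y = 0) :
    ∃ p : Y →ₗ[A] X, ∀ x, p (f x) = x := by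
  have hY : Module.IsTorsionBySet A Y (maximalIdeal A : Set A) := fun x a => h a.1 a.2 x
  have hX : Module.IsTorsionBySet A X (maximalIdeal A : Set A) := fun x a => hf (by
    rw [map_zero]; exact (f.map_smul _ _).trans (h a.1 a.2 _))
  let _ : Module (ResidueField A) Y := hY.module
  let _ : Module (ResidueField A) X := hX.module
  have hs : ∀ (a : A) (x : Y), residue A a • x = a • x := fun a x => rfl
  have hs' : ∀ (a : A) (x : X), residue A a • x = a • x := fun a x => rfl
  let f' : X →ₗ[ResidueField A] Y :=
    { toFun := f
      map_add' := map_add f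
      map_smul' := fun a x => by
        obtain ⟨a, rfl⟩ := residue_surjective a
        rw [hs', map_smul]; rfl }
  obtain ⟨p, hp⟩ := f'.exists_leftInverse_of_injective (LinearMap.ker_eq_bot.2 hf)
  exact ⟨{ toFun := p, map_add' := map_add p, map_smul' := fun a x => by rw [← hs, map_smul]; rfl }, 
    fun x => LinearMap.congr_fun hp x⟩

theorem nu_prod {X Z : Type v} [AddCommGroup X] [Module A X] [AddCommGroup Z] [Module A Z]
    [Module.Finite A X] [Module.Finite A Z] : nu A (X × Z) = nu A X + nu A Z := by
  rw [nu, LinearEquiv.finrank_eq (TensorProduct.prodRight A (ResidueField A) (ResidueField A) X Z), Module.finrank_prod]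
  rfl

theorem nu_pi {X : Type v} [AddCommGroup X] [Module A X] [Module.Finite A X] (b : ℕ) : nu A (Fin b → X) = b * nu A X := by
  rw [nu, LinearEquiv.finrank_eq (TensorProduct.piRight A (ResidueField A) (ResidueField A) (fun _ : Fin b => X)), 
    Module.finrank_pi_fintype]
  simp [nu]

theorem nu_add_le {X Y Z : Type v} [AddCommGroup X] [Module A X] [AddCommGroup Y] [Module A Y] 
    [AddCommGroup Z] [Module A Z] [Module.Finite A X] [Module.Finite A Y] [Module.Finite A Z]
    (f : X →ₗ[A] Y) (hf : Function.Injective f)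
    (g : Y →ₗ[A] Z) (hg : Function.Surjective g) (hgf : ∀ x, g (f x) = 0) (h : ∀ a ∈ maximalIdeal A, ∀ y : Y, a • y = 0) :
    nu A X + nu A Z ≤ nu A Y := by
  obtain ⟨p, hp⟩ := exists_retr f hf h
  rw [← nu_prod]
  refine nu_le_of_surj (p.prod g) ?_
  rintro ⟨x, z⟩
  obtain ⟨y, rfl⟩ := hg z
  refine ⟨y + f (x - p y), ?_⟩
  simp [hp, hgf]

theorem ext_k_smul {N : ModuleCat.{u} A} {n : ℕ} (a : A) (ha : a ∈ maximalIdeal A) 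
    (x : Ext (ModuleCat.of A (ResidueField A)) N n) : a • x = 0 := by
  rw [← Ext.mk₀_id_comp x, ← Ext.smul_comp, ← Ext.mk₀_smul]
  have : a • 𝟙 (ModuleCat.of A (ResidueField A)) = 0 := by
    ext y
    change a • y = 0
    have : algebraMap A (ResidueField A) a = 0 := (residue_eq_zero_iff _).2 ha
    rw [Algebra.smul_def, this, zero_mul]
  rw [this, Ext.mk₀_zero, Ext.zero_comp]

theorem ext_k_smul' {N : ModuleCat.{u} A} {n : ℕ} (a : A) (ha : a ∈ maximalIdeal A) 
    (x : Ext N (ModuleCat.of A (ResidueField A)) n) : a • x = 0 := by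
  rw [← Ext.comp_mk₀_id x, ← Ext.comp_smul, ← Ext.mk₀_smul]
  have : a • 𝟙 (ModuleCat.of A (ResidueField A)) = 0 := by
    ext y
    change a • y = 0
    have : algebraMap A (ResidueField A) a = 0 := (residue_eq_zero_iff _).2 ha
    rw [Algebra.smul_def, this, zero_mul]
  rw [this, Ext.mk₀_zero, Ext.comp_zero]
end nu2

section zeromap
variable {A : Type u} [CommRing A]

/-- evaluation-type map -/
noncomputable def fs {S : Type u} [AddCommGroup S] [Module A S] (f : S →ₗ[A] A) (T : ModuleCat.{u} A) :
    T ⟶ ModuleCat.of A (S →ₗ[A] T) :=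
  ModuleCat.ofHom ((LinearMap.lsmul A T).comp f).flip

/-- Hom functor on maps -/
noncomputable def hm (S : Type u) [AddCommGroup S] [Module A S] {T T' : ModuleCat.{u} A} (g : T ⟶ T') :
    ModuleCat.of A (S →ₗ[A] T) ⟶ ModuleCat.of A (S →ₗ[A] T') :=
  ModuleCat.ofHom (LinearMap.compRight A g.hom)

theorem fs_nat {S : Type u} [AddCommGroup S] [Module A S] (f : S →ₗ[A] A) {T T' : ModuleCat.{u} A} (g : T ⟶ T') :
    g ≫ fs f T' = fs f T ≫ hm S g := by
  ext x s
  exact (g.hom.map_smul (f s) x).symm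

theorem ses_hom (S : Type u) [AddCommGroup S] [Module A S] {X Y Z : ModuleCat.{u} A} {f : X ⟶ Y} {g : Y ⟶ Z} (h : SES f g)
    (hS : Subsingleton (Ext (ModuleCat.of A S) X 1)) : SES (hm S f) (hm S g) where
  inj := by
    intro φ ψ hφ
    apply LinearMap.ext
    intro s
    exact h.inj (LinearMap.congr_fun (h := hφ) s)
  exact := by
    intro φ
    constructor
    · intro hφ
      have : ∀ s, ∃ x, f.hom x = φ s := fun s => (h.exact (φ s)).1 (LinearMap.congr_fun (h := hφ) s)
      choose ψ hψ using this
      refine ⟨⟨⟨ψ, fun a b => h.inj ?_⟩, fun a b => h.inj ?_⟩, ?_⟩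
      · exact (hψ _).trans ((map_add φ a b).trans (by rw [← hψ, ← hψ]; exact (map_add f.hom _ _).symm))
      · exact (hψ _).trans ((map_smul φ a b).trans (by rw [← hψ]; exact (map_smul f.hom _ _).symm))
      · apply LinearMap.ext
        exact hψ
    · rintro ⟨ψ, rfl⟩
      apply LinearMap.ext
      intro s
      exact h.exact.apply_apply_eq_zero (ψ s)
  surj := by
    intro φ
    obtain ⟨y, hy⟩ := h.cov3 (Ext.mk₀ (ModuleCat.ofHom φ : ModuleCat.of A S ⟶ Z)) (zero_add 1) (Subsingleton.elim _ _)
    obtain ⟨ψ, rfl⟩ := (Ext.mk₀_bijective _ _).2 y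
    rw [Ext.mk₀_comp_mk₀] at hy
    have := (Ext.mk₀_bijective _ _).1 hy
    refine ⟨ψ.hom, ?_⟩
    exact congrArg ModuleCat.Hom.hom this

theorem fs_zero [IsLocalRing A] {S : Type u} [AddCommGroup S] [Module A S] (f : S →ₗ[A] A) (hf : ∀ s, f s ∈ maximalIdeal A)
    (n : ℕ) : ∀ (T : ModuleCat.{u} A), (∀ i, Subsingleton (Ext (ModuleCat.of A S) T (i + 1))) →
    ∀ x : Ext (ModuleCat.of A (ResidueField A)) T n, x.comp (Ext.mk₀ (fs f T)) (add_zero n) = 0 := by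
  induction n with
  | zero =>
    intro T hT x
    obtain ⟨φ, rfl⟩ := (Ext.mk₀_bijective _ _).2 x
    rw [Ext.mk₀_comp_mk₀]
    have : φ ≫ fs f T = 0 := by
      ext x s
      change f s • φ.hom x = 0
      rw [← map_smul]
      have h0 : f s • x = 0 := by
        have : algebraMap A (ResidueField A) (f s) = 0 := (residue_eq_zero_iff _).2 (hf s)
        exact (Algebra.smul_def (A := ResidueField A) (f s) x).trans (by rw [this, zero_mul])
      rw [h0, map_zero]
    rw [this, Ext.mk₀_zero]
  | succ n ih =>
    intro T hT x
    let I := Injective.under T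
    let ι : T ⟶ I := Injective.ι T
    let C := ModuleCat.of A (I ⧸ LinearMap.range ι.hom)
    let π : I ⟶ C := ModuleCat.ofHom (LinearMap.range ι.hom).mkQ
    have hs : SES ι π := ⟨(ModuleCat.mono_iff_injective ι).1 inferInstance,
      LinearMap.exact_map_mkQ_range ι.hom, Submodule.mkQ_surjective _⟩
    have hC : ∀ i, Subsingleton (Ext (ModuleCat.of A S) C (i + 1)) := by
      intro i
      refine subsingleton_of_forall_eq 0 fun y => ?_
      have := hT (i + 1)
      obtain ⟨z, rfl⟩ := hs.cov3 y rfl (Subsingleton.elim _ _)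
      have : Subsingleton (Ext (ModuleCat.of A S) I (i + 1)) := Ext.subsingleton_of_injective _ _ _
      rw [Subsingleton.elim z 0, Ext.zero_comp]
    have hH := ses_hom S hs (hT 0)
    have : Subsingleton (Ext (ModuleCat.of A (ResidueField A)) I (n + 1)) := Ext.subsingleton_of_injective _ _ _
    obtain ⟨y, rfl⟩ := hs.cov1 x rfl (Subsingleton.elim _ _)
    have hn := hs.nat hH (fs f T) (fs f I) (fs f C) (fs_nat f ι) (fs_nat f π)
    rw [Ext.comp_assoc (a₁₂ := n + 1) (a₂₃ := 1) _ _ _ rfl (add_zero 1) rfl, hn,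
      ← Ext.comp_assoc (a₁₂ := n) (a₂₃ := 1) _ _ _ (add_zero n) (zero_add 1) (by omega), ih C hC, Ext.zero_comp]
end zeromap
end CT

namespace CT
open Abelian TensorProduct

variable {A : Type u} [CommRing A]

/-- shifted free resolution -/
def FRes.shift {M : Type u} [AddCommGroup M] [Module A M] (F : FRes A M) : FRes A (LinearMap.ker F.aug) where
  b n := F.b (n + 1)
  d n := F.d (n + 1)
  aug := (F.d 0).codRestrict _ fun x => F.ex0.apply_apply_eq_zero x
  surj := by
    rintro ⟨y, hy⟩
    obtain ⟨z, rfl⟩ := (F.ex0 y).1 hy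
    exact ⟨z, rfl⟩
  ex0 := by
    intro y
    refine Iff.trans ?_ (F.exs 0 y)
    exact Subtype.ext_iff
  exs n := F.exs (n + 1)

section
variable {M : Type u} [AddCommGroup M] [Module A M] (F : FRes A M) (T : ModuleCat.{u} A)

/-- Hom into free -/
noncomputable def ba : ModuleCat.of A (M →ₗ[A] T) ⟶ ModuleCat.of A (Fin (F.b 0) → T) :=
  ModuleCat.ofHom (LinearMap.pi fun j => LinearMap.applyₗ (F.aug (Pi.single j 1)))

/-- coordinate functions on the syzygy -/
def cf (j : Fin (F.b 0)) : LinearMap.ker F.aug →ₗ[A] A := (LinearMap.proj j).comp (LinearMap.ker F.aug).subtype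

/-- restriction to the syzygy -/
noncomputable def bb : ModuleCat.of A (Fin (F.b 0) → T) ⟶ ModuleCat.of A (LinearMap.ker F.aug →ₗ[A] T) :=
  ∑ j, ModuleCat.ofHom (LinearMap.proj j) ≫ fs (cf F j) T

theorem bb_apply (x : Fin (F.b 0) → T) (s : LinearMap.ker F.aug) :
    ((bb F T).hom x : LinearMap.ker F.aug →ₗ[A] T) s = ∑ j, s.1 j • x j := by
  rw [bb, ModuleCat.hom_sum]
  have h1 : ∀ (f : Fin (F.b 0) → ((Fin (F.b 0) → T) →ₗ[A] (LinearMap.ker F.aug →ₗ[A] T))), 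
      (∑ j, f j) x s = ∑ j, f j x s := by
    intro f; simp
  exact h1 _

theorem bass_ses (hM : Subsingleton (Ext (ModuleCat.of A M) T 1)) : SES (ba F T) (bb F T) := by
  classical
  have hlin : ∀ (ψ : (Fin (F.b 0) → A) →ₗ[A] T) (y : Fin (F.b 0) → A), ψ y = ∑ j, y j • ψ (Pi.single j 1) := by
    intro ψ y
    conv_lhs => rw [pi_eq_sum_univ' y]
    rw [map_sum]
    refine Finset.sum_congr rfl fun j _ => ?_
    rw [map_smul]
  have hφ : ∀ (φ : M →ₗ[A] T) (y : Fin (F.b 0) → A), φ (F.aug y) = ∑ j, y j • φ (F.aug (Pi.single j 1)) :=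
    fun φ y => hlin (φ.comp F.aug) y
  refine ⟨?_, ?_, ?_⟩
  · intro φ ψ h
    apply LinearMap.ext
    intro m
    obtain ⟨y, rfl⟩ := F.surj m
    refine (hφ φ y).trans (Eq.trans ?_ (hφ ψ y).symm)
    refine Finset.sum_congr rfl fun j _ => ?_
    exact congrArg (fun z => y j • z) (congrFun h j)
  · intro x
    constructor
    · intro hx
      have hx' : ∀ s : LinearMap.ker F.aug, ∑ j, s.1 j • x j = 0 := fun s =>
        (bb_apply F T x s).symm.trans (LinearMap.congr_fun (f := ((bb F T).hom x : LinearMap.ker F.aug →ₗ[A] T)) hx s)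
      let ψ : (Fin (F.b 0) → A) →ₗ[A] T := Fintype.linearCombination A x
      have hle : LinearMap.ker F.aug ≤ LinearMap.ker ψ := fun s hs => hx' ⟨s, hs⟩
      let φ : M →ₗ[A] T := ((LinearMap.ker F.aug).liftQ ψ hle).comp (F.aug.quotKerEquivOfSurjective F.surj).symm.toLinearMap
      refine ⟨φ, ?_⟩
      funext j
      change ((LinearMap.ker F.aug).liftQ ψ hle) ((F.aug.quotKerEquivOfSurjective F.surj).symm (F.aug (Pi.single j 1))) = x j
      have : (F.aug.quotKerEquivOfSurjective F.surj).symm (F.aug (Pi.single j 1)) = Submodule.Quotient.mk (Pi.single j 1) := by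
        rw [LinearEquiv.symm_apply_eq]; rfl
      rw [this]
      change ψ (Pi.single j 1) = x j
      simp [ψ, Fintype.linearCombination_apply, Pi.single_apply]
    · rintro ⟨φ, rfl⟩
      apply LinearMap.ext
      intro s
      refine (bb_apply F T _ s).trans ?_
      refine (hφ φ s.1).symm.trans ?_
      have : F.aug s.1 = 0 := s.2
      rw [this, map_zero]; rfl
  · intro φ
    have hs := F.toPRes.ses
    obtain ⟨y, hy⟩ := hs.con1 (Ext.mk₀ (ModuleCat.ofHom φ : F.toPRes.syz ⟶ T)) (add_zero 1) (Subsingleton.elim _ _)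
    obtain ⟨ψ, rfl⟩ := (Ext.mk₀_bijective _ _).2 y
    rw [Ext.mk₀_comp_mk₀] at hy
    have := (Ext.mk₀_bijective _ _).1 hy
    refine ⟨fun j => ψ.hom (Pi.single j (1:A) : Fin (F.b 0) → A), ?_⟩
    apply LinearMap.ext
    intro s
    refine (bb_apply F T _ s).trans ?_
    refine (hlin ψ.hom s.1).symm.trans ?_
    exact congrArg (fun f => f.hom s) this

end

section
variable [IsLocalRing A] {M : Type u} [AddCommGroup M] [Module A M] (F : FRes A M) (T : ModuleCat.{u} A)

theorem bb_zero (hF : ∀ n x i, F.d n x i ∈ maximalIdeal A) 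
    (hM : ∀ i, Subsingleton (Ext (ModuleCat.of A (LinearMap.ker F.aug)) T (i+1))) (n : ℕ)
    (x : Ext (ModuleCat.of A (ResidueField A)) (ModuleCat.of A (Fin (F.b 0) → T)) n) :
    x.comp (Ext.mk₀ (bb F T)) (add_zero n) = 0 := by
  rw [bb, Ext.mk₀_sum, Ext.comp_sum]
  refine Finset.sum_eq_zero fun j _ => ?_
  rw [← Ext.mk₀_comp_mk₀, ← Ext.comp_assoc (a₁₂ := n) (a₂₃ := 0) _ _ _ (add_zero n) (add_zero 0) (by omega)]
  refine fs_zero _ ?_ n T hM _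
  rintro ⟨s, hs⟩
  obtain ⟨y, rfl⟩ := (F.ex0 s).1 hs
  exact hF 0 y j

theorem syz_van (hM : ∀ i, Subsingleton (Ext (ModuleCat.of A M) T (i+1))) (i : ℕ) : 
    Subsingleton (Ext (ModuleCat.of A (LinearMap.ker F.aug)) T (i+1)) := by
  refine subsingleton_of_forall_eq 0 fun x => ?_
  have hs := F.toPRes.ses
  have := F.toPRes.proj 0
  have := hM (i + 1)
  obtain ⟨y, rfl⟩ := hs.con1 x (add_comm 1 (i+1)) (Subsingleton.elim _ _)
  have : Subsingleton (Ext (F.toPRes.X 0) T (i + 1)) := Ext.subsingleton_of_projective _ _ _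
  rw [Subsingleton.elim y 0]
  exact Ext.comp_zero _ _ _ _ _

variable [IsNoetherianRing A]

theorem nu_ext_pi (L T : ModuleCat.{u} A) [Module.Finite A L] [Module.Finite A T] (b n : ℕ) :
    b * nu A (Ext L T n) ≤ nu A (Ext L (ModuleCat.of A (Fin b → T)) n) := by
  classical
  rw [← nu_pi]
  refine nu_le_of_surj (LinearMap.pi fun j => 
    (Ext.mk₀ (ModuleCat.ofHom (LinearMap.proj j) : ModuleCat.of A (Fin b → T) ⟶ T)).postcompOfLinear A L (add_zero n)) ?_
  intro v
  refine ⟨∑ j, (v j).comp (Ext.mk₀ (ModuleCat.ofHom (LinearMap.single A (fun _ => T) j) : T ⟶ ModuleCat.of A (Fin b → T))) (add_zero n), ?_⟩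
  funext i
  change (∑ j, (v j).comp (Ext.mk₀ (ModuleCat.ofHom (LinearMap.single A (fun _ => T) j) : T ⟶ ModuleCat.of A (Fin b → T))) (add_zero n)).comp
    (Ext.mk₀ (ModuleCat.ofHom (LinearMap.proj i) : ModuleCat.of A (Fin b → T) ⟶ T)) (add_zero n) = v i
  rw [Ext.sum_comp, Finset.sum_eq_single i]
  · rw [Ext.comp_assoc (a₁₂ := n) (a₂₃ := 0) _ _ _ (add_zero n) (add_zero 0) (by omega), Ext.mk₀_comp_mk₀]
    have : (ModuleCat.ofHom (LinearMap.single A (fun _ => T) i) : T ⟶ ModuleCat.of A (Fin b → T)) ≫ 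
      (ModuleCat.ofHom (LinearMap.proj i) : ModuleCat.of A (Fin b → T) ⟶ T) = 𝟙 T := by
      ext x
      exact Pi.single_eq_same (M := fun _ => T) i x
    rw [this, Ext.comp_mk₀_id]
  · intro j _ hj
    rw [Ext.comp_assoc (a₁₂ := n) (a₂₃ := 0) _ _ _ (add_zero n) (add_zero 0) (by omega), Ext.mk₀_comp_mk₀]
    have : (ModuleCat.ofHom (LinearMap.single A (fun _ => T) j) : T ⟶ ModuleCat.of A (Fin b → T)) ≫ 
      (ModuleCat.ofHom (LinearMap.proj i) : ModuleCat.of A (Fin b → T) ⟶ T) = 0 := by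
      ext x
      exact Pi.single_eq_of_ne (M := fun _ => T) hj.symm x
    rw [this, Ext.mk₀_zero, Ext.comp_zero]
  · simp

/-- Bass numbers -/
noncomputable def mu (T : ModuleCat.{u} A) (n : ℕ) : ℕ := nu A (Ext (ModuleCat.of A (ResidueField A)) T n)

theorem bass [Module.Finite A T] (n : ℕ) : ∀ (M : Type u) [AddCommGroup M] [Module A M] [Module.Finite A M] (F : FRes A M)
    (_ : ∀ n x i, F.d n x i ∈ maximalIdeal A) (_ : ∀ i, Subsingleton (Ext (ModuleCat.of A M) T (i+1))),
    ∑ i ∈ Finset.range (n + 1), F.b i * mu T (n - i) ≤ mu (ModuleCat.of A (M →ₗ[A] T)) n := by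
  induction n with
  | zero =>
    intro M _ _ _ F hF hM
    rw [Finset.sum_range_one]
    refine (nu_ext_pi (ModuleCat.of A (ResidueField A)) T (F.b 0) 0).trans ?_
    refine nu_le_of_surj ((Ext.mk₀ (ba F T)).postcompOfLinear A _ (add_zero 0)) fun x => ?_
    exact (bass_ses F T (hM 0)).cov2 x (bb_zero F T hF (syz_van F T hM) 0 x)
  | succ n ih =>
    intro M _ _ _ F hF hM
    have hs := bass_ses F T (hM 0)
    have hz := bb_zero F T hF (syz_van F T hM)
    rw [Finset.sum_range_succ']
    have h1 := ih (LinearMap.ker F.aug) F.shift (fun n => hF (n + 1)) (syz_van F T hM)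
    have h2 := nu_ext_pi (ModuleCat.of A (ResidueField A)) T (F.b 0) (n + 1)
    have h3 : ∑ i ∈ Finset.range (n + 1), F.b (i + 1) * mu T (n + 1 - (i + 1)) = 
        ∑ i ∈ Finset.range (n + 1), F.shift.b i * mu T (n - i) := by
      refine Finset.sum_congr rfl fun i _ => ?_
      rw [Nat.add_sub_add_right]; rfl
    rw [h3]
    refine (add_le_add h1 h2).trans ?_
    refine nu_add_le (hs.cls.postcompOfLinear A _ rfl) ?_ ((Ext.mk₀ (ba F T)).postcompOfLinear A _ (add_zero (n+1))) ?_ ?_ ?_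
    · rw [injective_iff_map_eq_zero]
      intro x hx
      obtain ⟨y, rfl⟩ := hs.cov3 x rfl hx
      exact hz n y
    · intro x
      exact hs.cov2 x (hz (n+1) x)
    · intro x
      change (x.comp hs.cls rfl).comp (Ext.mk₀ (ba F T)) (add_zero (n+1)) = 0
      rw [Ext.comp_assoc (a₁₂ := n + 1) (a₂₃ := 1) _ _ _ rfl (add_zero 1) rfl, hs.cls_f, Ext.comp_zero]
    · intro a ha y
      exact ext_k_smul a ha y
end
end CT

namespace CT
open Abelian TensorProduct

theorem sum_mul_sum_le (b μ w : ℕ → ℕ) (h : ∀ n, ∑ i ∈ Finset.range (n + 1), b i * μ (n - i) ≤ w n) (m : ℕ) :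
    (∑ i ∈ Finset.range m, b i) * (∑ i ∈ Finset.range m, μ i) ≤ ∑ n ∈ Finset.range (2 * m), w n := by
  rw [Finset.sum_mul_sum, ← Finset.sum_product']
  rw [← Finset.sum_fiberwise_of_maps_to (t := Finset.range (2 * m)) (g := fun p : ℕ × ℕ => p.1 + p.2)]
  · refine Finset.sum_le_sum fun n _ => le_trans ?_ (h n)
    rw [← Finset.Nat.sum_antidiagonal_eq_sum_range_succ (fun i j => b i * μ j)]
    refine Finset.sum_le_sum_of_subset fun p hp => ?_
    rw [Finset.mem_filter] at hp
    exact Finset.HasAntidiagonal.mem_antidiagonal.2 hp.2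
  · rintro ⟨i, j⟩ hp
    simp only [Finset.mem_product, Finset.mem_range] at hp ⊢
    omega

theorem numerics (c t : ℕ) (b μ w : ℕ → ℕ) (hprod : ∀ n, ∑ i ∈ Finset.range (n + 1), b i * μ (n - i) ≤ w n)
    (hw : ∃ C : ℝ, ∀ m : ℕ, ∑ n ∈ Finset.range m, (w n : ℝ) ≤ C * ((m : ℝ) + 1) ^ c)
    (hμ : ∃ C e : ℕ, ∀ q, (q + 1) ^ c ≤ (c * q + 1) ^ t * (C * ∑ n ∈ Finset.range (2 * (c * q) + e), μ n)) :
    ∃ C : ℝ, 0 ≤ C ∧ ∀ m : ℕ, ∑ n ∈ Finset.range m, (b n : ℝ) ≤ C * ((m : ℝ) + 1) ^ t := by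
  obtain ⟨C0, hC0⟩ := hw
  obtain ⟨C, e, hC⟩ := hμ
  obtain ⟨D, hD0, hD⟩ : ∃ D : ℝ, 0 ≤ D ∧ ∀ m : ℕ, ∑ n ∈ Finset.range m, (w n : ℝ) ≤ D * ((m : ℝ) + 1) ^ c :=
    ⟨|C0|, abs_nonneg _, fun m => (hC0 m).trans (by gcongr; exact le_abs_self _)⟩
  let K : ℝ := 2 * (2 * c + e + 1) + 1
  refine ⟨(c + 1) ^ t * (C * (D * K ^ c)), by positivity, fun n => ?_⟩
  let m := 2 * (c * n) + e + n
  have h1 : ((n : ℝ) + 1) ^ c ≤ (c * n + 1) ^ t * (C * ∑ i ∈ Finset.range (2 * (c * n) + e), (μ i : ℝ)) := by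
    exact_mod_cast hC n
  have h2 : ∑ i ∈ Finset.range (2 * (c * n) + e), (μ i : ℝ) ≤ ∑ i ∈ Finset.range m, (μ i : ℝ) :=
    Finset.sum_le_sum_of_subset_of_nonneg (Finset.range_mono (by omega)) (fun _ _ _ => by positivity)
  have h3 : ∑ i ∈ Finset.range n, (b i : ℝ) ≤ ∑ i ∈ Finset.range m, (b i : ℝ) :=
    Finset.sum_le_sum_of_subset_of_nonneg (Finset.range_mono (by omega)) (fun _ _ _ => by positivity)
  have h4 : (∑ i ∈ Finset.range m, (b i : ℝ)) * ∑ i ∈ Finset.range m, (μ i : ℝ) ≤ ∑ i ∈ Finset.range (2 * m), (w i : ℝ) := by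
    exact_mod_cast sum_mul_sum_le b μ w hprod m
  have h5 := hD (2 * m)
  have h6 : ((2 * m : ℕ) : ℝ) + 1 ≤ K * (n + 1) := by
    have : 2 * m + 1 ≤ (2 * (2 * c + e + 1) + 1) * (n + 1) := by
      simp only [m]; nlinarith [Nat.zero_le (e * n), Nat.zero_le (c * n), Nat.zero_le n, Nat.zero_le c, Nat.zero_le e]
    have h := (Nat.cast_le (α := ℝ)).2 this
    push_cast at h ⊢
    exact h
  have h7 : (((2 * m : ℕ) : ℝ) + 1) ^ c ≤ K ^ c * (n + 1) ^ c := by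
    rw [← mul_pow]; gcongr
  have h8 : ((c : ℝ) * n + 1) ^ t ≤ (c + 1) ^ t * (n + 1) ^ t := by
    rw [← mul_pow]; gcongr; nlinarith [(Nat.cast_nonneg c : (0:ℝ) ≤ c), (Nat.cast_nonneg n : (0:ℝ) ≤ n)]
  set Sb := ∑ i ∈ Finset.range n, (b i : ℝ)
  set Sm := ∑ i ∈ Finset.range m, (b i : ℝ)
  set Mu := ∑ i ∈ Finset.range m, (μ i : ℝ)
  have hSb : 0 ≤ Sb := Finset.sum_nonneg fun _ _ => by positivity
  have hMu : 0 ≤ Mu := Finset.sum_nonneg fun _ _ => by positivity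
  have hpos : (0 : ℝ) < ((n : ℝ) + 1) ^ c := by positivity
  have key : ((n : ℝ) + 1) ^ c * Sb ≤ ((n : ℝ) + 1) ^ c * ((c + 1) ^ t * (C * (D * K ^ c)) * ((n : ℝ) + 1) ^ t) := by
    calc ((n : ℝ) + 1) ^ c * Sb ≤ ((c * n + 1) ^ t * (C * Mu)) * Sm := by
          gcongr
          refine h1.trans (by gcongr)
      _ = (c * n + 1) ^ t * (C * (Sm * Mu)) := by ring
      _ ≤ ((c + 1) ^ t * (n + 1) ^ t) * (C * (D * (K ^ c * (n + 1) ^ c))) := by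
          have h9 : Sm * Mu ≤ D * (K ^ c * (n + 1) ^ c) := h4.trans (h5.trans (mul_le_mul_of_nonneg_left h7 hD0))
          exact mul_le_mul h8 (mul_le_mul_of_nonneg_left h9 (Nat.cast_nonneg C)) (mul_nonneg (Nat.cast_nonneg C)
            (mul_nonneg (hSb.trans h3) hMu)) (by positivity)
      _ = _ := by ring
  exact le_of_mul_le_mul_left key hpos

section
variable {A : Type u} [CommRing A] [IsLocalRing A] [IsNoetherianRing A]

theorem exists_shift (T : ModuleCat.{u} A) (i0 : ℕ) : ∀ (M : Type u) [AddCommGroup M] [Module A M] [Module.Finite A M] (F : FRes A M)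
    (_ : ∀ n x i, F.d n x i ∈ maximalIdeal A) (_ : ∀ i, Subsingleton (Ext (ModuleCat.of A M) T (i0 + i + 1))),
    ∃ (M' : ModuleCat.{u} A) (_ : Module.Finite A M') (F' : FRes A M'), (∀ n x i, F'.d n x i ∈ maximalIdeal A) ∧
      (∀ i, Subsingleton (Ext (ModuleCat.of A M') T (i + 1))) ∧ ∀ i, F'.b i = F.b (i + i0) := by
  induction i0 with
  | zero =>
    intro M _ _ hM F hF hv
    exact ⟨ModuleCat.of A M, hM, F, hF, fun i => by simpa using hv i, fun i => rfl⟩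
  | succ j ih =>
    intro M _ _ hM F hF hv
    obtain ⟨M', h1, F', h2, h3, h4⟩ := ih (LinearMap.ker F.aug) F.shift (fun n => hF (n + 1)) (fun i => by
      refine subsingleton_of_forall_eq 0 fun x => ?_
      have hs := F.toPRes.ses
      have := F.toPRes.proj 0
      have : Subsingleton (Ext (ModuleCat.of A M) T (j + i + 1 + 1)) := by
        have := hv i
        rwa [show j + 1 + i + 1 = j + i + 1 + 1 by omega] at this
      obtain ⟨y, rfl⟩ := hs.con1 x (add_comm 1 (j + i + 1)) (Subsingleton.elim _ _)
      have : Subsingleton (Ext (F.toPRes.X 0) T (j + i + 1)) := Ext.subsingleton_of_projective _ _ _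
      rw [Subsingleton.elim y 0]
      exact Ext.comp_zero _ _ _ _ _)
    exact ⟨M', h1, F', h2, h3, fun i => h4 i⟩

theorem mu_le_nu (W : ModuleCat.{u} A) [Module.Finite A W] (n : ℕ) :
    mu W n ≤ nu A (Ext (ModuleCat.of A (ResidueField A × W)) (ModuleCat.of A (ResidueField A × W)) n) := by
  let N := ModuleCat.of A (ResidueField A × W)
  let k := ModuleCat.of A (ResidueField A)
  let i1 : k ⟶ N := ModuleCat.ofHom (LinearMap.inl A _ _)
  let p1 : N ⟶ k := ModuleCat.ofHom (LinearMap.fst A _ _)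
  let i2 : W ⟶ N := ModuleCat.ofHom (LinearMap.inr A _ _)
  let p2 : N ⟶ W := ModuleCat.ofHom (LinearMap.snd A _ _)
  have h1 : i1 ≫ p1 = 𝟙 k := rfl
  have h2 : i2 ≫ p2 = 𝟙 W := rfl
  refine nu_le_of_surj ((pre (Ext.mk₀ i1) W (zero_add n)).comp ((Ext.mk₀ p2).postcompOfLinear A N (add_zero n))) fun x => ?_
  refine ⟨(Ext.mk₀ p1).comp (x.comp (Ext.mk₀ i2) (add_zero n)) (zero_add n), ?_⟩
  change (Ext.mk₀ i1).comp (((Ext.mk₀ p1).comp (x.comp (Ext.mk₀ i2) (add_zero n)) (zero_add n)).comp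
      (Ext.mk₀ p2) (add_zero n)) (zero_add n) = x
  rw [Ext.comp_assoc (a₁₂ := n) (a₂₃ := n) _ _ _ (zero_add n) (add_zero n) (by omega),
      Ext.comp_assoc (a₁₂ := n) (a₂₃ := 0) _ _ _ (add_zero n) (add_zero 0) (by omega), Ext.mk₀_comp_mk₀,
      ← Ext.comp_assoc (a₁₂ := 0) (a₂₃ := n) _ _ _ (add_zero 0) (zero_add n) (by omega), Ext.mk₀_comp_mk₀, h1, h2]
  simp
end
end CT

namespace CT
open Abelian TensorProduct
variable {A : Type u} [CommRing A] [IsLocalRing A] [IsNoetherianRing A]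

theorem EZ_betti {r : ℕ} (ω : Fin r → CentralOp A) (L : ModuleCat.{u} A) [Module.Finite A L]
    (h : FGE ω L (ModuleCat.of A (ResidueField A))) :
    EZ r (fun n => (nu A (Ext L (ModuleCat.of A (ResidueField A)) n) : ℝ)) := by
  let V : ℕ → Type u := fun n => Ext L (ModuleCat.of A (ResidueField A)) n
  have ht : ∀ n, Module.IsTorsionBySet A (V n) (maximalIdeal A : Set A) := fun n x a => ext_k_smul' a.1 a.2 x
  let _ : ∀ n, Module (ResidueField A) (V n) := fun n => (ht n).module
  have hs : ∀ n (a : A) (x : V n), residue A a • x = a • x := fun n a x => rfl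
  have _ : ∀ n, IsScalarTower A (ResidueField A) (V n) := fun n => (ht n).isScalarTower
  have _ : ∀ n, Module.Finite A (V n) := fun n => inferInstanceAs (Module.Finite A (Ext L (ModuleCat.of A (ResidueField A)) n))
  have _ : ∀ n, Module.Finite (ResidueField A) (V n) := fun n => Module.Finite.of_restrictScalars_finite A _ _
  let X : Fin r → ∀ n, V n →ₗ[ResidueField A] V (n + 2) := fun j n =>
    { toFun := extOp ω L _ j n
      map_add' := map_add _
      map_smul' := fun a x => by
        obtain ⟨a, rfl⟩ := residue_surjective a
        exact map_smul (extOp ω L (ModuleCat.of A (ResidueField A)) j n) a x }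
  have := hilbert_serre (ResidueField A) r V X (fun i j n v => extOp_comm ω _ _ i j n v) h
  simpa only [← nu_eq_finrank (A := A)] using this

theorem finrank_ext (M N : Type u) [AddCommGroup M] [Module A M] [AddCommGroup N] [Module A N] (n : ℕ) :
    Module.finrank (ResidueField A) (TensorProduct A (ResidueField A) (ComplexityTest.extModule A M n N)) =
      nu A (Ext (ModuleCat.of A M) (ModuleCat.of A N) n) := by
  obtain ⟨e⟩ := ext_bridge (ModuleCat.of A M) (ModuleCat.of A N) n
  exact nu_congr e

theorem finite_ext' (M N : Type u) [AddCommGroup M] [Module A M] [AddCommGroup N] [Module A N] [Module.Finite A M] 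
    [Module.Finite A N] (n : ℕ) : Module.Finite (ResidueField A) (TensorProduct A (ResidueField A) (ComplexityTest.extModule A M n N)) := by
  obtain ⟨e⟩ := ext_bridge (ModuleCat.of A M) (ModuleCat.of A N) n
  have : Module.Finite A (ComplexityTest.extModule A M n N) := Module.Finite.equiv e.symm
  infer_instance

theorem hw_of (c : ℕ) (D : ComplexityTest.SupportVarietyTheory A c) (N : Type u) [AddCommGroup N] [Module A N] [Module.Finite A N] :
    ∃ C : ℝ, ∀ m : ℕ, ∑ n ∈ Finset.range m, (nu A (Ext (ModuleCat.of A N) (ModuleCat.of A N) n) : ℝ) ≤ C * ((m : ℝ) + 1) ^ c := by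
  let _ := D.smul N
  have := finite_ext' (A := A) N N
  have := D.finite N
  have := sum_finrank_le (K := ResidueField A) (c := c) (fun n => TensorProduct A (ResidueField A) (ComplexityTest.extModule A N n N))
    (D.compat N) (D.degree_two N)
  simpa only [finrank_ext] using this

theorem hmu_of (c : ℕ) (D : ComplexityTest.SupportVarietyTheory A c) (T : Type u) [AddCommGroup T] [Module A T] [Module.Finite A T]
    (t : ℕ) (η : Fin t → MvPolynomial (Fin c) (IsLocalRing.ResidueField A))
    (deg : Fin t → ℕ)
    (hdeg : ∀ i, 0 < deg i ∧ (η i).IsHomogeneous (deg i))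
    (hT : ComplexityTest.supportVariety A D T = ComplexityTest.polyZeroLocus A c (Set.range η)) :
    ∃ C e : ℕ, ∀ q : ℕ, (q + 1) ^ c ≤ (c * q + 1) ^ t * 
      (C * ∑ n ∈ Finset.range (2 * (c * q) + e), nu A (Ext (ModuleCat.of A T) (ModuleCat.of A T) n)) := by
  let _ := D.smul T
  have := finite_ext' (A := A) T T
  have := D.finite T
  have := sum_finrank_ge (K := ResidueField A) (c := c) (fun n => TensorProduct A (ResidueField A) (ComplexityTest.extModule A T n T))
    (D.compat T) (D.degree_two T) t η deg hdeg (fun α hα f hf => by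
      have : α ∈ ComplexityTest.supportVariety A D T := by
        rw [hT]
        rintro _ ⟨i, rfl⟩
        exact hα i
      exact this f hf)
  simpa only [finrank_ext] using this

theorem exists_ops_completion (hA : ComplexityTest.IsCompleteIntersection A) : IsNoetherianRing (ComplexityTest.Completion A) ∧ 
    ∃ r, ∃ ω : Fin r → CentralOp (ComplexityTest.Completion A),
      ∀ L N : ModuleCat.{u} (ComplexityTest.Completion A), Module.Finite (ComplexityTest.Completion A) L → Module.Finite (ComplexityTest.Completion A) N → FGE ω L N := by
  obtain ⟨Q, _, _, ⟨_, n, x, hx, hn⟩, g, hg, rs, hrs, hker⟩ := hA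
  exact ⟨isNoetherianRing_of_surjective Q _ g hg, exists_ops n x hx hn.le g hg rs hrs hker⟩

theorem main (c : ℕ) (hA : ComplexityTest.IsCompleteIntersection A)
    (D : ComplexityTest.SupportVarietyTheory A c)
    (M : Type u) [AddCommGroup M] [Module A M] [Module.Finite A M]
    (t : ℕ) (η : Fin t → MvPolynomial (Fin c) (IsLocalRing.ResidueField A))
    (deg : Fin t → ℕ)
    (hdeg : ∀ i, 0 < deg i ∧ (η i).IsHomogeneous (deg i))
    (T : Type u) [AddCommGroup T] [Module A T] [Module.Finite A T]
    (hT : ComplexityTest.supportVariety A D T = ComplexityTest.polyZeroLocus A c (Set.range η))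
    (hvanish : ∀ᶠ i in Filter.atTop, ComplexityTest.extVanish A M i T) :
    ComplexityTest.HasComplexityLE A M t := by
  obtain ⟨hB, r, ω, hω⟩ := exists_ops_completion hA
  let B := ComplexityTest.Completion A
  have hm : maximalIdeal B = (maximalIdeal A).map (algebraMap A B) := AdicCompletion.maximalIdeal_eq_map ..
  obtain ⟨F, hF⟩ := exists_minres (A := A) M
  -- the Bass numbers
  have hμ : ∃ C e : ℕ, ∀ q : ℕ, (q + 1) ^ c ≤ (c * q + 1) ^ t *
      (C * ∑ n ∈ Finset.range (2 * (c * q) + e), mu (ModuleCat.of A T) n) := by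
    obtain ⟨C, e, h1⟩ := hmu_of c D T t η deg hdeg hT
    have h2 : Bdd (mu (ModuleCat.of A T)) (fun n => nu A (Ext (ModuleCat.of A T) (ModuleCat.of A T) n)) := by
      have h3 := cmp_all ω (ModuleCat.of B (B ⊗[A] T)) hω (ModuleCat.of B (B ⊗[A] T)) (fun _ => ⊤) (fun _ _ _ _ => trivial)
      have h4 : (fun n => nu B (Ext (ModuleCat.of B (ResidueField B)) (ModuleCat.of B (B ⊗[A] T)) n)) = mu (ModuleCat.of A T) :=
        funext fun n => nu_ext_k_left (A := A) (B := B) hm T n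
      rw [← h4]
      refine h3.mono fun n => ?_
      rw [← nu_ext_baseChange (A := A) (B := B) T T n]
      exact (nu_congr Submodule.topEquiv).ge
    obtain ⟨C', e', h2⟩ := h2
    refine ⟨C * C', e + e', fun q => (h1 q).trans ?_⟩
    rw [mul_assoc C, ← add_assoc]
    exact Nat.mul_le_mul_left _ (Nat.mul_le_mul_left _ (h2 _))
  -- the vanishing
  obtain ⟨i0, hi0⟩ := Filter.eventually_atTop.1 hvanish
  obtain ⟨M', _, F', hF', hv', hb'⟩ := exists_shift (ModuleCat.of A T) i0 M F hF (fun i => by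
    have h : Subsingleton (ComplexityTest.extModule A M (i0 + i + 1) T) := hi0 _ (by omega)
    obtain ⟨e⟩ := ext_bridge (ModuleCat.of A M) (ModuleCat.of A T) (i0 + i + 1)
    exact e.symm.toEquiv.subsingleton_congr.2 h)
  have hprod := fun n => bass (ModuleCat.of A T) n M' F' hF' hv'
  have hw : ∃ C : ℝ, ∀ m : ℕ, ∑ n ∈ Finset.range m, (mu (ModuleCat.of A (M' →ₗ[A] T)) n : ℝ) ≤ C * ((m : ℝ) + 1) ^ c := by
    obtain ⟨C, hC⟩ := hw_of c D (ResidueField A × (M' →ₗ[A] T))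
    refine ⟨C, fun m => (Finset.sum_le_sum fun n _ => ?_).trans (hC m)⟩
    exact_mod_cast mu_le_nu (ModuleCat.of A (M' →ₗ[A] T)) n
  obtain ⟨C, hC0, hC⟩ := numerics c t F'.b _ _ hprod hw hμ
  -- growth
  have hEZ : EZ r (fun n => (F.b n : ℝ)) := by
    have h1 := EZ_betti ω (ModuleCat.of B (B ⊗[A] M)) (hω _ _ inferInstance inferInstance)
    have h2 : ∀ n, nu B (Ext (ModuleCat.of B (B ⊗[A] M)) (ModuleCat.of B (ResidueField B)) n) = F.b n := fun n =>
      (nu_ext_k_right (A := A) (B := B) hm M n).trans (F.nu_ext hF n)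
    have h3 : (fun n => (F.b n : ℝ)) =
        fun n => (nu B (Ext (ModuleCat.of B (B ⊗[A] M)) (ModuleCat.of B (ResidueField B)) n) : ℝ) :=
      funext fun n => by rw [h2]
    rw [h3]
    exact h1
  obtain ⟨a, ha⟩ := growth_of_EZ F.b hEZ (C + ∑ i ∈ Finset.range i0, (F.b i : ℝ)) t (fun m => by
    have h1 : ∑ i ∈ Finset.range m, (F.b i : ℝ) ≤ ∑ i ∈ Finset.range (i0 + m), (F.b i : ℝ) :=
      Finset.sum_le_sum_of_subset_of_nonneg (Finset.range_mono (by omega)) (fun _ _ _ => by positivity)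
    rw [Finset.sum_range_add] at h1
    have h2 := hC m
    simp only [hb', add_comm _ i0] at h2
    have h3 : (1 : ℝ) ≤ ((m : ℝ) + 1) ^ t := one_le_pow₀ (by linarith [(Nat.cast_nonneg m : (0:ℝ) ≤ m)])
    have h4 : (0 : ℝ) ≤ ∑ i ∈ Finset.range i0, (F.b i : ℝ) := Finset.sum_nonneg fun _ _ => by positivity
    nlinarith)
  exact ⟨⟨F.b, F.d, F.aug, F.surj, F.ex0, F.exs, hF⟩, a, ha⟩
end CT

/-- **Proposition (variety test)**: let `A` be a local complete intersection of
codimension `c`, let `M` be a finitely generated `A`-module, let `η_1, …, η_t` be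
homogeneous elements of positive degree in `H = k[χ_1, …, χ_c]`, and let `T` be a
finitely generated `A`-module whose support variety satisfies
`V(T) = V_H(η_1, …, η_t)`. If `Ext^i_A(M,T) = 0` for `i ≫ 0`, then `cx M ≤ t`. -/
theorem complexity_le_of_extVanish_against_variety_test_module
    (A : Type u) [CommRing A] [IsLocalRing A] [IsNoetherianRing A]
    (c : ℕ) (hA : IsCompleteIntersection A) (hcodim : HasCodim A c)
    (D : SupportVarietyTheory A c)
    (M : Type u) [AddCommGroup M] [Module A M] [Module.Finite A M]
    (t : ℕ) (η : Fin t → MvPolynomial (Fin c) (IsLocalRing.ResidueField A))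
    (deg : Fin t → ℕ)
    (hdeg : ∀ i, 0 < deg i ∧ (η i).IsHomogeneous (deg i))
    (T : Type u) [AddCommGroup T] [Module A T] [Module.Finite A T]
    (hT : supportVariety A D T = polyZeroLocus A c (Set.range η))
    (hvanish : ∀ᶠ i in Filter.atTop, extVanish A M i T) :
    complexity A M ≤ (t : ℕ∞) := by
  exact sInf_le ⟨t, rfl, CT.main c hA D M t η deg hdeg T hT hvanish⟩
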